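/- Multi-period Superhedging Theorem without options (Theorem 4.7): Assume NA(𝒫) holds, let φ ≥ 1 be a random variable on Ω, and let f : Ω → ℝ be upper semianalytic with |f| ≤ φ. Then sup_{Q∈𝒬_φ} E_Q[f] = π(f) := inf{x ∈ ℝ : ∃H ∈ ℋ such that x + (H·S)_T ≥ f 𝒫-q.s.}, where 𝒬_φ := {Q ∈ 𝒬 : E_Q[φ] < ∞}. -/

import Mathlib

open MeasureTheory Set Filter Topology
open scoped ENNReal NNReal

noncomputable section

namespace BN

/-- The universal completion of the ambient measurable structure on `α`:
a set is measurable iff it is null-measurable for every probability measure. -/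
def univComp (α : Type*) [MeasurableSpace α] : MeasurableSpace α where
  MeasurableSet' s := ∀ μ : Measure α, IsProbabilityMeasure μ → NullMeasurableSet s μ
  measurableSet_empty := fun _ _ => MeasurableSet.empty.nullMeasurableSet
  measurableSet_compl := fun _ hs μ hμ => (hs μ hμ).compl
  measurableSet_iUnion := fun _ hf μ hμ => NullMeasurableSet.iUnion fun i => hf i μ hμ

/-- `N` is `PP`-polar: it is contained in an `m`-measurable set which is null under
every `P ∈ PP`. -/
def IsPolar {α : Type*} [MeasurableSpace α] (PP : Set (Measure α)) (m : MeasurableSpace α)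
    (N : Set α) : Prop :=
  ∃ A : Set α, MeasurableSet[m] A ∧ N ⊆ A ∧ ∀ P ∈ PP, P A = 0

/-- A property holds `PP`-quasi surely if its complement is `PP`-polar. -/
def QuasiSure {α : Type*} [mα : MeasurableSpace α] (PP : Set (Measure α))
    (m : MeasurableSpace α) (p : α → Prop) : Prop :=
  @IsPolar α mα PP m {ω | ¬ p ω}

/-- Expectation of a real random variable, with the convention
`E[f] = E[f⁺] - E[f⁻]` and `∞ - ∞ = -∞` (which holds in `EReal`). -/
def expec {α : Type*} [MeasurableSpace α] (Q : Measure α) (f : α → ℝ) : EReal :=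
  ((∫⁻ x, ENNReal.ofReal (f x) ∂Q : ℝ≥0∞) : EReal)
    - ((∫⁻ x, ENNReal.ofReal (-f x) ∂Q : ℝ≥0∞) : EReal)

/-- Positive part of an extended real, valued in `ℝ≥0∞`. -/
def posE (x : EReal) : ℝ≥0∞ := if x = ⊤ then ⊤ else ENNReal.ofReal x.toReal

/-- Expectation of an extended-real random variable, with the convention
`E[f] = E[f⁺] - E[f⁻]` and `∞ - ∞ = -∞`. -/
def eexpec {α : Type*} [MeasurableSpace α] (Q : Measure α) (f : α → EReal) : EReal :=
  ((∫⁻ x, posE (f x) ∂Q : ℝ≥0∞) : EReal) - ((∫⁻ x, posE (-(f x)) ∂Q : ℝ≥0∞) : EReal)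

/-- A real-valued function is upper semianalytic if all its strict superlevel sets
are analytic. -/
def UpperSemianalytic {α : Type*} [TopologicalSpace α] (f : α → ℝ) : Prop :=
  ∀ c : ℝ, AnalyticSet {x | c < f x}

/-- An extended-real-valued function is upper semianalytic if all its strict
superlevel sets `{f > c}`, `c ∈ ℝ`, are analytic. -/
def UpperSemianalyticE {α : Type*} [TopologicalSpace α] (f : α → EReal) : Prop :=
  ∀ c : ℝ, AnalyticSet {x | (c : EReal) < f x}

/-- Convexity of a set of probability measures. -/
def ConvexPM {α : Type*} [MeasurableSpace α] (C : Set (ProbabilityMeasure α)) : Prop :=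
  ∀ μ ∈ C, ∀ ν ∈ C, ∀ a b : ℝ≥0∞, a + b = 1 →
    ∀ ξ : ProbabilityMeasure α, (ξ : Measure α) = a • (μ : Measure α) + b • (ν : Measure α) →
      ξ ∈ C

/-! ### The general (non-Polish) setting of Section 2 -/

section General

variable {Ω : Type*} [MeasurableSpace Ω]

/-- Predictability of a trading strategy `H` with respect to a filtration `F`:
the holding `H (u+1)` over the period `(u, u+1]` is `F u`-measurable. -/
def PredictableF (F : ℕ → MeasurableSpace Ω) (T d : ℕ) (H : ℕ → Ω → Fin d → ℝ) : Prop :=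
  ∀ u : ℕ, u < T → Measurable[F u] (H (u + 1))

/-- The final gain `(H · S)_T` from trading `H` in the stocks `S`. -/
def gainF {d : ℕ} (S : ℕ → Ω → Fin d → ℝ) (H : ℕ → Ω → Fin d → ℝ) (T : ℕ) (ω : Ω) : ℝ :=
  ∑ u : Fin T, ∑ i : Fin d, H (u + 1) ω i * (S (u + 1) ω i - S u ω i)

/-- The no-arbitrage condition `NA(PP)` (no options). -/
def NAF (F : ℕ → MeasurableSpace Ω) (T d : ℕ) (S : ℕ → Ω → Fin d → ℝ)
    (PP : Set (Measure Ω)) : Prop :=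
  ∀ H : ℕ → Ω → Fin d → ℝ, PredictableF F T d H →
    QuasiSure PP ‹MeasurableSpace Ω› (fun ω => 0 ≤ gainF S H T ω) →
      QuasiSure PP ‹MeasurableSpace Ω› (fun ω => gainF S H T ω = 0)

/-- The cone `𝒞` of claims superreplicable from zero initial capital. -/
def Cset (F : ℕ → MeasurableSpace Ω) (T d : ℕ) (S : ℕ → Ω → Fin d → ℝ) : Set (Ω → ℝ) :=
  {W | ∃ H : ℕ → Ω → Fin d → ℝ, PredictableF F T d H ∧
    ∃ K : Ω → ℝ, Measurable K ∧ (∀ ω, 0 ≤ K ω) ∧ ∀ ω, W ω = gainF S H T ω - K ω}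

/-- The superhedging price (no options), with values in `EReal` (`inf ∅ = +∞`). -/
def superPriceF (F : ℕ → MeasurableSpace Ω) (T d : ℕ) (S : ℕ → Ω → Fin d → ℝ)
    (PP : Set (Measure Ω)) (f : Ω → ℝ) : EReal :=
  sInf ((fun x : ℝ => (x : EReal)) ''
    {x : ℝ | ∃ H : ℕ → Ω → Fin d → ℝ, PredictableF F T d H ∧
      QuasiSure PP ‹MeasurableSpace Ω› (fun ω => f ω ≤ x + gainF S H T ω)})

end General

/-! ### The one-period setting of Section 3 -/

section OnePeriod

variable {Ω : Type*} [MeasurableSpace Ω] {d : ℕ}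

/-- One-period no-arbitrage condition `NA(PP)` for the increment `ΔS`. -/
def NA1 (PP : Set (Measure Ω)) (ΔS : Ω → Fin d → ℝ) : Prop :=
  ∀ y : Fin d → ℝ,
    QuasiSure PP ‹MeasurableSpace Ω› (fun ω => 0 ≤ ∑ i, y i * ΔS ω i) →
      QuasiSure PP ‹MeasurableSpace Ω› (fun ω => ∑ i, y i * ΔS ω i = 0)

/-- The martingale measures dominated by `PP` in the one-period market:
`𝒬 = {Q : Q ⋘ 𝒫, E_Q[ΔS] = 0}`. -/
def Q1set (PP : Set (Measure Ω)) (ΔS : Ω → Fin d → ℝ) : Set (Measure Ω) :=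
  {Q | IsProbabilityMeasure Q ∧ (∃ P ∈ PP, Q ≪ P) ∧
    ∀ i, expec Q (fun ω => ΔS ω i) = 0}

/-- One-period superhedging price, with values in `EReal` (`inf ∅ = +∞`). -/
def superPrice1 (PP : Set (Measure Ω)) (ΔS : Ω → Fin d → ℝ) (f : Ω → ℝ) : EReal :=
  sInf ((fun x : ℝ => (x : EReal)) ''
    {x : ℝ | ∃ H : Fin d → ℝ,
      QuasiSure PP ‹MeasurableSpace Ω› (fun ω => f ω ≤ x + ∑ i, H i * ΔS ω i)})

end OnePeriod

/-! ### The Polish multi-period setting -/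

section Polish

variable (Ω₁ : Type) [MeasurableSpace Ω₁]

/-- Restriction of a path up to time `t`. -/
def restr {T : ℕ} (t : ℕ) (h : t ≤ T) (ω : Fin T → Ω₁) : Fin t → Ω₁ :=
  fun i => ω (Fin.castLE h i)

/-- Universally measurable predictability: `H u` (the holding over `(u, u+1]`)
is a universally measurable function of the first `u` coordinates. -/
def Pred (d : ℕ) (H : (u : ℕ) → (Fin u → Ω₁) → Fin d → ℝ) : Prop :=
  ∀ u : ℕ, @Measurable _ _ (univComp (Fin u → Ω₁)) _ (H u)

/-- The gain `(H · S)_t = ∑_{u=1}^t H_u (S_u - S_{u-1})` up to time `t ≤ T`. -/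
def gain {T d : ℕ} (S : (t : ℕ) → (Fin t → Ω₁) → Fin d → ℝ)
    (H : (u : ℕ) → (Fin u → Ω₁) → Fin d → ℝ) (t : ℕ) (h : t ≤ T) (ω : Fin T → Ω₁) : ℝ :=
  ∑ u : Fin t, ∑ i : Fin d,
    H u (restr Ω₁ u (u.2.le.trans h) ω) i *
      (S (u + 1) (restr Ω₁ (u + 1) (Nat.succ_le_of_lt (u.2.trans_le h)) ω) i
        - S u (restr Ω₁ u (u.2.le.trans h) ω) i)

variable [TopologicalSpace Ω₁] [OpensMeasurableSpace Ω₁]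

/-- The set `PP = {P₀ ⊗ ⋯ ⊗ P_{t-1}}` of measures built from universally
measurable selectors of the one-step collections `𝒫_s(·)`. -/
def MeasFam (Pt : (t : ℕ) → (Fin t → Ω₁) → Set (ProbabilityMeasure Ω₁)) :
    (t : ℕ) → Set (Measure (Fin t → Ω₁))
  | 0 => {μ | μ = Measure.dirac Fin.elim0}
  | (t + 1) => {μ | ∃ ν ∈ MeasFam Pt t, ∃ κ : (Fin t → Ω₁) → ProbabilityMeasure Ω₁,
      @Measurable _ _ (univComp (Fin t → Ω₁)) (borel (ProbabilityMeasure Ω₁)) κ ∧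
      (∀ ω, κ ω ∈ Pt t ω) ∧
      μ = ν.bind (fun ω => Measure.map (Fin.snoc ω) (κ ω : Measure Ω₁))}

/-- The σ-field `ℱ_t` on `Ω = Ω₁^T`: the comap under the restriction map of the
universal completion of the Borel σ-field of `Ω₁^t`. -/
def filtr (T : ℕ) (t : ℕ) (h : t ≤ T) : MeasurableSpace (Fin T → Ω₁) :=
  MeasurableSpace.comap (restr Ω₁ t h) (univComp (Fin t → Ω₁))

/-- `S` is a `Q`-martingale with respect to the filtration `(ℱ_t)`. -/
def IsMartMeas {T d : ℕ} (S : (t : ℕ) → (Fin t → Ω₁) → Fin d → ℝ)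
    (Q : Measure (Fin T → Ω₁)) : Prop :=
  (∀ (t : ℕ) (h : t ≤ T) (i : Fin d), Integrable (fun ω => S t (restr Ω₁ t h ω) i) Q) ∧
  (∀ (t : ℕ) (h : t + 1 ≤ T) (i : Fin d) (A : Set (Fin T → Ω₁)),
    MeasurableSet[filtr Ω₁ T t ((Nat.le_succ t).trans h)] A →
      ∫ ω in A, S (t + 1) (restr Ω₁ (t + 1) h ω) i ∂Q
        = ∫ ω in A, S t (restr Ω₁ t ((Nat.le_succ t).trans h) ω) i ∂Q)

/-- The martingale measures `Q ⋘ PP` consistent with the option prices: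
`𝒬 = {Q ⋘ PP : S is a Q-martingale, E_Q[gⁱ] = 0}`. -/
def QSet {T d e : ℕ} (PP : Set (Measure (Fin T → Ω₁)))
    (S : (t : ℕ) → (Fin t → Ω₁) → Fin d → ℝ) (g : Fin e → (Fin T → Ω₁) → ℝ) :
    Set (Measure (Fin T → Ω₁)) :=
  {Q | IsProbabilityMeasure Q ∧ (∃ P ∈ PP, Q ≪ P) ∧ IsMartMeas Ω₁ S Q ∧
    ∀ i : Fin e, expec Q (g i) = 0}

/-- The no-arbitrage condition `NA(PP)` with semistatic trading in the stocks `S`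
and the options `g`. -/
def NA {T d e : ℕ} (PP : Set (Measure (Fin T → Ω₁)))
    (S : (t : ℕ) → (Fin t → Ω₁) → Fin d → ℝ) (g : Fin e → (Fin T → Ω₁) → ℝ) : Prop :=
  ∀ H : (u : ℕ) → (Fin u → Ω₁) → Fin d → ℝ, Pred Ω₁ d H → ∀ h : Fin e → ℝ,
    QuasiSure PP (univComp (Fin T → Ω₁))
      (fun ω => 0 ≤ gain Ω₁ S H T le_rfl ω + ∑ i, h i * g i ω) →
    QuasiSure PP (univComp (Fin T → Ω₁))
      (fun ω => gain Ω₁ S H T le_rfl ω + ∑ i, h i * g i ω = 0)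

/-- The minimal semistatic superhedging price, valued in `EReal` (`inf ∅ = +∞`). -/
def superPrice {T d e : ℕ} (PP : Set (Measure (Fin T → Ω₁)))
    (S : (t : ℕ) → (Fin t → Ω₁) → Fin d → ℝ) (g : Fin e → (Fin T → Ω₁) → ℝ)
    (f : (Fin T → Ω₁) → ℝ) : EReal :=
  sInf ((fun x : ℝ => (x : EReal)) ''
    {x : ℝ | ∃ H : (u : ℕ) → (Fin u → Ω₁) → Fin d → ℝ, ∃ h : Fin e → ℝ, Pred Ω₁ d H ∧
      QuasiSure PP (univComp (Fin T → Ω₁))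
        (fun ω => f ω ≤ x + gain Ω₁ S H T le_rfl ω + ∑ i, h i * g i ω)})

/-- `f` is replicable by semistatic trading. -/
def Replicable {T d e : ℕ} (PP : Set (Measure (Fin T → Ω₁)))
    (S : (t : ℕ) → (Fin t → Ω₁) → Fin d → ℝ) (g : Fin e → (Fin T → Ω₁) → ℝ)
    (f : (Fin T → Ω₁) → ℝ) : Prop :=
  ∃ x : ℝ, ∃ H : (u : ℕ) → (Fin u → Ω₁) → Fin d → ℝ, ∃ h : Fin e → ℝ, Pred Ω₁ d H ∧
    QuasiSure PP (univComp (Fin T → Ω₁))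
      (fun ω => x + gain Ω₁ S H T le_rfl ω + ∑ i, h i * g i ω = f ω)

/-- The one-period increment `ΔS_{t+1}(ω, ·)` of the stock, given history `ω ∈ Ω_t`. -/
def incr {d : ℕ} (S : (t : ℕ) → (Fin t → Ω₁) → Fin d → ℝ) (t : ℕ) (ω : Fin t → Ω₁)
    (x : Ω₁) : Fin d → ℝ :=
  fun i => S (t + 1) (Fin.snoc ω x) i - S t ω i

/-- The one-step martingale measures `𝒬_t(ω)` dominated by `𝒫_t(ω)`. -/
def Q1fam {d : ℕ} (Pt : (t : ℕ) → (Fin t → Ω₁) → Set (ProbabilityMeasure Ω₁))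
    (S : (t : ℕ) → (Fin t → Ω₁) → Fin d → ℝ) (t : ℕ) (ω : Fin t → Ω₁) :
    Set (ProbabilityMeasure Ω₁) :=
  {Q | (∃ P' ∈ Pt t ω, (Q : Measure Ω₁) ≪ (P' : Measure Ω₁)) ∧
    ∀ i, expec (Q : Measure Ω₁) (fun x => incr Ω₁ S t ω x i) = 0}

/-- `V` is a `Q`-supermartingale with respect to the filtration `(ℱ_t)`:
each `V_t` is `Q`-integrable and `E_Q[V_{t+1} | ℱ_t] ≤ V_t`. -/
def IsSupermart {T : ℕ} (V : ℕ → (Fin T → Ω₁) → ℝ) (Q : Measure (Fin T → Ω₁)) : Prop :=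
  (∀ t : ℕ, t ≤ T → Integrable (V t) Q) ∧
  ∀ (t : ℕ) (h : t + 1 ≤ T) (A : Set (Fin T → Ω₁)),
    MeasurableSet[filtr Ω₁ T t ((Nat.le_succ t).trans h)] A →
      ∫ ω in A, V (t + 1) ω ∂Q ≤ ∫ ω in A, V t ω ∂Q

end Polish

/-! ### Quasi-sure supports -/

/-- The quasi-sure support of a family of measures on `ℝ^d`. -/
def qsSupp {d : ℕ} (Rs : Set (Measure (Fin d → ℝ))) : Set (Fin d → ℝ) :=
  ⋂₀ {A : Set (Fin d → ℝ) | IsClosed A ∧ ∀ R ∈ Rs, R A = 1}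

end BN

set_option linter.unusedSectionVars false

namespace BN

section UnivComp

variable {α β γ : Type*} [MeasurableSpace α] [MeasurableSpace β]

/-- Universally measurable sets. -/
abbrev USet (s : Set α) : Prop := MeasurableSet[univComp α] s

/-- Universally measurable maps. -/
abbrev UMeas [mγ : MeasurableSpace γ] (f : α → γ) : Prop := @Measurable α γ (univComp α) mγ f

lemma le_univComp : (inferInstance : MeasurableSpace α) ≤ univComp α :=
  fun _ hs _ _ => hs.nullMeasurableSet

lemma USet.of_measurable {s : Set α} (hs : MeasurableSet s) : USet s := le_univComp _ hs

lemma UMeas.of_measurable {mγ : MeasurableSpace γ} {f : α → γ} (hf : Measurable f) : UMeas f :=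
  fun _ hs => le_univComp _ (hf hs)

lemma USet.nullMeasurableSet {s : Set α} (hs : USet s) (μ : Measure α) [IsFiniteMeasure μ] :
    NullMeasurableSet s μ := by
  rcases eq_or_ne μ 0 with rfl | h
  · exact NullMeasurableSet.of_null (by simp)
  have : NeZero μ := ⟨h⟩
  have h1 := hs ((μ univ)⁻¹ • μ) inferInstance
  refine h1.mono_ac ?_
  refine Measure.AbsolutelyContinuous.mk fun t _ ht => ?_
  simpa [Measure.smul_apply, h, measure_ne_top] using ht

lemma UMeas.aemeasurable {mγ : MeasurableSpace γ} [MeasurableSpace.CountablyGenerated γ]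
    [Nonempty γ] {f : α → γ} (hf : UMeas f) (μ : Measure α) [IsFiniteMeasure μ] :
    AEMeasurable f μ :=
  NullMeasurable.aemeasurable fun _ hs => USet.nullMeasurableSet (hf hs) μ

lemma UMeas.of_aemeasurable {mγ : MeasurableSpace γ} {f : α → γ}
    (hf : ∀ μ : Measure α, IsProbabilityMeasure μ → AEMeasurable f μ) : UMeas f :=
  fun _ hs μ hμ => (hf μ hμ).nullMeasurable hs

lemma measurable_univComp {f : α → β} (hf : Measurable f) :
    @Measurable _ _ (univComp α) (univComp β) f := fun _ hs μ _ =>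
  (hs (μ.map f) (Measure.isProbabilityMeasure_map hf.aemeasurable)).preimage
    ⟨hf, Measure.AbsolutelyContinuous.rfl⟩

lemma UMeas.comp_measurable {mγ : MeasurableSpace γ} {g : β → γ} {f : α → β} (hg : UMeas g)
    (hf : Measurable f) : UMeas (g ∘ f) :=
  @Measurable.comp _ _ _ (univComp α) (univComp β) _ _ _ hg (measurable_univComp hf)

lemma USet.preimage {f : α → β} {s : Set β} (hs : USet s) (hf : Measurable f) :
    USet (f ⁻¹' s) := measurable_univComp hf hs

lemma UMeas.pi {ι : Type*} {δ : ι → Type*} [∀ i, MeasurableSpace (δ i)] {f : α → ∀ i, δ i}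
    (hf : ∀ i, UMeas fun x => f x i) : UMeas f := @measurable_pi_lambda _ _ _ (univComp α) _ _ hf

lemma UMeas.prodMk [MeasurableSpace γ] {f : α → β} {g : α → γ} (hf : UMeas f) (hg : UMeas g) :
    UMeas fun x => (f x, g x) := Measurable.prodMk (m := univComp α) hf hg

lemma UMeas.indicator [MeasurableSpace γ] [Zero γ] {f : α → γ} {s : Set α} (hf : UMeas f)
    (hs : USet s) : UMeas (s.indicator f) := Measurable.indicator hf hs

lemma UMeas.const [MeasurableSpace γ] (c : γ) : UMeas fun _ : α => c :=
  @measurable_const _ _ _ (univComp α) c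

lemma USet.umeas_indicator_one {s : Set α} (hs : USet s) :
    UMeas (s.indicator (1 : α → ℝ≥0∞)) := UMeas.indicator (UMeas.const 1) hs

end UnivComp

section Analytic

/-- The compact box of sequences dominated by `a`. -/
def box (a : ℕ → ℕ) : Set (ℕ → ℕ) := {b | ∀ n, b n ≤ a n}

lemma isCompact_box (a : ℕ → ℕ) : IsCompact (box a) := by
  have : box a = Set.pi univ fun n => Iic (a n) := by ext b; simp [box, Pi.le_def]
  rw [this]
  exact isCompact_univ_pi fun n => (finite_Iic (a n)).isCompact

/-- Sequences dominated by `a` before time `n`. -/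
def preBox (a : ℕ → ℕ) (n : ℕ) : Set (ℕ → ℕ) := {b | ∀ i < n, b i ≤ a i}

lemma exists_preBox_subset {a : ℕ → ℕ} {V : Set (ℕ → ℕ)} (hV : IsOpen V) (h : box a ⊆ V) :
    ∃ n, preBox a n ⊆ V := by
  by_contra! hc
  have hc' : ∀ n, ∃ b ∈ preBox a n, b ∉ V := fun n => not_subset.1 (hc n)
  choose b hb hbV using hc'
  obtain ⟨c, hc, φ, hφ, hlim⟩ := (isCompact_box a).tendsto_subseq
    (x := fun n => fun i => min (b n i) (a i)) (fun n i => min_le_right _ _)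
  have hlim' : Tendsto (fun n => b (φ n)) atTop (𝓝 c) := by
    rw [tendsto_pi_nhds] at hlim ⊢
    intro i
    refine (hlim i).congr' ?_
    filter_upwards [eventually_gt_atTop i] with n hn
    exact min_eq_left (hb (φ n) i (hn.trans_le (hφ.id_le n)))
  obtain ⟨n, hn⟩ := (hlim'.eventually (hV.mem_nhds (h hc))).exists
  exact hbV _ hn

variable {X : Type*} [TopologicalSpace X] [MeasurableSpace X]

lemma exists_box_measure_ge (μ : Measure X) [μ.OuterRegular] {g : (ℕ → ℕ) → X}
    (hg : Continuous g) {r : ℝ≥0∞} (hr : r < μ (range g)) : ∃ a, r ≤ μ (g '' box a) := by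
  have step : ∀ (A : Set (ℕ → ℕ)) (n : ℕ), r < μ (g '' A) →
      ∃ k, r < μ (g '' (A ∩ {b | b n ≤ k})) := by
    intro A n hA
    have h1 : g '' A = ⋃ k, g '' (A ∩ {b | b n ≤ k}) := by
      rw [← image_iUnion, ← inter_iUnion]
      congr 1
      refine (inter_eq_left.2 fun b _ => mem_iUnion.2 ⟨b n, ?_⟩).symm
      simp
    have hm : Monotone fun k => g '' (A ∩ {b | b n ≤ k}) := fun k l hkl =>
      image_mono (inter_subset_inter_right _ fun b (hb : b n ≤ k) => hb.trans hkl)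
    rw [h1, hm.measure_iUnion] at hA
    exact lt_iSup_iff.1 hA
  choose! K hK using step
  let A : ℕ → Set (ℕ → ℕ) := fun n =>
    Nat.rec univ (fun n A => A ∩ {b | b n ≤ K A n}) n
  let a : ℕ → ℕ := fun n => K (A n) n
  have hAs : ∀ n, A (n + 1) = A n ∩ {b | b n ≤ a n} := fun n => rfl
  have hA : ∀ n, A n = preBox a n := by
    intro n
    induction n with
    | zero => ext b; simp [A, preBox]
    | succ n ih =>
      rw [hAs, ih]
      ext b
      simp only [preBox, mem_inter_iff, mem_ofPred_eq, Nat.lt_succ_iff_lt_or_eq]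
      constructor
      · rintro ⟨h1, h2⟩ i (hi | rfl)
        exacts [h1 i hi, h2]
      · exact fun h => ⟨fun i hi => h i (Or.inl hi), h n (Or.inr rfl)⟩
  have hμ : ∀ n, r < μ (g '' A n) := by
    intro n
    induction n with
    | zero => simpa [A] using hr
    | succ n ih => rw [hAs]; exact hK _ _ ih
  refine ⟨a, ?_⟩
  rw [Set.measure_eq_iInf_isOpen]
  refine le_iInf fun U => le_iInf fun hU => le_iInf fun hUo => ?_
  obtain ⟨n, hn⟩ := exists_preBox_subset (hUo.preimage hg) (image_subset_iff.1 hU)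
  rw [← hA] at hn
  exact (hμ n).le.trans (measure_mono (image_subset_iff.2 hn))

variable [BorelSpace X]

lemma _root_.MeasureTheory.AnalyticSet.nullMeasurableSet [PolishSpace X] {A : Set X}
    (hA : AnalyticSet A) (μ : Measure X) [IsFiniteMeasure μ] : NullMeasurableSet A μ := by
  rw [AnalyticSet] at hA
  rcases hA with rfl | ⟨g, hg, rfl⟩
  · exact nullMeasurableSet_empty
  rcases eq_or_ne (μ (range g)) 0 with h0 | h0
  · exact NullMeasurableSet.of_null h0
  obtain ⟨u, -, hu, hlim⟩ := exists_seq_strictMono_tendsto' (pos_iff_ne_zero.2 h0)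
  choose a ha using fun n => exists_box_measure_ge μ hg (hu n).2
  have hB : MeasurableSet (⋃ n, g '' box (a n)) :=
    MeasurableSet.iUnion fun n => ((isCompact_box _).image hg).isClosed.measurableSet
  have hBA : (⋃ n, g '' box (a n)) ⊆ range g := iUnion_subset fun n => image_subset_range _ _
  have hle : μ (range g) ≤ μ (⋃ n, g '' box (a n)) :=
    le_of_tendsto' hlim fun n => (ha n).trans (measure_mono (subset_iUnion (fun n => g '' box (a n)) n))
  exact ⟨_, hB, ((ae_eq_of_subset_of_measure_ge hBA hle hB.nullMeasurableSet
    (measure_ne_top _ _))).symm⟩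

lemma _root_.MeasureTheory.AnalyticSet.uset [PolishSpace X] {A : Set X} (hA : AnalyticSet A) :
    USet A := fun μ _ => hA.nullMeasurableSet μ

end Analytic

section Selection

lemma measurable_nat_sInf {α : Type*} {m : MeasurableSpace α} {K : ℕ → Set α}
    (hK : ∀ k, MeasurableSet[m] (K k)) :
    @Measurable _ _ m _ (fun x => sInf {k | x ∈ K k}) := by
  refine measurable_to_countable' fun k => ?_
  have : (fun x => sInf {k | x ∈ K k}) ⁻¹' {k} =
      (K k ∩ ⋂ j : Fin k, (K j)ᶜ) ∪ {x | k = 0 ∧ ∀ j, x ∈ (K j)ᶜ} := by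
    ext x
    simp only [mem_preimage, mem_singleton_iff, mem_union, mem_inter_iff, mem_iInter, mem_compl_iff,
      mem_ofPred_eq]
    constructor
    · rintro rfl
      rcases eq_empty_or_nonempty {k | x ∈ K k} with h | h
      · exact Or.inr ⟨by simp [h], fun j hj => by
          have : j ∈ {k | x ∈ K k} := hj
          simp [h] at this⟩
      · exact Or.inl ⟨Nat.sInf_mem h, fun j hj => Nat.notMem_of_lt_sInf j.2 hj⟩
    · rintro (⟨h1, h2⟩ | ⟨rfl, h⟩)
      · refine le_antisymm (Nat.sInf_le h1) (le_csInf ⟨k, h1⟩ fun j hj => ?_)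
        by_contra hlt
        exact h2 ⟨j, not_le.1 hlt⟩ hj
      · simp [h]
  rw [this]
  refine ((hK k).inter (MeasurableSet.iInter fun j => (hK _).compl)).union ?_
  by_cases hk : k = 0
  · simp only [hk, true_and, ofPred_forall]
    exact MeasurableSet.iInter fun j => (hK j).compl
  · simp [hk]

variable {X : Type*}

/-- The lexicographically least point of the fibre of `w` over `x`. -/
def lexLeast (w : (ℕ → ℕ) → X) (x : X) : ℕ → ℕ
  | n => sInf {k | ∃ b, w b = x ∧ (∀ i : Fin n, b i = lexLeast w x i) ∧ b n = k}
termination_by n => n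
decreasing_by exact i.2

lemma lexLeast_approx {w : (ℕ → ℕ) → X} {x : X} (hx : x ∈ range w) (n : ℕ) :
    ∃ b, w b = x ∧ ∀ i < n, b i = lexLeast w x i := by
  induction n with
  | zero =>
    obtain ⟨b, hb⟩ := hx
    exact ⟨b, hb, by simp⟩
  | succ n ih =>
    obtain ⟨b, hb, hi⟩ := ih
    have hne : {k | ∃ b, w b = x ∧ (∀ i : Fin n, b i = lexLeast w x i) ∧ b n = k}.Nonempty :=
      ⟨b n, b, hb, fun i => hi i i.2, rfl⟩
    obtain ⟨c, hc, hci, hcn⟩ := Nat.sInf_mem hne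
    refine ⟨c, hc, fun i hi => ?_⟩
    rcases Nat.lt_succ_iff_lt_or_eq.1 hi with h | rfl
    · exact hci ⟨i, h⟩
    · rw [hcn, ← lexLeast]

variable [TopologicalSpace X]

lemma apply_lexLeast [T2Space X] {w : (ℕ → ℕ) → X} (hw : Continuous w) {x : X}
    (hx : x ∈ range w) : w (lexLeast w x) = x := by
  choose b hb hbi using lexLeast_approx hx
  have hlim : Tendsto b atTop (𝓝 (lexLeast w x)) := by
    rw [tendsto_pi_nhds]
    intro i
    refine tendsto_const_nhds.congr' ?_
    filter_upwards [eventually_gt_atTop i] with n hn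
    exact (hbi n i hn).symm
  have := (hw.tendsto _).comp hlim
  exact tendsto_nhds_unique this (by simp [Function.comp_def, hb])

variable [PolishSpace X] [MeasurableSpace X] [BorelSpace X]

lemma umeas_lexLeast {w : (ℕ → ℕ) → X} (hw : Continuous w) : UMeas (lexLeast w) := by
  refine UMeas.pi fun n => ?_
  induction n using Nat.strong_induction_on with
  | _ n ih =>
    have : (fun x => lexLeast w x n) = fun x => sInf {k | x ∈
        {x | ∃ b, w b = x ∧ (∀ i : Fin n, b i = lexLeast w x i) ∧ b n = k}} := by
      ext x
      conv_lhs => rw [lexLeast]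
      rfl
    rw [this]
    refine measurable_nat_sInf fun k => ?_
    have : {x | ∃ b, w b = x ∧ (∀ i : Fin n, b i = lexLeast w x i) ∧ b n = k} =
        ⋃ u : Fin n → ℕ, (⋂ i : Fin n, (fun x => lexLeast w x i) ⁻¹' {u i}) ∩
          w '' {b | (∀ i : Fin n, b i = u i) ∧ b n = k} := by
      ext x
      simp only [mem_ofPred_eq, mem_iUnion, mem_inter_iff, mem_iInter, mem_preimage,
        mem_singleton_iff, mem_image]
      constructor
      · rintro ⟨b, hb, hi, hk⟩
        exact ⟨fun i => lexLeast w x i, fun i => rfl, b, ⟨hi, hk⟩, hb⟩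
      · rintro ⟨u, hu, b, ⟨hi, hk⟩, hb⟩
        exact ⟨b, hb, fun i => by rw [hi, hu], hk⟩
    rw [this]
    refine MeasurableSet.iUnion fun u => MeasurableSet.inter ?_ ?_
    · exact MeasurableSet.iInter fun i => ih i i.2 (measurableSet_singleton _)
    · refine AnalyticSet.uset ?_
      refine AnalyticSet.image_of_continuous (IsClosed.analyticSet ?_) hw
      simp only [ofPred_and, ofPred_forall]
      refine IsClosed.inter (isClosed_iInter fun i => ?_) ?_
      · exact isClosed_eq (continuous_apply _) continuous_const
      · exact isClosed_eq (continuous_apply _) continuous_const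

/-- Jankov–von Neumann uniformization for continuous images of Polish spaces. -/
theorem exists_uniformization {Z : Type*} [TopologicalSpace Z] [PolishSpace Z] [Nonempty Z]
    [MeasurableSpace Z] [BorelSpace Z] {w : Z → X} (hw : Continuous w) :
    ∃ s : X → Z, UMeas s ∧ ∀ x ∈ range w, w (s x) = x := by
  obtain ⟨p, hp, hps⟩ := PolishSpace.exists_nat_nat_continuous_surjective Z
  refine ⟨fun x => p (lexLeast (w ∘ p) x), ?_, fun x hx => ?_⟩
  · exact hp.measurable.comp (umeas_lexLeast (hw.comp hp))
  · refine apply_lexLeast (hw.comp hp) (w := w ∘ p) ?_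
    rwa [hps.range_comp]

end Selection

section Active

variable {Θ X : Type*} [TopologicalSpace Θ] [PolishSpace Θ] [MeasurableSpace Θ] [BorelSpace Θ]
  [TopologicalSpace X] [PolishSpace X] [MeasurableSpace X] [BorelSpace X]

/-- The set of `ω` for which some `P ∈ PP ω` charges the section of `A`. -/
def active (PP : Θ → Set (ProbabilityMeasure X)) (A : Set (Θ × X)) : Set Θ :=
  {ω | ∃ P ∈ PP ω, 0 < (P : Measure X) (Prod.mk ω ⁻¹' A)}

/-- A continuous parametrization of the graph of a set-valued map. -/
structure GraphParam (PP : Θ → Set (ProbabilityMeasure X)) where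
  w : (ℕ → ℕ) → Θ
  p : (ℕ → ℕ) → ProbabilityMeasure X
  cw : Continuous w
  cp : Continuous p
  mem : ∀ b, p b ∈ PP (w b)
  surj : ∀ ω, ∀ P ∈ PP ω, ∃ b, w b = ω ∧ p b = P

lemma nonempty_graphParam [Nonempty Θ] {PP : Θ → Set (ProbabilityMeasure X)}
    (hne : ∀ ω, (PP ω).Nonempty)
    (h : AnalyticSet {q : Θ × ProbabilityMeasure X | q.2 ∈ PP q.1}) :
    Nonempty (GraphParam PP) := by
  rw [AnalyticSet] at h
  rcases h with h | ⟨q, hq, hr⟩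
  · obtain ⟨ω⟩ := ‹Nonempty Θ›
    obtain ⟨P, hP⟩ := hne ω
    have : (ω, P) ∈ ({q : Θ × ProbabilityMeasure X | q.2 ∈ PP q.1}) := hP
    simp [h] at this
  · refine ⟨⟨fun b => (q b).1, fun b => (q b).2, continuous_fst.comp hq, continuous_snd.comp hq,
      fun b => ?_, fun ω P hP => ?_⟩⟩
    · have : q b ∈ range q := mem_range_self b
      rw [hr] at this
      exact this
    · have : (ω, P) ∈ range q := by rw [hr]; exact hP
      obtain ⟨b, hb⟩ := this
      exact ⟨b, by simp [hb], by simp [hb]⟩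

lemma isClosed_measure_section_ge {w : (ℕ → ℕ) → Θ} {p : (ℕ → ℕ) → ProbabilityMeasure X}
    (hw : Continuous w) (hp : Continuous p) {g : (ℕ → ℕ) → Θ × X} (hg : Continuous g)
    (r : ℝ≥0∞) :
    IsClosed {z : (ℕ → ℕ) × (ℕ → ℕ) |
      r ≤ (p z.1 : Measure X) (Prod.mk (w z.1) ⁻¹' (g '' box z.2))} := by
  refine IsSeqClosed.isClosed fun z z₀ hz hlim => ?_
  obtain ⟨b₀, a₀⟩ := z₀
  have hb : Tendsto (fun n => (z n).1) atTop (𝓝 b₀) := (continuous_fst.tendsto _).comp hlim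
  have ha : Tendsto (fun n => (z n).2) atTop (𝓝 a₀) := (continuous_snd.tendsto _).comp hlim
  by_contra hlt
  rw [mem_ofPred_eq, not_le] at hlt
  have hK : IsClosed (Prod.mk (w b₀) ⁻¹' (g '' box a₀)) :=
    (((isCompact_box a₀).image hg).isClosed).preimage (by fun_prop)
  obtain ⟨W, hKW, hWo, hWr⟩ := Set.exists_isOpen_lt_of_lt _ _ hlt
  let _ := TopologicalSpace.upgradeIsCompletelyMetrizable X
  obtain ⟨U, hUo, hKU, hUW⟩ := normal_exists_closure_subset hK hWo hKW
  have key : ∀ᶠ n in atTop, Prod.mk (w (z n).1) ⁻¹' (g '' box (z n).2) ⊆ U := by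
    by_contra hc
    rw [not_eventually] at hc
    obtain ⟨φ, hφ, hφc⟩ := extraction_of_frequently_atTop hc
    choose x hx hxU using fun n => not_subset.1 (hφc n)
    choose c hc hgc using hx
    have hbd : ∀ i, BddAbove (range fun n => (z (φ n)).2 i) := fun i =>
      (((tendsto_pi_nhds.1 ha i).comp hφ.tendsto_atTop).bddAbove_range)
    choose M hM using hbd
    obtain ⟨e, -, ψ, hψ, hlime⟩ := (isCompact_box M).tendsto_subseq (x := c)
      (fun n i => (hc n i).trans (hM i (mem_range_self n)))
    have hψφ : Tendsto (fun n => φ (ψ n)) atTop atTop := hφ.tendsto_atTop.comp hψ.tendsto_atTop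
    have hebox : e ∈ box a₀ := fun i =>
      le_of_tendsto_of_tendsto' (tendsto_pi_nhds.1 hlime i)
        ((tendsto_pi_nhds.1 ha i).comp hψφ) fun n => hc (ψ n) i
    have hglim := (hg.tendsto e).comp hlime
    have hsnd : Tendsto (fun n => x (ψ n)) atTop (𝓝 (g e).2) := by
      refine ((continuous_snd.tendsto _).comp hglim).congr fun n => ?_
      simp [hgc]
    have hfst : Tendsto (fun n => w (z (φ (ψ n))).1) atTop (𝓝 (g e).1) := by
      refine ((continuous_fst.tendsto _).comp hglim).congr fun n => ?_
      simp [hgc]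
    have hfst' : w b₀ = (g e).1 :=
      tendsto_nhds_unique ((hw.tendsto b₀).comp (hb.comp hψφ)) hfst
    have hin : (g e).2 ∈ U := hKU ⟨e, hebox, by rw [hfst']⟩
    obtain ⟨n, hn⟩ := (hsnd.eventually (hUo.mem_nhds hin)).exists
    exact hxU _ hn
  have hpl : Tendsto (fun n => p (z n).1) atTop (𝓝 (p b₀)) := (hp.tendsto _).comp hb
  have h1 := ProbabilityMeasure.limsup_measure_closed_le_of_tendsto hpl
    (isClosed_closure (s := U))
  have h2 : r ≤ limsup (fun n => (p (z n).1 : Measure X) (closure U)) atTop := by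
    refine le_limsup_of_frequently_le ?_
    refine (key.mono fun n hn => ?_).frequently
    exact (hz n).trans (measure_mono (hn.trans subset_closure))
  exact absurd (h2.trans (h1.trans (measure_mono hUW))) (not_le.2 hWr)

lemma exists_box_section {P : Measure X} [IsProbabilityMeasure P] {ω : Θ} {g : (ℕ → ℕ) → Θ × X}
    (hg : Continuous g) {r : ℝ≥0∞} (hr : r < P (Prod.mk ω ⁻¹' range g)) :
    ∃ a, r ≤ P (Prod.mk ω ⁻¹' (g '' box a)) := by
  have hm : Measurable (Prod.mk ω : X → Θ × X) := by fun_prop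
  have : IsProbabilityMeasure (P.map (Prod.mk ω)) := Measure.isProbabilityMeasure_map hm.aemeasurable
  have hA : AnalyticSet (range g) := analyticSet_range_of_polishSpace hg
  rw [← Measure.map_apply₀ hm.aemeasurable (hA.nullMeasurableSet _)] at hr
  obtain ⟨a, ha⟩ := exists_box_measure_ge _ hg hr
  refine ⟨a, ?_⟩
  rwa [Measure.map_apply hm ((isCompact_box a).image hg).isClosed.measurableSet] at ha

theorem exists_active_selector {PP : Θ → Set (ProbabilityMeasure X)} (hne : ∀ ω, (PP ω).Nonempty)
    (G : GraphParam PP) {A : Set (Θ × X)} (hA : AnalyticSet A) :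
    AnalyticSet (active PP A) ∧ ∃ s : Θ → (ℕ → ℕ), UMeas s ∧ (∀ ω, G.w (s ω) = ω) ∧
      ∀ ω ∈ active PP A, 0 < (G.p (s ω) : Measure X) (Prod.mk ω ⁻¹' A) := by
  obtain ⟨s₀, hs₀, hws₀⟩ := exists_uniformization G.cw
  have hsurj : ∀ ω, G.w (s₀ ω) = ω := fun ω => by
    obtain ⟨P, hP⟩ := hne ω
    obtain ⟨b, hb, -⟩ := G.surj ω P hP
    exact hws₀ ω ⟨b, hb⟩
  rw [AnalyticSet] at hA
  rcases hA with rfl | ⟨g, hg, rfl⟩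
  · have : active PP (∅ : Set (Θ × X)) = ∅ := by ext ω; simp [active]
    rw [this]
    exact ⟨analyticSet_empty, s₀, hs₀, hsurj, by simp⟩
  let C : Set (ℕ × (ℕ → ℕ) × (ℕ → ℕ)) := {z | ((z.1 : ℝ≥0∞) + 1)⁻¹ ≤
    (G.p z.2.1 : Measure X) (Prod.mk (G.w z.2.1) ⁻¹' (g '' box z.2.2))}
  have hC : IsClosed C := by
    rw [← isOpen_compl_iff, isOpen_prod_iff]
    rintro m z hz
    refine ⟨{m}, {z : (ℕ → ℕ) × (ℕ → ℕ) | ((m : ℝ≥0∞) + 1)⁻¹ ≤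
        (G.p z.1 : Measure X) (Prod.mk (G.w z.1) ⁻¹' (g '' box z.2))}ᶜ, isOpen_discrete _,
        (isClosed_measure_section_ge G.cw G.cp hg _).isOpen_compl, rfl, hz, ?_⟩
    rintro ⟨m', z'⟩ ⟨rfl, hz'⟩
    exact hz'
  have hrange : active PP (range g) = range fun z : C => G.w z.1.2.1 := by
    ext ω
    constructor
    · rintro ⟨P, hP, hpos⟩
      obtain ⟨b, rfl, rfl⟩ := G.surj ω P hP
      obtain ⟨m, hm⟩ := ENNReal.exists_inv_nat_lt hpos.ne'
      have hm' : ((m : ℝ≥0∞) + 1)⁻¹ < (G.p b : Measure X) (Prod.mk (G.w b) ⁻¹' range g) :=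
        (ENNReal.inv_le_inv.2 le_self_add).trans_lt hm
      obtain ⟨a, ha⟩ := exists_box_section hg hm'
      exact ⟨⟨(m, b, a), ha⟩, rfl⟩
    · rintro ⟨⟨⟨m, b, a⟩, hz⟩, rfl⟩
      refine ⟨G.p b, G.mem b, ?_⟩
      have h0 : 0 < ((m : ℝ≥0∞) + 1)⁻¹ := by simp
      exact h0.trans_le (hz.trans (measure_mono (preimage_mono (image_subset_range _ _))))
  have : PolishSpace C := hC.polishSpace
  have hcont : Continuous fun z : C => G.w z.1.2.1 := G.cw.comp (by fun_prop)
  refine ⟨hrange ▸ analyticSet_range_of_polishSpace hcont, ?_⟩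
  rcases isEmpty_or_nonempty C with hem | hnem
  · refine ⟨s₀, hs₀, hsurj, fun ω hω => ?_⟩
    rw [hrange] at hω
    obtain ⟨z, -⟩ := hω
    exact (hem.false z).elim
  obtain ⟨s, hs, hws⟩ := exists_uniformization hcont
  have hE : USet (active PP (range g)) := (hrange ▸ analyticSet_range_of_polishSpace hcont :
    AnalyticSet (active PP (range g))).uset
  classical
  refine ⟨fun ω => if ω ∈ active PP (range g) then (s ω).1.2.1 else s₀ ω,
    Measurable.ite hE ?_ hs₀, fun ω => ?_, fun ω hω => ?_⟩
  · exact (show Measurable fun z : C => z.1.2.1 by fun_prop).comp hs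
  · by_cases h : ω ∈ active PP (range g)
    · simp only [h, if_true]
      exact hws ω (hrange ▸ h)
    · simp only [h, if_false, hsurj]
  · simp only [hω, if_true]
    have h1 := hws ω (hrange ▸ hω)
    have h2 := (s ω).2
    have h0 : 0 < (((s ω).1.1 : ℝ≥0∞) + 1)⁻¹ := by simp
    refine h0.trans_le (h2.trans ?_)
    rw [h1]
    exact measure_mono (preimage_mono (image_subset_range _ _))

end Active

section Kernels

open ProbabilityTheory

lemma exists_countable_piSystem (X : Type*) [m : MeasurableSpace X]
    [MeasurableSpace.CountablyGenerated X] :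
    ∃ C : Set (Set X), C.Countable ∧ IsPiSystem C ∧ m = MeasurableSpace.generateFrom C :=
  ⟨generateSetAlgebra (MeasurableSpace.countableGeneratingSet X),
    countable_generateSetAlgebra (MeasurableSpace.countable_countableGeneratingSet),
    fun _ hs _ ht _ => isSetAlgebra_generateSetAlgebra.inter_mem hs ht, by
      rw [generateFrom_generateSetAlgebra_eq,
        MeasurableSpace.generateFrom_countableGeneratingSet]⟩

variable {Θ X Y : Type*} [MeasurableSpace Θ] [MeasurableSpace X]
  [MeasurableSpace.CountablyGenerated X] [MeasurableSpace Y]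

lemma exists_kernel_ae_eq [Nonempty Θ] {K : Θ → Measure X} (hK : UMeas K)
    (hp : ∀ ω, IsProbabilityMeasure (K ω)) (μ : Measure Θ) [IsFiniteMeasure μ] :
    ∃ K' : Kernel Θ X, IsMarkovKernel K' ∧ ∀ᵐ ω ∂μ, K ω = K' ω := by
  obtain ⟨C, hCc, hCpi, hC⟩ := exists_countable_piSystem X
  have hCm : ∀ s ∈ C, MeasurableSet s := fun s hs => by
    rw [hC]; exact MeasurableSpace.measurableSet_generateFrom hs
  have h1 : ∀ s ∈ C, AEMeasurable (fun ω => K ω s) μ := fun s hs =>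
    UMeas.aemeasurable ((Measure.measurable_coe (hCm s hs)).comp hK) μ
  have h2 : ∀ᵐ ω ∂μ, ∀ s (hs : s ∈ C), K ω s = (h1 s hs).mk _ ω :=
    (ae_ball_iff hCc).2 fun s hs => (h1 s hs).ae_eq_mk
  obtain ⟨G, hGsub, hGm, hG⟩ := h2.exists_measurable_mem
  have ω₀ : Θ := Classical.arbitrary Θ
  classical
  have hpr : ∀ ω, IsProbabilityMeasure (if ω ∈ G then K ω else K ω₀) := fun ω => by
    split_ifs
    exacts [hp _, hp _]
  have hmeas : Measurable fun ω => if ω ∈ G then K ω else K ω₀ := by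
    refine Measurable.measure_of_isPiSystem_of_isProbabilityMeasure hC hCpi fun s hs => ?_
    have : (fun ω => (if ω ∈ G then K ω else K ω₀) s) =
        fun ω => if ω ∈ G then (h1 s hs).mk _ ω else K ω₀ s := by
      ext ω
      split_ifs with h
      · exact hG ω h s hs
      · rfl
    rw [this]
    exact Measurable.ite hGm (h1 s hs).measurable_mk measurable_const
  refine ⟨⟨fun ω => if ω ∈ G then K ω else K ω₀, hmeas⟩, ⟨hpr⟩, ?_⟩
  filter_upwards [hGsub] with ω hω
  exact (if_pos hω).symm

/-- The measure on `Y` obtained by drawing `ω` from `μ`, then `x` from `K ω`, and applying `e`. -/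
def stepM (e : Θ × X → Y) (μ : Measure Θ) (K : Θ → Measure X) : Measure Y :=
  μ.bind fun ω => (K ω).map fun x => e (ω, x)

variable {e : Θ × X → Y} {μ : Measure Θ} [IsProbabilityMeasure μ] {K : Θ → Measure X}

lemma aemeasurable_map_kernel (he : Measurable e) (hK : UMeas K)
    (hp : ∀ ω, IsProbabilityMeasure (K ω)) :
    AEMeasurable (fun ω => (K ω).map fun x => e (ω, x)) μ := by
  have := nonempty_of_isProbabilityMeasure μ
  obtain ⟨K', hK', hae⟩ := exists_kernel_ae_eq hK hp μ
  refine ⟨fun ω => (K' ω).map fun x => e (ω, x), ?_, ?_⟩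
  · refine Measure.measurable_of_measurable_coe _ fun s hs => ?_
    have : (fun ω => (K' ω).map (fun x => e (ω, x)) s) =
        fun ω => K' ω (Prod.mk ω ⁻¹' (e ⁻¹' s)) := by
      ext ω
      rw [Measure.map_apply (by fun_prop) hs]
      rfl
    rw [this]
    exact Kernel.measurable_kernel_prodMk_left (he hs)
  · filter_upwards [hae] with ω hω
    rw [hω]

lemma isProbabilityMeasure_stepM (he : Measurable e) (hK : UMeas K)
    (hp : ∀ ω, IsProbabilityMeasure (K ω)) : IsProbabilityMeasure (stepM e μ K) :=
  isProbabilityMeasure_bind (aemeasurable_map_kernel he hK hp) (ae_of_all _ fun _ =>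
    Measure.isProbabilityMeasure_map (he.comp measurable_prodMk_left).aemeasurable)

lemma lintegral_stepM (he : Measurable e) (hK : UMeas K) (hp : ∀ ω, IsProbabilityMeasure (K ω))
    {u : Y → ℝ≥0∞} (hu : UMeas u) :
    ∫⁻ y, u y ∂(stepM e μ K) = ∫⁻ ω, ∫⁻ x, u (e (ω, x)) ∂(K ω) ∂μ := by
  have := isProbabilityMeasure_stepM (μ := μ) he hK hp
  rw [stepM, Measure.lintegral_bind (aemeasurable_map_kernel he hK hp) (hu.aemeasurable (stepM e μ K))]
  refine lintegral_congr fun ω => ?_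
  have hm : Measurable fun x => e (ω, x) := he.comp measurable_prodMk_left
  have : IsProbabilityMeasure ((K ω).map fun x => e (ω, x)) :=
    Measure.isProbabilityMeasure_map hm.aemeasurable
  rw [lintegral_map' (hu.aemeasurable _) hm.aemeasurable]

lemma stepM_apply (he : Measurable e) (hK : UMeas K) (hp : ∀ ω, IsProbabilityMeasure (K ω))
    {A : Set Y} (hA : USet A) : stepM e μ K A = ∫⁻ ω, K ω {x | e (ω, x) ∈ A} ∂μ := by
  have := isProbabilityMeasure_stepM (μ := μ) he hK hp
  rw [← lintegral_indicator_one₀ (hA.nullMeasurableSet _),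
    lintegral_stepM he hK hp hA.umeas_indicator_one]
  refine lintegral_congr fun ω => ?_
  have hm : Measurable fun x => e (ω, x) := he.comp measurable_prodMk_left
  exact lintegral_indicator_one₀ (USet.nullMeasurableSet (hA.preimage hm) _)

lemma umeas_lintegral {K : Θ → Measure X} (hK : UMeas K)
    (hp : ∀ ω, IsProbabilityMeasure (K ω)) {u : Θ × X → ℝ≥0∞} (hu : UMeas u) :
    UMeas fun ω => ∫⁻ x, u (ω, x) ∂(K ω) := by
  refine UMeas.of_aemeasurable fun μ hμ => ?_
  have := nonempty_of_isProbabilityMeasure μ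
  obtain ⟨K', hK', hae⟩ := exists_kernel_ae_eq hK hp μ
  have hu' : AEMeasurable u (μ ⊗ₘ K') := hu.aemeasurable _
  refine ⟨fun ω => ∫⁻ x, hu'.mk u (ω, x) ∂(K' ω),
    hu'.measurable_mk.lintegral_kernel_prod_right', ?_⟩
  filter_upwards [hae, Measure.ae_ae_of_ae_compProd hu'.ae_eq_mk] with ω h1 h2
  rw [h1]
  exact lintegral_congr_ae h2

lemma umeas_measure_section {K : Θ → Measure X} (hK : UMeas K)
    (hp : ∀ ω, IsProbabilityMeasure (K ω)) {A : Set (Θ × X)} (hA : USet A) :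
    UMeas fun ω => K ω (Prod.mk ω ⁻¹' A) := by
  have h := umeas_lintegral hK hp hA.umeas_indicator_one
  refine (congrArg UMeas ?_).mp h
  ext ω
  rw [← lintegral_indicator_one₀ (USet.nullMeasurableSet (hA.preimage measurable_prodMk_left) _)]
  rfl

/-- A property with universally measurable extent holds almost surely for a two-step measure iff
it does so conditionally. -/
lemma ae_stepM_iff (he : Measurable e) (hK : UMeas K) (hp : ∀ ω, IsProbabilityMeasure (K ω))
    {p : Y → Prop} (hA : USet {y | p y}) :
    (∀ᵐ y ∂(stepM e μ K), p y) ↔ ∀ᵐ ω ∂μ, ∀ᵐ x ∂(K ω), p (e (ω, x)) := by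
  have hc : USet {y | ¬ p y} := hA.compl
  rw [ae_iff, stepM_apply he hK hp hc, lintegral_eq_zero_iff']
  · rfl
  · have := umeas_measure_section hK hp (hc.preimage he)
    exact this.aemeasurable μ

end Kernels

section Mixing

variable {X : Type*} [TopologicalSpace X] [PolishSpace X] [MeasurableSpace X] [BorelSpace X]

lemma measurable_toMeasure_borel :
    @Measurable (ProbabilityMeasure X) (Measure X) (borel _) _ (fun P => (P : Measure X)) := by
  let _ : MeasurableSpace (ProbabilityMeasure X) := borel _
  have : BorelSpace (ProbabilityMeasure X) := ⟨rfl⟩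
  refine Measurable.measure_of_isPiSystem_of_isProbabilityMeasure
    (BorelSpace.measurable_eq (α := X)) isPiSystem_isOpen fun U hU => ?_
  refine LowerSemicontinuous.measurable fun P y hy => ?_
  have h := ProbabilityMeasure.le_liminf_measure_open_of_tendsto (L := 𝓝 P) (μs := id) tendsto_id hU
  exact eventually_lt_of_lt_liminf (hy.trans_le h)

lemma umeas_toMeasure {Θ : Type*} [MeasurableSpace Θ] {κ : Θ → ProbabilityMeasure X}
    (hκ : @Measurable _ _ (univComp Θ) (borel (ProbabilityMeasure X)) κ) :
    UMeas fun ω => (κ ω : Measure X) :=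
  @Measurable.comp _ _ _ (univComp Θ) (borel _) _ _ _ measurable_toMeasure_borel hκ

/-- The equal-weight mixture of two probability measures. -/
def mix (P Q : ProbabilityMeasure X) : ProbabilityMeasure X :=
  ⟨(2⁻¹ : ℝ≥0∞) • (P : Measure X) + (2⁻¹ : ℝ≥0∞) • (Q : Measure X),
    ⟨by simp [ENNReal.inv_two_add_inv_two]⟩⟩

lemma coe_mix (P Q : ProbabilityMeasure X) :
    (mix P Q : Measure X) = (2⁻¹ : ℝ≥0∞) • (P : Measure X) + (2⁻¹ : ℝ≥0∞) • (Q : Measure X) := rfl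

lemma continuous_mix {Z : Type*} [TopologicalSpace Z] {P Q : Z → ProbabilityMeasure X}
    (hP : Continuous P) (hQ : Continuous Q) : Continuous fun z => mix (P z) (Q z) := by
  rw [ProbabilityMeasure.continuous_iff_forall_continuous_integral] at *
  intro f
  have : (fun z => ∫ x, f x ∂(mix (P z) (Q z) : Measure X)) =
      fun z => (2⁻¹ : ℝ) * ∫ x, f x ∂(P z : Measure X) + (2⁻¹ : ℝ) * ∫ x, f x ∂(Q z : Measure X) := by
    ext z
    rw [coe_mix, integral_add_measure, integral_smul_measure, integral_smul_measure]
    · simp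
    · exact (f.integrable _).smul_measure (by simp)
    · exact (f.integrable _).smul_measure (by simp)
  rw [this]
  exact (continuous_const.mul (hP f)).add (continuous_const.mul (hQ f))

lemma ConvexPM.mix_mem {C : Set (ProbabilityMeasure X)} (hC : ConvexPM C)
    {P Q : ProbabilityMeasure X} (hP : P ∈ C) (hQ : Q ∈ C) : mix P Q ∈ C :=
  hC P hP Q hQ 2⁻¹ 2⁻¹ ENNReal.inv_two_add_inv_two _ rfl

lemma absolutelyContinuous_mix_left (P Q : ProbabilityMeasure X) :
    (P : Measure X) ≪ (mix P Q : Measure X) := by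
  rw [coe_mix]
  refine Measure.AbsolutelyContinuous.mk fun s _ hs => ?_
  simp only [Measure.coe_add, Measure.coe_smul, Pi.add_apply, Pi.smul_apply, smul_eq_mul,
    add_eq_zero, mul_eq_zero, ENNReal.inv_eq_zero, ENNReal.ofNat_ne_top, false_or] at hs
  exact hs.1

lemma absolutelyContinuous_mix_right (P Q : ProbabilityMeasure X) :
    (Q : Measure X) ≪ (mix P Q : Measure X) := by
  rw [coe_mix]
  refine Measure.AbsolutelyContinuous.mk fun s _ hs => ?_
  simp only [Measure.coe_add, Measure.coe_smul, Pi.add_apply, Pi.smul_apply, smul_eq_mul,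
    add_eq_zero, mul_eq_zero, ENNReal.inv_eq_zero, ENNReal.ofNat_ne_top, false_or] at hs
  exact hs.2

/-- Iterated mixtures dominating the first `n + 1` terms of a sequence. -/
def mixSeq (P : ℕ → ProbabilityMeasure X) : ℕ → ProbabilityMeasure X
  | 0 => P 0
  | n + 1 => mix (mixSeq P n) (P (n + 1))

lemma absolutelyContinuous_mixSeq (P : ℕ → ProbabilityMeasure X) {j n : ℕ} (h : j ≤ n) :
    (P j : Measure X) ≪ (mixSeq P n : Measure X) := by
  induction n with
  | zero =>
    obtain rfl : j = 0 := by omega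
    exact Measure.AbsolutelyContinuous.rfl
  | succ n ih =>
    rcases Nat.lt_succ_iff_lt_or_eq.1 (Nat.lt_succ_of_le h) with h' | rfl
    · exact (ih (Nat.lt_succ_iff.1 h')).trans (absolutelyContinuous_mix_left _ _)
    · exact absolutelyContinuous_mix_right _ _

lemma ConvexPM.mixSeq_mem {C : Set (ProbabilityMeasure X)} (hC : ConvexPM C)
    {P : ℕ → ProbabilityMeasure X} (hP : ∀ n, P n ∈ C) (n : ℕ) : mixSeq P n ∈ C := by
  induction n with
  | zero => exact hP 0
  | succ n ih => exact hC.mix_mem ih (hP _)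

lemma measurable_borel_mixSeq {Θ : Type*} [MeasurableSpace Θ]
    {p : (ℕ → ℕ) → ProbabilityMeasure X} (hp : Continuous p) {s : ℕ → Θ → ℕ → ℕ}
    (hs : ∀ n, UMeas (s n)) {N : Θ → ℕ} (hN : UMeas N) :
    @Measurable _ _ (univComp Θ) (borel (ProbabilityMeasure X))
      (fun ω => mixSeq (fun n => p (s n ω)) (N ω)) := by
  let _ : MeasurableSpace (ProbabilityMeasure X) := borel _
  have : BorelSpace (ProbabilityMeasure X) := ⟨rfl⟩
  have hc : ∀ n, Continuous fun b : ℕ → ℕ → ℕ => mixSeq (fun n => p (b n)) n := by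
    intro n
    induction n with
    | zero => exact hp.comp (continuous_apply 0)
    | succ n ih => exact continuous_mix ih (hp.comp (continuous_apply (n + 1)))
  have hm : Measurable fun q : (ℕ → ℕ → ℕ) × ℕ => mixSeq (fun n => p (q.1 n)) q.2 :=
    measurable_from_prod_countable_left fun n => (hc n).measurable
  exact hm.comp (UMeas.prodMk (UMeas.pi hs) hN)

end Mixing

section ConstraintSelection

variable {Θ E : Type*} [mΘ : MeasurableSpace Θ] [MetricSpace E] [ProperSpace E] [Nonempty E]
  [MeasurableSpace E] [BorelSpace E]

lemma exists_le_zero_closedBall_iff {g : E → ℝ} (hg : Continuous g) (q : E) (r : ℝ) :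
    (∃ y ∈ Metric.closedBall q r, g y ≤ 0) ↔ ∀ N : ℕ, ∃ n : ℕ,
      dist (TopologicalSpace.denseSeq E n) q < r + 1 / (N + 1) ∧
        g (TopologicalSpace.denseSeq E n) < 1 / (N + 1) := by
  constructor
  · rintro ⟨y, hy, hgy⟩ N
    have hN : (0 : ℝ) < 1 / (N + 1) := by positivity
    have ho : IsOpen {z | dist z q < r + 1 / (N + 1) ∧ g z < 1 / (N + 1)} :=
      IsOpen.inter (s := {z | dist z q < r + 1 / (N + 1)}) (t := {z | g z < 1 / (N + 1)})
        (isOpen_lt (continuous_id.dist continuous_const) continuous_const)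
        (isOpen_lt hg continuous_const)
    exact (TopologicalSpace.denseRange_denseSeq E).exists_mem_open ho
      ⟨y, by have := Metric.mem_closedBall.1 hy; linarith, by linarith⟩
  · intro h
    choose n hn1 hn2 using h
    have hmem : ∀ N, TopologicalSpace.denseSeq E (n N) ∈ Metric.closedBall q (r + 1) := by
      intro N
      have h1 : (1 : ℝ) / (N + 1) ≤ 1 := by
        rw [div_le_one (by positivity)]
        have : (0 : ℝ) ≤ N := Nat.cast_nonneg N
        linarith
      exact Metric.mem_closedBall.2 (by linarith [hn1 N])
    obtain ⟨y, -, φ, hφ, hlim⟩ := (isCompact_closedBall q (r + 1)).tendsto_subseq hmem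
    have h0 : Tendsto (fun N => (1 : ℝ) / ((φ N : ℝ) + 1)) atTop (𝓝 0) :=
      tendsto_one_div_add_atTop_nhds_zero_nat.comp hφ.tendsto_atTop
    refine ⟨y, ?_, ?_⟩
    · have h1 : Tendsto (fun N => r + (1 : ℝ) / ((φ N : ℝ) + 1)) atTop (𝓝 (r + 0)) :=
        h0.const_add r
      rw [add_zero] at h1
      exact Metric.mem_closedBall.2 (le_of_tendsto_of_tendsto' (hlim.dist tendsto_const_nhds) h1
        fun N => (hn1 (φ N)).le)
    · exact le_of_tendsto_of_tendsto' ((hg.tendsto y).comp hlim) h0 fun N => (hn2 (φ N)).le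

/-- Carathéodory functions: measurable in the parameter and continuous in the variable. -/
structure IsCarath (g : Θ → E → ℝ) : Prop where
  meas : ∀ y, Measurable fun θ => g θ y
  cont : ∀ θ, Continuous (g θ)

lemma IsCarath.measurableSet_closedBall {g : Θ → E → ℝ} (hg : IsCarath g) (q : E) (r : ℝ) :
    MeasurableSet {θ | ∃ y ∈ Metric.closedBall q r, g θ y ≤ 0} := by
  simp only [exists_le_zero_closedBall_iff (hg.cont _), ofPred_forall, ofPred_exists, ofPred_and]
  refine MeasurableSet.iInter fun N => MeasurableSet.iUnion fun n => MeasurableSet.inter ?_ ?_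
  · exact MeasurableSet.const _
  · exact measurableSet_lt (hg.meas _) measurable_const

lemma IsCarath.measurableSet_nonempty {g : Θ → E → ℝ} (hg : IsCarath g) :
    MeasurableSet {θ | ∃ y, g θ y ≤ 0} := by
  have q : E := Classical.arbitrary E
  have : {θ | ∃ y, g θ y ≤ 0} = ⋃ R : ℕ, {θ | ∃ y ∈ Metric.closedBall q R, g θ y ≤ 0} := by
    ext θ
    simp only [mem_ofPred_eq, mem_iUnion]
    constructor
    · rintro ⟨y, hy⟩
      obtain ⟨R, hR⟩ := exists_nat_ge (dist y q)
      exact ⟨R, y, hR, hy⟩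
    · rintro ⟨R, y, -, hy⟩
      exact ⟨y, hy⟩
  rw [this]
  exact MeasurableSet.iUnion fun R => hg.measurableSet_closedBall q R

/-- Index of a dense point close to the constraint set. -/
def nearIdx (g : Θ → E → ℝ) (ε : ℝ) (θ : Θ) : ℕ :=
  sInf {n | θ ∈ {θ | ∃ y ∈ Metric.closedBall (TopologicalSpace.denseSeq E n) ε, g θ y ≤ 0}}

/-- A dense point close to the constraint set. -/
def nearPt (g : Θ → E → ℝ) (ε : ℝ) (θ : Θ) : E := TopologicalSpace.denseSeq E (nearIdx g ε θ)

lemma IsCarath.measurable_nearPt {g : Θ → E → ℝ} (hg : IsCarath g) (ε : ℝ) :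
    Measurable (nearPt g ε) := by
  have h1 : Measurable (nearIdx g ε) :=
    measurable_nat_sInf fun n => hg.measurableSet_closedBall _ ε
  exact (measurable_from_nat (f := TopologicalSpace.denseSeq E)).comp h1

lemma IsCarath.exists_near {g : Θ → E → ℝ} {ε : ℝ} (hε : 0 < ε) {θ : Θ}
    (h : ∃ y, g θ y ≤ 0) : ∃ y, max (g θ y) (dist y (nearPt g ε θ) - ε) ≤ 0 := by
  obtain ⟨y, hy⟩ := h
  obtain ⟨n, hn⟩ := (TopologicalSpace.denseRange_denseSeq E).exists_dist_lt y hε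
  have hne : {n | θ ∈ {θ | ∃ y ∈ Metric.closedBall (TopologicalSpace.denseSeq E n) ε,
      g θ y ≤ 0}}.Nonempty := ⟨n, y, hn.le, hy⟩
  obtain ⟨z, hz, hgz⟩ := Nat.sInf_mem hne
  exact ⟨z, max_le hgz (by have := Metric.mem_closedBall.1 hz; rw [nearPt, nearIdx]; linarith)⟩

/-- Successive refinements of a constraint around nearby dense points. -/
def refineC (g : Θ → E → ℝ) : ℕ → Θ → E → ℝ
  | 0 => g
  | k + 1 => fun θ y =>
    max (refineC g k θ y) (dist y (nearPt (refineC g k) ((1 / 2) ^ k) θ) - (1 / 2) ^ k)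

lemma IsCarath.refineC {g : Θ → E → ℝ} (hg : IsCarath g) (k : ℕ) : IsCarath (refineC g k) := by
  induction k with
  | zero => exact hg
  | succ k ih =>
    refine ⟨fun y => ?_, fun θ => ?_⟩
    · exact (ih.meas y).max ((measurable_const.dist (ih.measurable_nearPt _)).sub_const _)
    · exact (ih.cont θ).max ((continuous_id.dist continuous_const).sub continuous_const)

/-- Measurable selection from the sublevel sets of a Carathéodory function. -/
lemma IsCarath.exists_selector {g : Θ → E → ℝ} (hg : IsCarath g) :
    ∃ y : Θ → E, Measurable y ∧ ∀ θ, (∃ z, g θ z ≤ 0) → g θ (y θ) ≤ 0 := by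
  classical
  set u : ℕ → Θ → E := fun k => nearPt (BN.refineC g k) ((1 / 2) ^ k) with hu
  have hex : ∀ k θ, (∃ z, g θ z ≤ 0) → ∃ z, BN.refineC g k θ z ≤ 0 := by
    intro k θ h
    induction k with
    | zero => exact h
    | succ k ih => exact IsCarath.exists_near (by positivity) ih
  have hmono : ∀ k θ z, BN.refineC g k θ z ≤ 0 →
      g θ z ≤ 0 ∧ ∀ j < k, dist z (u j θ) ≤ (1 / 2) ^ j := by
    intro k θ z
    induction k with
    | zero => exact fun h => ⟨h, by simp⟩
    | succ k ih =>
      intro h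
      have h1 := max_le_iff.1 (show max _ _ ≤ (0 : ℝ) from h)
      refine ⟨(ih h1.1).1, fun j hj => ?_⟩
      rcases Nat.lt_succ_iff_lt_or_eq.1 hj with h' | rfl
      · exact (ih h1.1).2 j h'
      · exact sub_nonpos.1 h1.2
  have key : ∀ θ, (∃ z, g θ z ≤ 0) → ∃ y, Tendsto (fun k => u k θ) atTop (𝓝 y) ∧ g θ y ≤ 0 := by
    intro θ h
    choose z hz using fun k => hex (k + 1) θ h
    have hzd : ∀ k, ∀ j ≤ k, dist (z k) (u j θ) ≤ (1 / 2) ^ j := fun k j hj =>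
      (hmono (k + 1) θ (z k) (hz k)).2 j (Nat.lt_succ_of_le hj)
    have hc : CauchySeq fun k => u k θ := by
      refine cauchySeq_of_le_geometric (1 / 2) 2 (by norm_num) fun n => ?_
      have h1 := hzd (n + 1) n (Nat.le_succ n)
      have h2 := hzd (n + 1) (n + 1) le_rfl
      have h3 := dist_triangle_left (u n θ) (u (n + 1) θ) (z (n + 1))
      have h4 : ((1 : ℝ) / 2) ^ (n + 1) ≤ (1 / 2) ^ n :=
        pow_le_pow_of_le_one (by norm_num) (by norm_num) (Nat.le_succ n)
      linarith
    obtain ⟨y, hy⟩ := cauchySeq_tendsto_of_complete hc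
    refine ⟨y, hy, ?_⟩
    have hz' : Tendsto z atTop (𝓝 y) := by
      refine hy.congr_dist ?_
      refine squeeze_zero (fun _ => dist_nonneg) (fun k => ?_)
        (tendsto_pow_atTop_nhds_zero_of_lt_one (r := (1 / 2 : ℝ)) (by norm_num) (by norm_num))
      rw [dist_comm]
      exact hzd k k le_rfl
    exact le_of_tendsto' (((hg.cont θ).tendsto y).comp hz') fun k => (hmono _ θ _ (hz k)).1
  have q : E := Classical.arbitrary E
  have hlim : ∀ θ, ∃ y, Tendsto (fun k => if ∃ z, g θ z ≤ 0 then u k θ else q) atTop (𝓝 y) ∧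
      ((∃ z, g θ z ≤ 0) → g θ y ≤ 0) := by
    intro θ
    by_cases h : ∃ z, g θ z ≤ 0
    · obtain ⟨y, hy, hgy⟩ := key θ h
      exact ⟨y, by simpa only [h, if_true] using hy, fun _ => hgy⟩
    · exact ⟨q, by simp only [h, if_false]; exact tendsto_const_nhds, fun h' => absurd h' h⟩
  choose y hy hgy using hlim
  refine ⟨y, ?_, hgy⟩
  refine measurable_of_tendsto_metrizable
    (f := fun k θ => if ∃ z, g θ z ≤ 0 then u k θ else q) (fun k => ?_) (tendsto_pi_nhds.2 hy)
  exact Measurable.ite hg.measurableSet_nonempty ((hg.refineC k).measurable_nearPt _)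
    measurable_const

/-- Aggregation of countably many Carathéodory constraints into one. -/
lemma exists_isCarath_forall {G : ℕ → Θ → E → ℝ} (hG : ∀ n, IsCarath (G n)) :
    ∃ g : Θ → E → ℝ, IsCarath g ∧ ∀ θ y, g θ y ≤ 0 ↔ ∀ n, G n θ y ≤ 0 := by
  let a : ℕ → Θ → E → ℝ := fun n θ y => (1 / 2) ^ n * min (max (G n θ y) 0) 1
  have ha0 : ∀ n θ y, 0 ≤ a n θ y := fun n θ y => by positivity
  have hab : ∀ n θ y, ‖a n θ y‖ ≤ (1 / 2) ^ n := fun n θ y => by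
    rw [Real.norm_of_nonneg (ha0 n θ y)]
    exact mul_le_of_le_one_right (by positivity) (min_le_right _ _)
  have hs : Summable fun n : ℕ => ((1 : ℝ) / 2) ^ n := summable_geometric_two
  have hsa : ∀ θ y, Summable fun n => a n θ y := fun θ y => Summable.of_norm_bounded hs (hab · θ y)
  refine ⟨fun θ y => ∑' n, a n θ y, ⟨fun y => ?_, fun θ => ?_⟩, fun θ y => ?_⟩
  · refine measurable_of_tendsto_metrizable (f := fun N θ => ∑ n ∈ Finset.range N, a n θ y)
      (fun N => ?_) (tendsto_pi_nhds.2 fun θ => (hsa θ y).hasSum.tendsto_sum_nat)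
    refine Finset.measurable_fun_sum _ fun n _ => ?_
    exact ((((hG n).meas y).max measurable_const).min measurable_const).const_mul _
  · refine continuous_tsum (fun n => ?_) hs (fun n y => hab n θ y)
    exact continuous_const.mul ((((hG n).cont θ).max continuous_const).min continuous_const)
  · constructor
    · intro h n
      have h1 : a n θ y ≤ 0 := ((hsa θ y).le_tsum n fun j _ => ha0 j θ y).trans h
      by_contra hlt
      have : 0 < a n θ y := by
        have : 0 < G n θ y := not_le.1 hlt
        positivity
      linarith
    · intro h
      refine le_of_eq ((tsum_congr fun n => ?_).trans tsum_zero)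
      simp [a, max_eq_right (h n)]

/-- Measurable selection of points satisfying countably many Carathéodory constraints. -/
theorem exists_constraint_selector {ι : Type*} [Countable ι] {G : ι → Θ → E → ℝ}
    (hG : ∀ i, IsCarath (G i)) :
    MeasurableSet {θ | ∃ y, ∀ i, G i θ y ≤ 0} ∧
    ∃ y : Θ → E, Measurable y ∧ ∀ θ, (∃ z, ∀ i, G i θ z ≤ 0) → ∀ i, G i θ (y θ) ≤ 0 := by
  rcases isEmpty_or_nonempty ι with h | h
  · exact ⟨by simp, fun _ => Classical.arbitrary E, measurable_const, by simp⟩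
  obtain ⟨e, he⟩ := exists_surjective_nat ι
  obtain ⟨g, hg, hiff⟩ := exists_isCarath_forall fun n => hG (e n)
  have hiff' : ∀ θ y, g θ y ≤ 0 ↔ ∀ i, G i θ y ≤ 0 := fun θ y => by
    rw [hiff, he.forall]
  obtain ⟨y, hy, hyg⟩ := hg.exists_selector
  simp only [← hiff']
  exact ⟨hg.measurableSet_nonempty, y, hy, hyg⟩

end ConstraintSelection

section ConvexDuality

variable {ι W : Type*} [NormedAddCommGroup W] [NormedSpace ℝ W] [FiniteDimensional ℝ W]

/-- A finitely generated-type convex cone without proper supporting hyperplanes is everything. -/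
lemma exists_nonneg_linearCombination {v : ι → W} (hspan : Submodule.span ℝ (range v) = ⊤)
    (hNA : ∀ f : W →L[ℝ] ℝ, (∀ j, 0 ≤ f (v j)) → ∀ j, f (v j) = 0) (w : W) :
    ∃ μ : ι →₀ ℝ, 0 ≤ μ ∧ Finsupp.linearCombination ℝ v μ = w := by
  classical
  set K : Set W := Finsupp.linearCombination ℝ v '' {μ : ι →₀ ℝ | 0 ≤ μ} with hK
  have hKc : Convex ℝ K := by
    refine Convex.linear_image ?_ _
    intro x hx y hy a b ha hb _
    rw [mem_ofPred_eq] at hx hy ⊢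
    exact add_nonneg (smul_nonneg ha hx) (smul_nonneg hb hy)
  have hvK : ∀ j, v j ∈ K := fun j =>
    ⟨Finsupp.single j 1, Finsupp.single_nonneg.2 zero_le_one, by simp⟩
  have h0K : (0 : W) ∈ K := ⟨0, by simp, by simp⟩
  have hsmul : ∀ c : ℝ, 0 ≤ c → ∀ x ∈ K, c • x ∈ K := by
    rintro c hc _ ⟨μ, hμ, rfl⟩
    rw [mem_ofPred_eq] at hμ
    exact ⟨c • μ, mem_ofPred_eq ▸ smul_nonneg hc hμ, by simp⟩
  have hInteg : (interior K).Nonempty := by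
    rw [hKc.interior_nonempty_iff_affineSpan_eq_top]
    rw [← AffineSubspace.direction_eq_top_iff_of_nonempty ⟨0, subset_affineSpan ℝ K h0K⟩,
      direction_affineSpan, eq_top_iff, ← hspan]
    refine Submodule.span_le.2 ?_
    rintro _ ⟨j, rfl⟩
    have := vsub_mem_vectorSpan ℝ (hvK j) h0K
    simpa using this
  have h0 : (0 : W) ∈ interior K := by
    by_contra hnot
    obtain ⟨f, hf⟩ := geometric_hahn_banach_open_point hKc.interior isOpen_interior hnot
    rw [map_zero] at hf
    have hle : ∀ x ∈ K, f x ≤ 0 := by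
      intro x hx
      have hx' : x ∈ closure (interior K) := by
        rw [hKc.closure_interior_eq_closure_of_nonempty_interior hInteg]
        exact subset_closure hx
      exact closure_minimal (t := {x | f x ≤ 0}) (fun y hy => (hf y hy).le)
        (isClosed_le f.continuous continuous_const) hx'
    have hz := hNA (-f) (fun j => by simpa using hle _ (hvK j))
    obtain ⟨x, hx⟩ := hInteg
    obtain ⟨μ, -, hμ⟩ := interior_subset hx
    have : f x = 0 := by
      rw [← hμ, Finsupp.linearCombination_apply, Finsupp.sum, map_sum]
      refine Finset.sum_eq_zero fun j _ => ?_
      have := hz j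
      simp at this
      simp [this]
    linarith [hf x hx]
  have hnhds : K ∈ 𝓝 (0 : W) := mem_interior_iff_mem_nhds.1 h0
  have ht : Tendsto (fun n : ℕ => ((1 : ℝ) / (n + 1)) • w) atTop (𝓝 ((0 : ℝ) • w)) :=
    tendsto_one_div_add_atTop_nhds_zero_nat.smul_const w
  rw [zero_smul] at ht
  obtain ⟨n, hn⟩ := (ht.eventually hnhds).exists
  have hw := hsmul ((n : ℝ) + 1) (by positivity) _ hn
  rw [smul_smul, mul_one_div_cancel (by positivity), one_smul] at hw
  exact hw

lemma certificate_or_functional {v : ι → W} (hspan : Submodule.span ℝ (range v) = ⊤)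
    (hNA : ∀ f : W →L[ℝ] ℝ, (∀ j, 0 ≤ f (v j)) → ∀ j, f (v j) = 0) (b : ι → ℝ) :
    (∃ μ : ι →₀ ℝ, 0 ≤ μ ∧ Finsupp.linearCombination ℝ v μ = 0 ∧
      0 < Finsupp.linearCombination ℝ b μ) ∨ ∃ g : W →ₗ[ℝ] ℝ, ∀ j, b j ≤ g (v j) := by
  classical
  by_contra! hcon
  obtain ⟨hno, hhedge⟩ := hcon
  let s : PointedCone ℝ (W × ℝ) :=
    { carrier := {x | ∃ μ : ι →₀ ℝ, 0 ≤ μ ∧ Finsupp.linearCombination ℝ v μ = x.1 ∧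
        x.2 ≤ Finsupp.linearCombination ℝ b μ}
      add_mem' := by
        rintro x y ⟨μ, hμ, h1, h2⟩ ⟨ν, hν, h3, h4⟩
        exact ⟨μ + ν, add_nonneg hμ hν, by simp [h1, h3], by simpa using add_le_add h2 h4⟩
      zero_mem' := ⟨0, le_rfl, by simp, by simp⟩
      smul_mem' := by
        rintro ⟨c, hc⟩ x ⟨μ, hμ, h1, h2⟩
        refine ⟨c • μ, smul_nonneg hc hμ, ?_, ?_⟩
        · rw [map_smul, h1]; rfl
        · rw [map_smul]; exact mul_le_mul_of_nonneg_left h2 hc }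
  let f : (W × ℝ) →ₗ.[ℝ] ℝ :=
    { domain := LinearMap.ker (LinearMap.fst ℝ W ℝ)
      toFun := (-(LinearMap.snd ℝ W ℝ)).comp (Submodule.subtype _) }
  obtain ⟨g, hg, hgs⟩ := riesz_extension s f
    (by
      rintro ⟨x, hx⟩ ⟨μ, hμ, h1, h2⟩
      have hx0 : x.1 = 0 := hx
      have := hno μ hμ (h1.trans hx0)
      change 0 ≤ -x.2
      change x.2 ≤ _ at h2
      linarith)
    (by
      intro y
      obtain ⟨μ, hμ, h1⟩ := exists_nonneg_linearCombination hspan hNA y.1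
      refine ⟨⟨(0, Finsupp.linearCombination ℝ b μ - y.2), LinearMap.mem_ker.2 rfl⟩, μ, hμ, ?_, ?_⟩
      · simp [h1]
      · simp)
  have h01 : g (0, 1) = -1 := hg ⟨(0, 1), (rfl : ((0, 1) : W × ℝ).1 = 0)⟩
  obtain ⟨j, hj⟩ := hhedge (g.comp (LinearMap.inl ℝ W ℝ))
  have h1 := hgs (v j, b j) ⟨Finsupp.single j 1, Finsupp.single_nonneg.2 zero_le_one, by simp,
    by simp⟩
  have h2 : (v j, b j) = (v j, 0) + b j • ((0, 1) : W × ℝ) := by simp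
  rw [h2, map_add, map_smul, h01] at h1
  simp at hj h1
  linarith

variable {d : ℕ}

/-- Duality between normalized martingale certificates and hedges for countably supported
one-step models: either some convex combination of the points `v j` vanishes with value above `a`,
or the values are dominated by an affine function. -/
theorem certificate_or_hedge (v : ι → Fin d → ℝ) (p : ι → ℝ) (a : ℝ)
    (hNA : ∀ y : Fin d → ℝ, (∀ j, 0 ≤ ∑ i, y i * v j i) → ∀ j, ∑ i, y i * v j i = 0) :
    (∃ l : ι →₀ ℝ, (∀ j, 0 ≤ l j) ∧ (l.sum fun _ c => c) = 1 ∧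
      (∀ i, (l.sum fun j c => c * v j i) = 0) ∧ a < l.sum fun j c => c * p j) ∨
    ∃ y : Fin d → ℝ, ∀ j, p j ≤ a + ∑ i, y i * v j i := by
  classical
  set U := Submodule.span ℝ (range v) with hU
  let v' : ι → U := fun j => ⟨v j, Submodule.subset_span ⟨j, rfl⟩⟩
  have hspan : Submodule.span ℝ (range v') = ⊤ := by
    have := Submodule.span_span_coe_preimage (R := ℝ) (s := range v)
    convert this using 2
    ext x
    simp only [mem_range, mem_preimage, v', Subtype.ext_iff]
  have hrep : ∀ g : U →ₗ[ℝ] ℝ, ∃ y : Fin d → ℝ, ∀ j, g (v' j) = ∑ i, y i * v j i := by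
    intro g
    obtain ⟨h, hh⟩ := LinearMap.exists_extend g
    refine ⟨fun i => h (Pi.single i 1), fun j => ?_⟩
    have h1 : g (v' j) = h (v j) := by rw [← hh]; rfl
    rw [h1, LinearMap.pi_apply_eq_sum_univ h (v j)]
    refine Finset.sum_congr rfl fun i _ => ?_
    rw [smul_eq_mul, mul_comm]
    congr 2
    ext k
    simp [Pi.single_apply, eq_comm]
  rcases certificate_or_functional hspan (fun f hf => by
      obtain ⟨y, hy⟩ := hrep f.toLinearMap
      have := hNA y (fun j => by rw [← hy]; exact hf j)
      intro j
      have h2 := hy j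
      rw [this j] at h2
      exact h2) (fun j => p j - a) with ⟨μ, hμ, h1, h2⟩ | ⟨g, hg⟩
  · left
    have hvi : ∀ i, (μ.sum fun j c => c * v j i) = 0 := by
      intro i
      have := congrArg (fun x : U => (x : Fin d → ℝ) i) h1
      simpa [Finsupp.linearCombination_apply, Finsupp.sum, v'] using this
    have hb : 0 < (μ.sum fun j c => c * p j) - a * μ.sum fun _ c => c := by
      rw [Finsupp.linearCombination_apply] at h2
      refine h2.trans_le (le_of_eq ?_)
      simp only [Finsupp.sum, smul_eq_mul, Finset.mul_sum, ← Finset.sum_sub_distrib]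
      exact Finset.sum_congr rfl fun j _ => by ring
    set m := μ.sum fun _ c => c with hm
    have hm0 : 0 ≤ m := Finset.sum_nonneg fun j _ => hμ j
    have hmpos : 0 < m := by
      rcases hm0.lt_or_eq with h | h
      · exact h
      · exfalso
        have hz : ∀ j ∈ μ.support, μ j = 0 :=
          (Finset.sum_eq_zero_iff_of_nonneg fun j _ => hμ j).1 h.symm
        have : (μ.sum fun j c => c * p j) = 0 :=
          Finset.sum_eq_zero fun j hj => by simp [hz j hj]
        rw [this, ← h] at hb
        simp at hb
    have hsum : ∀ F : ι → ℝ, ((m⁻¹ • μ).sum fun j c => c * F j) =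
        m⁻¹ * μ.sum fun j c => c * F j := by
      intro F
      rw [Finsupp.sum_smul_index (fun i => by simp), Finsupp.mul_sum]
      exact Finset.sum_congr rfl fun j _ => by ring
    refine ⟨m⁻¹ • μ, fun j => mul_nonneg (inv_nonneg.2 hm0) (hμ j), ?_, fun i => ?_, ?_⟩
    · have := hsum fun _ => 1
      simp only [mul_one] at this
      rw [this, ← hm, inv_mul_cancel₀ hmpos.ne']
    · rw [hsum, hvi, mul_zero]
    · rw [hsum, ← div_eq_inv_mul, lt_div_iff₀ hmpos]
      linarith
  · right
    obtain ⟨y, hy⟩ := hrep g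
    exact ⟨y, fun j => by have := hg j; rw [hy] at this; linarith⟩

end ConvexDuality

section Cells

variable {d : ℕ}

/-- Centre of the `j`-th cell. -/
def ctr (d j : ℕ) : Fin d → ℝ :=
  TopologicalSpace.denseSeq (Fin d → ℝ) ((Denumerable.eqv (ℕ × ℕ × ℚ)).symm j).1

/-- Radius of the `j`-th cell. -/
def rad (j : ℕ) : ℝ := 1 / ((((Denumerable.eqv (ℕ × ℕ × ℚ)).symm j).2.1 : ℝ) + 1)

/-- Level of the `j`-th cell. -/
def lev (j : ℕ) : ℝ := (((Denumerable.eqv (ℕ × ℕ × ℚ)).symm j).2.2 : ℝ)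

lemma exists_cell_index (n k : ℕ) (c : ℚ) : ∃ j, ctr d j = TopologicalSpace.denseSeq _ n ∧
    rad j = 1 / ((k : ℝ) + 1) ∧ lev j = c :=
  ⟨Denumerable.eqv (ℕ × ℕ × ℚ) (n, k, c), by simp [ctr, rad, lev]⟩

/-- The points where `D` is close to the `j`-th centre and `F` exceeds the `j`-th level. -/
def cell {Z : Type*} (D : Z → Fin d → ℝ) (F : Z → EReal) (j : ℕ) : Set Z :=
  {z | dist (D z) (ctr d j) < rad j ∧ (lev j : EReal) < F z}

lemma exists_mem_cell {Z : Type*} (D : Z → Fin d → ℝ) (F : Z → EReal) {z : Z} {c : ℝ}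
    (hc : (c : EReal) < F z) (k : ℕ) :
    ∃ j, z ∈ cell D F j ∧ rad j = 1 / ((k : ℝ) + 1) ∧ c ≤ lev j := by
  obtain ⟨b, hcb, hb⟩ := EReal.lt_iff_exists_real_btwn.1 hc
  obtain ⟨q, hq1, hq2⟩ := exists_rat_btwn (EReal.coe_lt_coe_iff.1 hcb)
  obtain ⟨n, hn⟩ := (TopologicalSpace.denseRange_denseSeq (Fin d → ℝ)).exists_dist_lt (D z)
    (show (0 : ℝ) < 1 / ((k : ℝ) + 1) by positivity)
  obtain ⟨j, h1, h2, h3⟩ := exists_cell_index (d := d) n k q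
  refine ⟨j, ⟨by rw [h1, h2]; exact hn, ?_⟩, h2, by rw [h3]; exact hq1.le⟩
  rw [h3]
  exact (EReal.coe_lt_coe_iff.2 hq2).trans hb

end Cells

section FixedPoint

variable {X : Type*} [MeasurableSpace X] {d : ℕ}

/-- The affine function with slope `y` and intercept `a` dominates `p ∘ F` quasi surely, up to
left limits. -/
def IHedge (C : Set (ProbabilityMeasure X)) (D : X → Fin d → ℝ) (F : X → EReal) (p : ℝ → ℝ)
    (a : ℝ) (y : Fin d → ℝ) : Prop :=
  ∀ P ∈ C, ∀ᵐ x ∂(P : Measure X), ∀ c : ℝ, (c : EReal) < F x → p c ≤ a + ∑ i, y i * D x i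

/-- No arbitrage on the set where `F` is not `-∞`. -/
def INA (C : Set (ProbabilityMeasure X)) (D : X → Fin d → ℝ) (F : X → EReal) : Prop :=
  ∀ y, IHedge C D F 0 0 y → IHedge C D F 0 0 (-y)

/-- A family of probability measures concentrated on the charged cells. -/
structure AtomsAt (C : Set (ProbabilityMeasure X)) (D : X → Fin d → ℝ) (F : X → EReal)
    (A : Set ℕ) (R : ℕ → Measure X) : Prop where
  meas : Measurable D
  null : ∀ j ∉ A, ∀ P ∈ C, (P : Measure X) (cell D F j) = 0
  prob : ∀ j, IsProbabilityMeasure (R j)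
  dom : ∀ j, ∃ P ∈ C, R j ≪ (P : Measure X)
  ae_cell : ∀ j ∈ A, ∀ᵐ x ∂(R j), x ∈ cell D F j

/-- The barycentre of an atom. -/
def bary (D : X → Fin d → ℝ) (R : ℕ → Measure X) (j : ℕ) (i : Fin d) : ℝ := ∫ x, D x i ∂(R j)

/-- A convex combination of charged atoms, of mesh at least as fine as `1 / (k + 1)`, with centred
barycentre and value above `a`. -/
def Cert (D : X → Fin d → ℝ) (A : Set ℕ) (R : ℕ → Measure X) (p : ℝ → ℝ) (a : ℝ) (k : ℕ)
    (l : ℕ →₀ ℝ) : Prop :=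
  (∀ j ∈ l.support, j ∈ A ∧ rad j ≤ 1 / ((k : ℝ) + 1)) ∧ (∀ j, 0 ≤ l j) ∧
    (l.sum fun _ c => c) = 1 ∧ (∀ i, (l.sum fun j c => c * bary D R j i) = 0) ∧
    a < l.sum fun j c => c * p (lev j)

variable {C : Set (ProbabilityMeasure X)} {D : X → Fin d → ℝ} {F : X → EReal} {A : Set ℕ}
  {R : ℕ → Measure X}

namespace AtomsAt

lemma ae_mem (h : AtomsAt C D F A R) {P : ProbabilityMeasure X} (hP : P ∈ C) :
    ∀ᵐ x ∂(P : Measure X), ∀ j, x ∈ cell D F j → j ∈ A := by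
  rw [ae_all_iff]
  intro j
  by_cases hj : j ∈ A
  · exact ae_of_all _ fun _ _ => hj
  · have : ∀ᵐ x ∂(P : Measure X), x ∉ cell D F j := by
      simpa [ae_iff] using h.null j hj P hP
    filter_upwards [this] with x hx hx'
    exact absurd hx' hx

lemma ae_dist (h : AtomsAt C D F A R) {j : ℕ} (hj : j ∈ A) (i : Fin d) :
    ∀ᵐ x ∂(R j), |D x i - ctr d j i| ≤ rad j := by
  filter_upwards [h.ae_cell j hj] with x hx
  exact (dist_le_pi_dist (D x) (ctr d j) i).trans hx.1.le

lemma integrable (h : AtomsAt C D F A R) {j : ℕ} (hj : j ∈ A) (i : Fin d) :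
    Integrable (fun x => D x i) (R j) := by
  have := h.prob j
  refine Integrable.of_bound (C := |ctr d j i| + rad j)
    ((measurable_pi_apply i).comp h.meas).aestronglyMeasurable ?_
  filter_upwards [h.ae_dist hj i] with x hx
  rw [Real.norm_eq_abs]
  have := abs_sub_abs_le_abs_sub (D x i) (ctr d j i)
  linarith

lemma abs_bary_sub_le (h : AtomsAt C D F A R) {j : ℕ} (hj : j ∈ A) (i : Fin d) :
    |bary D R j i - ctr d j i| ≤ rad j := by
  have := h.prob j
  have h1 : bary D R j i - ctr d j i = ∫ x, (D x i - ctr d j i) ∂(R j) := by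
    rw [integral_sub (h.integrable hj i) (integrable_const _)]
    simp [bary]
  rw [h1]
  have := norm_integral_le_of_norm_le_const (μ := R j) (f := fun x => D x i - ctr d j i)
    (h.ae_dist hj i)
  simpa using this

lemma sum_bary (h : AtomsAt C D F A R) {j : ℕ} (hj : j ∈ A) (y : Fin d → ℝ) :
    Integrable (fun x => ∑ i, y i * D x i) (R j) ∧
    ∑ i, y i * bary D R j i = ∫ x, ∑ i, y i * D x i ∂(R j) := by
  have hi : ∀ i ∈ Finset.univ, Integrable (fun x => y i * D x i) (R j) :=
    fun i _ => (h.integrable hj i).const_mul _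
  refine ⟨integrable_finsetSum _ hi, ?_⟩
  rw [integral_finsetSum _ hi]
  exact Finset.sum_congr rfl fun i _ => (integral_const_mul _ _).symm

lemma iHedge (h : AtomsAt C D F A R) {p : ℝ → ℝ} (hp : Monotone p) {a : ℝ} {y : Fin d → ℝ}
    (k₀ : ℕ) (hy : ∀ j ∈ A, rad j ≤ 1 / ((k₀ : ℝ) + 1) →
      p (lev j) ≤ a + ∑ i, y i * bary D R j i) : IHedge C D F p a y := by
  intro P hP
  filter_upwards [h.ae_mem hP] with x hx c hc
  have key : ∀ k : ℕ, p c ≤ a + ∑ i, y i * D x i +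
      (∑ i, |y i|) * (2 * (1 / (((k + k₀ : ℕ) : ℝ) + 1))) := by
    intro k
    obtain ⟨j, hj, hr, hl⟩ := exists_mem_cell D F hc (k + k₀)
    have hjA := hx j hj
    have hr' : rad j ≤ 1 / ((k₀ : ℝ) + 1) := by
      rw [hr]
      gcongr
      exact Nat.le_add_left _ _
    have h1 := hy j hjA hr'
    have h2 : ∀ i, y i * bary D R j i ≤ y i * D x i + |y i| * (2 * rad j) := by
      intro i
      have h3 := h.abs_bary_sub_le hjA i
      have h4 : |D x i - ctr d j i| ≤ rad j := (dist_le_pi_dist (D x) (ctr d j) i).trans hj.1.le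
      have h5 : |bary D R j i - D x i| ≤ 2 * rad j := by
        have := abs_sub_le (bary D R j i) (ctr d j i) (D x i)
        rw [abs_sub_comm (ctr d j i)] at this
        linarith
      have h6 : y i * (bary D R j i - D x i) ≤ |y i| * (2 * rad j) :=
        (le_abs_self _).trans (by rw [abs_mul]; gcongr)
      linarith
    have h3 := Finset.sum_le_sum fun i (_ : i ∈ Finset.univ) => h2 i
    rw [Finset.sum_add_distrib, ← Finset.sum_mul, hr] at h3
    linarith [hp hl]
  have hlim : Tendsto (fun k : ℕ => a + ∑ i, y i * D x i +
      (∑ i, |y i|) * (2 * (1 / (((k + k₀ : ℕ) : ℝ) + 1)))) atTop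
      (𝓝 (a + ∑ i, y i * D x i + (∑ i, |y i|) * (2 * 0))) :=
    (((tendsto_one_div_add_atTop_nhds_zero_nat.comp (tendsto_add_atTop_nat k₀)).const_mul
      2).const_mul _).const_add _
  have := ge_of_tendsto' hlim key
  simpa using this

lemma le_of_iHedge (h : AtomsAt C D F A R) {p : ℝ → ℝ} {a : ℝ} {y : Fin d → ℝ}
    (hy : IHedge C D F p a y) {j : ℕ} (hj : j ∈ A) :
    p (lev j) ≤ a + ∑ i, y i * bary D R j i := by
  have := h.prob j
  obtain ⟨P, hP, hRP⟩ := h.dom j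
  obtain ⟨h1, h2⟩ := h.sum_bary hj y
  have h3 : ∀ᵐ x ∂(R j), p (lev j) ≤ a + ∑ i, y i * D x i := by
    filter_upwards [hRP.ae_le (hy P hP), h.ae_cell j hj] with x hx hc
    exact hx _ hc.2
  have h4 := integral_mono_ae (integrable_const _) ((integrable_const a).add h1) h3
  rw [integral_const, integral_add' (integrable_const a) h1, integral_const] at h4
  simpa [h2] using h4

lemma ina_of_bary (h : AtomsAt C D F A R)
    (hz : ∀ y : Fin d → ℝ, (∀ j ∈ A, 0 ≤ ∑ i, y i * bary D R j i) →
      ∀ j ∈ A, ∑ i, y i * bary D R j i = 0) : INA C D F := by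
  intro y hy
  have h1 := hz y fun j hj => by simpa using h.le_of_iHedge hy hj
  refine h.iHedge (p := 0) (fun _ _ _ => le_rfl) 0 fun j hj _ => ?_
  simp [h1 j hj]

lemma bary_eq_zero (h : AtomsAt C D F A R) (hNA : INA C D F) {y : Fin d → ℝ} {k : ℕ}
    (hy : ∀ j ∈ A, rad j ≤ 1 / ((k : ℝ) + 1) → 0 ≤ ∑ i, y i * bary D R j i) {j : ℕ}
    (hj : j ∈ A) : ∑ i, y i * bary D R j i = 0 := by
  have h1 : IHedge C D F 0 0 y := h.iHedge (p := 0) (fun _ _ _ => le_rfl) k fun j hj hr => by simpa using hy j hj hr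
  have h2 := h.le_of_iHedge h1 hj
  have h3 := h.le_of_iHedge (hNA y h1) hj
  simp at h2 h3
  linarith

lemma cert_or_iHedge (h : AtomsAt C D F A R) (hNA : INA C D F) {p : ℝ → ℝ} (hp : Monotone p)
    (a : ℝ) (k : ℕ) : (∃ l, Cert D A R p a k l) ∨ ∃ y, IHedge C D F p a y := by
  classical
  let J := {j // j ∈ A ∧ rad j ≤ 1 / ((k : ℝ) + 1)}
  rcases certificate_or_hedge (fun j : J => bary D R j) (fun j => p (lev j)) a
    (fun y hy j => h.bary_eq_zero hNA (fun j hj hr => hy ⟨j, hj, hr⟩) j.2.1) with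
    ⟨l, h0, h1, h2, h3⟩ | ⟨y, hy⟩
  · left
    let l' : ℕ →₀ ℝ := l.embDomain ⟨Subtype.val, Subtype.val_injective⟩
    have hsum : ∀ G : ℕ → ℝ → ℝ, l'.sum G = l.sum fun j c => G j c := fun G =>
      Finsupp.sum_embDomain
    refine ⟨l', fun j hj => ?_, fun j => ?_, by rw [hsum]; exact h1, fun i => by rw [hsum, h2],
      by rw [hsum]; exact h3⟩
    · rw [Finsupp.support_embDomain, Finset.mem_map] at hj
      obtain ⟨m, -, rfl⟩ := hj
      exact m.2
    · by_cases hj : j ∈ range (Subtype.val : J → ℕ)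
      · obtain ⟨m, rfl⟩ := hj
        exact (Finsupp.embDomain_apply_self _ l m).symm ▸ h0 m
      · exact (Finsupp.embDomain_of_notMem_range _ l _ hj).ge
  · exact Or.inr ⟨y, h.iHedge hp k fun j hj hr => hy ⟨j, hj, hr⟩⟩

lemma not_iHedge_of_cert (h : AtomsAt C D F A R) {p : ℝ → ℝ} {a : ℝ} {k : ℕ} {l : ℕ →₀ ℝ}
    (hl : Cert D A R p a k l) (y : Fin d → ℝ) : ¬ IHedge C D F p a y := by
  intro hy
  obtain ⟨h0, h1, h2, h3, h4⟩ := hl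
  have h5 : (l.sum fun j c => c * p (lev j)) ≤
      l.sum fun j c => c * a + ∑ i, y i * (c * bary D R j i) := by
    refine Finset.sum_le_sum fun j hj => ?_
    have := mul_le_mul_of_nonneg_left (h.le_of_iHedge hy (h0 j hj).1) (h1 j)
    refine this.trans (le_of_eq ?_)
    rw [mul_add, Finset.mul_sum]
    congr 1
    exact Finset.sum_congr rfl fun i _ => by ring
  have h6 : (l.sum fun j c => c * a + ∑ i, y i * (c * bary D R j i)) = a := by
    rw [Finsupp.sum_add, Finsupp.sum, ← Finset.sum_mul]
    change (l.sum fun _ c => c) * a + _ = a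
    rw [h2, one_mul, Finsupp.sum, Finset.sum_comm]
    simp only [← Finset.mul_sum]
    have : ∀ i, ∑ j ∈ l.support, l j * bary D R j i = 0 := h3
    simp [this]
  linarith

end AtomsAt

end FixedPoint

section Glue

variable {Θ γ : Type*} [MeasurableSpace Θ] [MeasurableSpace γ]

lemma UMeas.comp_nat {f : ℕ → Θ → γ} (hf : ∀ n, UMeas (f n)) {N : Θ → ℕ} (hN : UMeas N) :
    UMeas fun ω => f (N ω) ω := by
  intro t ht
  have : (fun ω => f (N ω) ω) ⁻¹' t = ⋃ n, (N ⁻¹' {n} ∩ f n ⁻¹' t) := by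
    ext ω
    simp
  rw [this]
  exact MeasurableSet.iUnion fun n => MeasurableSet.inter (hN (measurableSet_singleton n)) (hf n ht)

lemma UMeas.ite {f g : Θ → γ} {s : Set Θ} [DecidablePred (· ∈ s)] (hs : USet s) (hf : UMeas f) (hg : UMeas g) :
    UMeas fun ω => if ω ∈ s then f ω else g ω :=
  Measurable.ite (m := univComp Θ) hs hf hg

lemma USet.lt {δ : Type*} [TopologicalSpace δ] [MeasurableSpace δ] [OpensMeasurableSpace δ]
    [LinearOrder δ] [OrderClosedTopology δ] [SecondCountableTopology δ] {f g : Θ → δ}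
    (hf : UMeas f) (hg : UMeas g) : USet {ω | f ω < g ω} :=
  measurableSet_lt (mδ := univComp Θ) hf hg

lemma USet.le {δ : Type*} [TopologicalSpace δ] [MeasurableSpace δ] [OpensMeasurableSpace δ]
    [LinearOrder δ] [OrderClosedTopology δ] [SecondCountableTopology δ] {f g : Θ → δ}
    (hf : UMeas f) (hg : UMeas g) : USet {ω | f ω ≤ g ω} :=
  measurableSet_le (mδ := univComp Θ) hf hg

end Glue

section Kernels

variable {Θ X : Type*} [MeasurableSpace Θ] [MeasurableSpace X]
  [MeasurableSpace.CountablyGenerated X]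

lemma UMeas.section {γ : Type*} [MeasurableSpace γ] {u : Θ × X → γ} (hu : UMeas u) (ω : Θ) :
    UMeas fun x => u (ω, x) := hu.comp_measurable measurable_prodMk_left

lemma umeas_integral {K : Θ → Measure X} (hK : UMeas K)
    (hp : ∀ ω, IsProbabilityMeasure (K ω)) {u : Θ × X → ℝ} (hu : UMeas u) :
    UMeas fun ω => ∫ x, u (ω, x) ∂(K ω) := by
  classical
  have h1 : UMeas fun ω => ∫⁻ x, ENNReal.ofReal (u (ω, x)) ∂(K ω) :=
    umeas_lintegral (u := fun z => ENNReal.ofReal (u z)) hK hp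
      (ENNReal.measurable_ofReal.comp hu)
  have h2 : UMeas fun ω => ∫⁻ x, ENNReal.ofReal (-u (ω, x)) ∂(K ω) :=
    umeas_lintegral (u := fun z => ENNReal.ofReal (-u z)) hK hp
      (ENNReal.measurable_ofReal.comp (measurable_neg.comp hu))
  have h3 : UMeas fun ω => ∫⁻ x, ‖u (ω, x)‖ₑ ∂(K ω) :=
    umeas_lintegral (u := fun z => ‖u z‖ₑ) hK hp (measurable_enorm.comp hu)
  have : (fun ω => ∫ x, u (ω, x) ∂(K ω)) = fun ω =>
      if ω ∈ {ω | ∫⁻ x, ‖u (ω, x)‖ₑ ∂(K ω) < ⊤} then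
        (∫⁻ x, ENNReal.ofReal (u (ω, x)) ∂(K ω)).toReal -
          (∫⁻ x, ENNReal.ofReal (-u (ω, x)) ∂(K ω)).toReal
      else 0 := by
    ext ω
    have := hp ω
    have hm : AEStronglyMeasurable (fun x => u (ω, x)) (K ω) :=
      ((hu.section ω).aemeasurable _).aestronglyMeasurable
    split_ifs with h
    · exact integral_eq_lintegral_pos_part_sub_lintegral_neg_part ⟨hm, h⟩
    · exact integral_undef fun hi => h hi.2
  rw [this]
  refine UMeas.ite (USet.lt h3 (UMeas.const _)) ?_ (UMeas.const _)
  exact Measurable.sub (m := univComp Θ) (ENNReal.measurable_toReal.comp h1)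
    (ENNReal.measurable_toReal.comp h2)

/-- Conditioning a kernel on a charged cell, after a truncation making a given function bounded. -/
lemma exists_atom {P : Θ → Measure X} (hP : UMeas P) (hp : ∀ ω, IsProbabilityMeasure (P ω))
    {B : Set (Θ × X)} (hB : USet B) {Φ : Θ × X → ℝ} (hΦ : UMeas Φ) :
    ∃ (R : Θ → Measure X) (M : Θ → ℝ), UMeas R ∧ UMeas M ∧ (∀ ω, IsProbabilityMeasure (R ω)) ∧
      (∀ ω, R ω ≪ P ω) ∧ ∀ ω, 0 < P ω (Prod.mk ω ⁻¹' B) →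
        ∀ᵐ x ∂(R ω), (ω, x) ∈ B ∧ Φ (ω, x) ≤ M ω := by
  classical
  have hBk : ∀ k : ℕ, USet (B ∩ {z | Φ z ≤ k}) := fun k =>
    MeasurableSet.inter hB (USet.le hΦ (UMeas.const _))
  have hpos : ∀ k : ℕ, USet {ω | 0 < P ω (Prod.mk ω ⁻¹' (B ∩ {z | Φ z ≤ k}))} := fun k =>
    USet.lt (UMeas.const _) (umeas_measure_section hP hp (hBk k))
  let M : Θ → ℕ := fun ω => sInf {k | ω ∈ {ω | 0 < P ω (Prod.mk ω ⁻¹' (B ∩ {z | Φ z ≤ k}))}}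
  have hM : UMeas M := measurable_nat_sInf hpos
  have hMr : UMeas fun ω => (M ω : ℝ) := (measurable_from_nat (f := fun n : ℕ => (n : ℝ))).comp hM
  let B' : Set (Θ × X) := B ∩ {z | Φ z ≤ M z.1}
  have hB' : USet B' :=
    MeasurableSet.inter hB (USet.le hΦ
      (hMr.comp_measurable measurable_fst))
  have hmass := umeas_measure_section hP hp hB'
  let Pos : Set Θ := {ω | 0 < P ω (Prod.mk ω ⁻¹' B')}
  have hPos : USet Pos := USet.lt (UMeas.const _) hmass
  have hsec : ∀ ω, NullMeasurableSet (Prod.mk ω ⁻¹' B') (P ω) := fun ω =>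
    have := hp ω
    USet.nullMeasurableSet (hB'.preimage measurable_prodMk_left) _
  refine ⟨fun ω => if ω ∈ Pos then ProbabilityTheory.cond (P ω) (Prod.mk ω ⁻¹' B') else P ω,
    fun ω => M ω, ?_, hMr, ?_, ?_, ?_⟩
  · refine UMeas.ite hPos ?_ hP
    refine Measure.measurable_of_measurable_coe _ fun t ht => ?_
    have : (fun ω => ProbabilityTheory.cond (P ω) (Prod.mk ω ⁻¹' B') t) = fun ω =>
        (P ω (Prod.mk ω ⁻¹' B'))⁻¹ * P ω (Prod.mk ω ⁻¹' (B' ∩ Prod.snd ⁻¹' t)) := by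
      ext ω
      rw [ProbabilityTheory.cond, Measure.smul_apply, Measure.restrict_apply ht, smul_eq_mul,
        inter_comm t]
      rfl
    rw [this]
    exact Measurable.mul (m := univComp Θ) (measurable_inv.comp hmass)
      (umeas_measure_section hP hp (MeasurableSet.inter hB'
        (USet.of_measurable (measurable_snd ht))))
  · intro ω
    have := hp ω
    dsimp only
    split_ifs with h
    · exact ProbabilityTheory.cond_isProbabilityMeasure (ne_of_gt h)
    · exact this
  · intro ω
    dsimp only
    split_ifs with h
    · exact ProbabilityTheory.cond_absolutelyContinuous
    · exact Measure.AbsolutelyContinuous.rfl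
  · intro ω h
    have h1 : ∃ k : ℕ, 0 < P ω (Prod.mk ω ⁻¹' (B ∩ {z | Φ z ≤ k})) := by
      by_contra! hcon
      have hu : Prod.mk ω ⁻¹' B = ⋃ k : ℕ, Prod.mk ω ⁻¹' (B ∩ {z | Φ z ≤ k}) := by
        ext x
        simp only [mem_preimage, mem_iUnion, mem_inter_iff, mem_ofPred_eq]
        refine ⟨fun hx => ?_, fun ⟨_, hx⟩ => hx.1⟩
        obtain ⟨k, hk⟩ := exists_nat_ge (Φ (ω, x))
        exact ⟨k, hx, hk⟩
      rw [hu, measure_iUnion_null fun k => le_zero_iff.1 (hcon k)] at h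
      exact lt_irrefl _ h
    have h2 : ω ∈ Pos := Nat.sInf_mem (s := {k : ℕ | ω ∈ {ω | 0 < P ω (Prod.mk ω ⁻¹'
      (B ∩ {z | Φ z ≤ k}))}}) h1
    dsimp only
    rw [if_pos h2, ProbabilityTheory.cond]
    refine Measure.ae_smul_measure ?_ _
    have := ae_restrict_mem₀ (hsec ω)
    filter_upwards [this] with x hx
    exact hx

end Kernels

section Step

variable {Θ X : Type*} [TopologicalSpace Θ] [PolishSpace Θ] [MeasurableSpace Θ] [BorelSpace Θ]
  [TopologicalSpace X] [PolishSpace X] [MeasurableSpace X] [BorelSpace X] {d : ℕ}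

lemma UpperSemianalyticE.umeas {F : Θ → EReal} (hF : UpperSemianalyticE F) : UMeas F := by
  refine measurable_of_Ioi fun c => ?_
  induction c with
  | bot =>
    have : F ⁻¹' Ioi ⊥ = ⋃ n : ℕ, {x | ((-(n : ℝ) : ℝ) : EReal) < F x} := by
      ext x
      simp only [mem_preimage, mem_Ioi, mem_iUnion, mem_ofPred_eq]
      constructor
      · intro h
        obtain ⟨b, -, hb⟩ := EReal.lt_iff_exists_real_btwn.1 h
        obtain ⟨n, hn⟩ := exists_nat_ge (-b)
        exact ⟨n, lt_of_le_of_lt (EReal.coe_le_coe_iff.2 (by linarith)) hb⟩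
      · rintro ⟨n, hn⟩
        exact (EReal.bot_lt_coe _).trans hn
    rw [this]
    exact MeasurableSet.iUnion fun n => (hF _).uset
  | coe c => exact (hF c).uset
  | top => simp

/-- Data of a one-step model: selectors charging the cells. -/
structure StepData (PP : Θ → Set (ProbabilityMeasure X)) (D : Θ × X → Fin d → ℝ)
    (F : Θ × X → EReal) where
  conv : ∀ ω, ConvexPM (PP ω)
  G : GraphParam PP
  measD : Measurable D
  usa : UpperSemianalyticE F
  s : ℕ → Θ → ℕ → ℕ
  us : ∀ j, UMeas (s j)
  ws : ∀ j ω, G.w (s j ω) = ω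
  pos : ∀ j, ∀ ω ∈ active PP (cell D F j), 0 < (G.p (s j ω) : Measure X) (Prod.mk ω ⁻¹' cell D F j)
  analytic_active : ∀ j, AnalyticSet (active PP (cell D F j))

variable {PP : Θ → Set (ProbabilityMeasure X)} {D : Θ × X → Fin d → ℝ} {F : Θ × X → EReal}

lemma analyticSet_cell (hD : Measurable D) (hF : UpperSemianalyticE F) (j : ℕ) :
    AnalyticSet (cell D F j) := by
  have h1 : AnalyticSet {z | dist (D z) (ctr d j) < rad j} :=
    (measurableSet_lt (hD.dist measurable_const) measurable_const).analyticSet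
  have : cell D F j = ⋂ b : Bool, bif b then {z | dist (D z) (ctr d j) < rad j}
      else {z | (lev j : EReal) < F z} := by
    ext z
    simp [cell, and_comm]
  rw [this]
  refine AnalyticSet.iInter fun b => ?_
  cases b
  · exact hF _
  · exact h1

lemma nonempty_stepData [Nonempty Θ] (hne : ∀ ω, (PP ω).Nonempty) (hconv : ∀ ω, ConvexPM (PP ω))
    (hgraph : AnalyticSet {q : Θ × ProbabilityMeasure X | q.2 ∈ PP q.1}) (hD : Measurable D)
    (hF : UpperSemianalyticE F) : Nonempty (StepData PP D F) := by
  obtain ⟨G⟩ := nonempty_graphParam hne hgraph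
  choose h s us ws pos using fun j => exists_active_selector hne G (analyticSet_cell hD hF j)
  exact ⟨⟨hconv, G, hD, hF, s, us, ws, pos, h⟩⟩

namespace StepData

/-- The selector charging the `j`-th cell. -/
def P (S : StepData PP D F) (j : ℕ) (ω : Θ) : ProbabilityMeasure X := S.G.p (S.s j ω)

/-- The indices of the charged cells. -/
def act (_ : StepData PP D F) (ω : Θ) : Set ℕ := {j | ω ∈ active PP (cell D F j)}

lemma P_mem (S : StepData PP D F) (j : ℕ) (ω : Θ) : S.P j ω ∈ PP ω := by
  have := S.G.mem (S.s j ω)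
  rwa [S.ws] at this

lemma measurable_P (S : StepData PP D F) (j : ℕ) :
    @Measurable _ _ (univComp Θ) (borel (ProbabilityMeasure X)) (S.P j) := by
  let _ : MeasurableSpace (ProbabilityMeasure X) := borel _
  have : BorelSpace (ProbabilityMeasure X) := ⟨rfl⟩
  exact S.G.cp.measurable.comp (S.us j)

lemma uset_act (S : StepData PP D F) (j : ℕ) : USet {ω | j ∈ S.act ω} := (S.analytic_active j).uset

lemma exists_atoms (S : StepData PP D F) {Φ : Θ × X → ℝ} (hΦ : UMeas Φ) :
    ∃ (R : ℕ → Θ → Measure X) (M : ℕ → Θ → ℝ), (∀ j, UMeas (R j)) ∧ (∀ j, UMeas (M j)) ∧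
      (∀ ω, AtomsAt (PP ω) (fun x => D (ω, x)) (fun x => F (ω, x)) (S.act ω) fun j => R j ω) ∧
      (∀ j ω, R j ω ≪ (S.P j ω : Measure X)) ∧
      ∀ ω, ∀ j ∈ S.act ω, ∀ᵐ x ∂(R j ω), Φ (ω, x) ≤ M j ω := by
  choose R M hR hM hp hac hae using fun j => exists_atom (umeas_toMeasure (S.measurable_P j))
    (fun ω => inferInstance) (analyticSet_cell S.measD S.usa j).uset hΦ
  refine ⟨R, M, hR, hM, fun ω => ⟨S.measD.comp measurable_prodMk_left, ?_, fun j => hp j ω,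
    fun j => ⟨S.P j ω, S.P_mem j ω, hac j ω⟩, ?_⟩, hac, ?_⟩
  · intro j hj P hP
    by_contra h
    exact hj ⟨P, hP, pos_iff_ne_zero.2 h⟩
  · intro j hj
    filter_upwards [hae j ω (S.pos j ω hj)] with x hx
    exact hx.1
  · intro ω j hj
    filter_upwards [hae j ω (S.pos j ω hj)] with x hx
    exact hx.2

end StepData

end Step

section Value

/-- Approximate martingale certificates in terms of cell centres and levels. -/
def ApproxCert (d : ℕ) (a : ℝ) (k : ℕ) (l : ℕ →₀ ℝ) : Prop :=
  (∀ j ∈ l.support, rad j ≤ 1 / ((k : ℝ) + 1)) ∧ (∀ j, 0 ≤ l j) ∧ (l.sum fun _ c => c) = 1 ∧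
    (∀ i, |l.sum fun j c => c * ctr d j i| ≤ 1 / ((k : ℝ) + 1)) ∧
    a - 1 / ((k : ℝ) + 1) ≤ l.sum fun j c => c * lev j

/-- The one-step value determined by the set of charged cells. -/
def val (d : ℕ) (A : Set ℕ) : EReal :=
  sSup {e | ∃ a : ℚ, e = ((a : ℝ) : EReal) ∧
    ∀ k : ℕ, ∃ l, ApproxCert d a k l ∧ ∀ j ∈ l.support, j ∈ A}

variable {X : Type*} [MeasurableSpace X] {d : ℕ} {C : Set (ProbabilityMeasure X)}
  {D : X → Fin d → ℝ} {F : X → EReal} {A : Set ℕ} {R : ℕ → Measure X}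

namespace AtomsAt

lemma abs_sum_bary_sub_le (h : AtomsAt C D F A R) {l : ℕ →₀ ℝ} {r : ℝ}
    (h0 : ∀ j ∈ l.support, rad j ≤ r) (h1 : ∀ j, 0 ≤ l j) (h2 : (l.sum fun _ c => c) = 1)
    (hA : ∀ j ∈ l.support, j ∈ A) (i : Fin d) :
    |(l.sum fun j c => c * bary D R j i) - l.sum fun j c => c * ctr d j i| ≤ r := by
  simp only [Finsupp.sum] at *
  rw [← Finset.sum_sub_distrib]
  calc |∑ j ∈ l.support, (l j * bary D R j i - l j * ctr d j i)|
      ≤ ∑ j ∈ l.support, |l j * bary D R j i - l j * ctr d j i| := Finset.abs_sum_le_sum_abs _ _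
    _ ≤ ∑ j ∈ l.support, l j * r := by
        refine Finset.sum_le_sum fun j hj => ?_
        rw [← mul_sub, abs_mul, abs_of_nonneg (h1 j)]
        exact mul_le_mul_of_nonneg_left ((h.abs_bary_sub_le (hA j hj) i).trans (h0 j hj)) (h1 j)
    _ = r := by rw [← Finset.sum_mul, h2, one_mul]

lemma not_iHedge_of_approxCert (h : AtomsAt C D F A R) {a a' : ℝ} (haa : a' < a)
    (hl : ∀ k : ℕ, ∃ l, ApproxCert d a k l ∧ ∀ j ∈ l.support, j ∈ A) (y : Fin d → ℝ) :
    ¬ IHedge C D F id a' y := by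
  intro hy
  have key : ∀ k : ℕ, a ≤ a' + (1 + (∑ i, |y i|) * 2) * (1 / ((k : ℝ) + 1)) := by
    intro k
    obtain ⟨l, ⟨h0, h1, h2, h3, h4⟩, hA⟩ := hl k
    set r := 1 / ((k : ℝ) + 1)
    have h5 : (l.sum fun j c => c * lev j) ≤ a' + ∑ i, y i * l.sum fun j c => c * bary D R j i := by
      have : (l.sum fun j c => c * lev j) ≤
          l.sum fun j c => c * a' + ∑ i, y i * (c * bary D R j i) := by
        refine Finset.sum_le_sum fun j hj => ?_
        have := mul_le_mul_of_nonneg_left (h.le_of_iHedge hy (hA j hj)) (h1 j)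
        refine this.trans (le_of_eq ?_)
        rw [mul_add, Finset.mul_sum]
        congr 1
        exact Finset.sum_congr rfl fun i _ => by ring
      refine this.trans (le_of_eq ?_)
      rw [Finsupp.sum_add, Finsupp.sum, ← Finset.sum_mul]
      change (l.sum fun _ c => c) * a' + _ = _
      rw [h2, one_mul, Finsupp.sum, Finset.sum_comm]
      simp only [← Finset.mul_sum]
      rfl
    have h6 : ∀ i, y i * (l.sum fun j c => c * bary D R j i) ≤ |y i| * (2 * r) := by
      intro i
      refine (le_abs_self _).trans ?_
      rw [abs_mul]
      refine mul_le_mul_of_nonneg_left ?_ (abs_nonneg _)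
      have h7 := h.abs_sum_bary_sub_le h0 h1 h2 hA i
      have h8 := abs_sub_abs_le_abs_sub (l.sum fun j c => c * bary D R j i)
        (l.sum fun j c => c * ctr d j i)
      linarith [h3 i]
    have h9 := Finset.sum_le_sum fun i (_ : i ∈ Finset.univ) => h6 i
    rw [← Finset.sum_mul] at h9
    nlinarith
  have hlim : Tendsto (fun k : ℕ => a' + (1 + (∑ i, |y i|) * 2) * (1 / ((k : ℝ) + 1))) atTop
      (𝓝 (a' + (1 + (∑ i, |y i|) * 2) * 0)) :=
    (tendsto_one_div_add_atTop_nhds_zero_nat.const_mul _).const_add _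
  have := ge_of_tendsto' hlim key
  simp at this
  linarith

lemma exists_approxCert (h : AtomsAt C D F A R) (hNA : INA C D F) {a : ℝ}
    (hno : ¬ ∃ y, IHedge C D F id a y) (k : ℕ) :
    ∃ l, ApproxCert d a k l ∧ ∀ j ∈ l.support, j ∈ A := by
  rcases h.cert_or_iHedge hNA monotone_id a k with ⟨l, h0, h1, h2, h3, h4⟩ | hy
  · refine ⟨l, ⟨fun j hj => (h0 j hj).2, h1, h2, fun i => ?_, ?_⟩, fun j hj => (h0 j hj).1⟩
    · have := h.abs_sum_bary_sub_le (fun j hj => (h0 j hj).2) h1 h2 (fun j hj => (h0 j hj).1) i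
      rwa [h3 i, zero_sub, abs_neg] at this
    · have : (0 : ℝ) < 1 / ((k : ℝ) + 1) := by positivity
      simp only [id] at h4
      linarith
  · exact absurd hy hno

lemma val_le_iff (h : AtomsAt C D F A R) (hNA : INA C D F) (a : ℝ) :
    val d A ≤ a ↔ ∃ y, IHedge C D F id a y := by
  constructor
  · intro hv
    by_contra hno
    rcases h.cert_or_iHedge hNA monotone_id a 0 with ⟨l, h0, h1, h2, h3, h4⟩ | hy
    · obtain ⟨q, hq1, hq2⟩ := exists_rat_btwn h4
      have hno' : ¬ ∃ y, IHedge C D F id q y := fun ⟨y, hy⟩ =>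
        h.not_iHedge_of_cert ⟨h0, h1, h2, h3, hq2⟩ y hy
      have : ((q : ℝ) : EReal) ≤ val d A := le_sSup ⟨q, rfl, h.exists_approxCert hNA hno'⟩
      exact absurd (EReal.coe_le_coe_iff.1 (this.trans hv)) (not_le.2 hq1)
    · exact hno hy
  · rintro ⟨y, hy⟩
    refine sSup_le ?_
    rintro _ ⟨q, rfl, hq⟩
    rw [EReal.coe_le_coe_iff]
    by_contra hlt
    exact h.not_iHedge_of_approxCert (not_le.1 hlt) hq y hy

lemma val_ne_bot (h : AtomsAt C D F A R) (hNA : INA C D F) (hA : A.Nonempty) : val d A ≠ ⊥ := by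
  rcases h.cert_or_iHedge hNA (p := 0) (fun _ _ _ => le_rfl) (-1) 0 with
    ⟨l, h0, h1, h2, h3, h4⟩ | ⟨y, hy⟩
  · intro hbot
    have : val d A ≤ (((l.sum fun j c => c * lev j) - 1 : ℝ) : EReal) := by rw [hbot]; exact bot_le
    obtain ⟨y, hy⟩ := (h.val_le_iff hNA _).1 this
    exact h.not_iHedge_of_cert (k := 0) ⟨h0, h1, h2, h3, by simp⟩ y hy
  · exfalso
    obtain ⟨j, hj⟩ := hA
    have hpos : ∀ j ∈ A, 1 ≤ ∑ i, y i * bary D R j i := fun j hj => by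
      have := h.le_of_iHedge hy hj
      simp at this
      linarith
    have := h.bary_eq_zero hNA (k := 0) (fun j hj _ => zero_le_one.trans (hpos j hj)) hj
    linarith [hpos j hj]

end AtomsAt

end Value

section Step

variable {Θ X : Type*} [TopologicalSpace Θ] [PolishSpace Θ] [MeasurableSpace Θ] [BorelSpace Θ]
  [TopologicalSpace X] [PolishSpace X] [MeasurableSpace X] [BorelSpace X] {d : ℕ}
  {PP : Θ → Set (ProbabilityMeasure X)} {D : Θ × X → Fin d → ℝ} {F : Θ × X → EReal}

namespace StepData

/-- The one-step value function. -/
def V (S : StepData PP D F) (ω : Θ) : EReal := val d (S.act ω)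

lemma upperSemianalyticE_V (S : StepData PP D F) : UpperSemianalyticE S.V := by
  intro c
  have : {ω | (c : EReal) < S.V ω} = ⋃ a : {a : ℚ // c < a}, ⋂ k : ℕ,
      ⋃ J : {J : Finset ℕ // ∃ l, ApproxCert d (a : ℚ) k l ∧ l.support = J},
        ⋂ j : (J : Finset ℕ), active PP (cell D F j) := by
    ext ω
    simp only [V, val, mem_ofPred_eq, lt_sSup_iff, mem_iUnion, mem_iInter]
    constructor
    · rintro ⟨_, ⟨a, rfl, ha⟩, hc⟩
      refine ⟨⟨a, EReal.coe_lt_coe_iff.1 hc⟩, fun k => ?_⟩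
      obtain ⟨l, hl, hA⟩ := ha k
      exact ⟨⟨l.support, l, hl, rfl⟩, fun j => hA j j.2⟩
    · rintro ⟨⟨a, hc⟩, ha⟩
      refine ⟨_, ⟨a, rfl, fun k => ?_⟩, EReal.coe_lt_coe_iff.2 hc⟩
      obtain ⟨⟨_, l, hl, rfl⟩, hA⟩ := ha k
      exact ⟨l, hl, fun j hj => hA ⟨j, hj⟩⟩
  rw [this]
  refine AnalyticSet.iUnion fun a => AnalyticSet.iInter fun k => AnalyticSet.iUnion ?_
  rintro ⟨J, l, hl, rfl⟩
  have : Nonempty l.support := by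
    rcases l.support.eq_empty_or_nonempty with h | h
    · have := hl.2.2.1
      rw [Finsupp.sum, h] at this
      simp at this
    · exact h.to_subtype
  exact AnalyticSet.iInter fun j => S.analytic_active j

end StepData

end Step

section Constraints

variable {Θ : Type*} [mΘ : MeasurableSpace Θ] {n : ℕ}

/-- Closed constraints on a vector depending measurably on a parameter. -/
def IsConstraint (C : Θ → (Fin n → ℝ) → Prop) : Prop :=
  ∃ g : Θ → (Fin n → ℝ) → ℝ, IsCarath g ∧ ∀ θ y, C θ y ↔ g θ y ≤ 0

lemma IsCarath.linear {z : Θ → Fin n → ℝ} (hz : ∀ i, Measurable fun θ => z θ i) :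
    IsCarath fun θ (y : Fin n → ℝ) => ∑ i, y i * z θ i :=
  ⟨fun _ => Finset.measurable_fun_sum _ fun i _ => (hz i).const_mul _, fun _ => by fun_prop⟩

lemma IsCarath.of_left {u : Θ → ℝ} (hu : Measurable u) :
    IsCarath fun θ (_ : Fin n → ℝ) => u θ := ⟨fun _ => hu, fun _ => continuous_const⟩

lemma IsConstraint.le {u v : Θ → (Fin n → ℝ) → ℝ} (hu : IsCarath u) (hv : IsCarath v) :
    IsConstraint fun θ y => u θ y ≤ v θ y :=
  ⟨fun θ y => u θ y - v θ y, ⟨fun y => (hu.meas y).sub (hv.meas y),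
    fun θ => (hu.cont θ).sub (hv.cont θ)⟩, fun _ _ => sub_nonpos.symm⟩

lemma IsConstraint.imp {C : Θ → (Fin n → ℝ) → Prop} (hC : IsConstraint C) {s : Set Θ}
    (hs : MeasurableSet s) : IsConstraint fun θ y => θ ∈ s → C θ y := by
  classical
  obtain ⟨g, hg, h⟩ := hC
  refine ⟨fun θ y => if θ ∈ s then g θ y else 0, ⟨fun y => Measurable.ite hs (hg.meas y)
    measurable_const, fun θ => ?_⟩, fun θ y => ?_⟩
  · by_cases hθ : θ ∈ s
    · simpa [hθ] using hg.cont θ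
    · simpa [hθ] using continuous_const
  · by_cases hθ : θ ∈ s <;> simp [hθ, h]

lemma IsConstraint.forall {ι : Type*} [Countable ι] {C : ι → Θ → (Fin n → ℝ) → Prop}
    (hC : ∀ i, IsConstraint (C i)) : IsConstraint fun θ y => ∀ i, C i θ y := by
  rcases isEmpty_or_nonempty ι with h | h
  · exact ⟨fun _ _ => 0, ⟨fun _ => measurable_const, fun _ => continuous_const⟩, by simp⟩
  choose g hg h' using hC
  obtain ⟨e, he⟩ := exists_surjective_nat ι
  obtain ⟨G, hG, hiff⟩ := exists_isCarath_forall fun n => hg (e n)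
  exact ⟨G, hG, fun θ y => by simp only [hiff, he.forall, h']⟩

lemma IsConstraint.and {C C' : Θ → (Fin n → ℝ) → Prop} (hC : IsConstraint C)
    (hC' : IsConstraint C') : IsConstraint fun θ y => C θ y ∧ C' θ y := by
  have : IsConstraint fun θ y => ∀ b : Bool, (bif b then C else C') θ y :=
    IsConstraint.forall fun b => by cases b <;> assumption
  simpa [and_comm] using this

lemma IsConstraint.eq {u v : Θ → (Fin n → ℝ) → ℝ} (hu : IsCarath u) (hv : IsCarath v) :
    IsConstraint fun θ y => u θ y = v θ y := by
  simpa only [le_antisymm_iff] using (IsConstraint.le hu hv).and (IsConstraint.le hv hu)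

lemma IsConstraint.exists_selector {C : Θ → (Fin n → ℝ) → Prop} (hC : IsConstraint C) :
    MeasurableSet {θ | ∃ y, C θ y} ∧
      ∃ y : Θ → Fin n → ℝ, Measurable y ∧ ∀ θ, (∃ z, C θ z) → C θ (y θ) := by
  obtain ⟨g, hg, h⟩ := hC
  simp only [h]
  simpa using exists_constraint_selector (fun _ : Unit => hg)

end Constraints

section Step

variable {Θ X : Type*} [TopologicalSpace Θ] [PolishSpace Θ] [MeasurableSpace Θ] [BorelSpace Θ]
  [TopologicalSpace X] [PolishSpace X] [MeasurableSpace X] [BorelSpace X] {d : ℕ}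
  {PP : Θ → Set (ProbabilityMeasure X)} {D : Θ × X → Fin d → ℝ} {F : Θ × X → EReal}

namespace StepData

/-- Reference atoms. -/
def R₀ (S : StepData PP D F) : ℕ → Θ → Measure X :=
  (S.exists_atoms (Φ := fun _ => 0) (UMeas.const 0)).choose

lemma umeas_R₀ (S : StepData PP D F) (j : ℕ) : UMeas (S.R₀ j) :=
  (S.exists_atoms (Φ := fun _ => 0) (UMeas.const 0)).choose_spec.choose_spec.1 j

lemma atomsAt_R₀ (S : StepData PP D F) (ω : Θ) :
    AtomsAt (PP ω) (fun x => D (ω, x)) (fun x => F (ω, x)) (S.act ω) fun j => S.R₀ j ω :=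
  (S.exists_atoms (Φ := fun _ => 0) (UMeas.const 0)).choose_spec.choose_spec.2.2.1 ω

lemma R₀_ac (S : StepData PP D F) (j : ℕ) (ω : Θ) : S.R₀ j ω ≪ (S.P j ω : Measure X) :=
  (S.exists_atoms (Φ := fun _ => 0) (UMeas.const 0)).choose_spec.choose_spec.2.2.2.1 j ω

/-- Barycentres of the reference atoms. -/
def z (S : StepData PP D F) (j : ℕ) (ω : Θ) : Fin d → ℝ :=
  bary (fun x => D (ω, x)) (fun j => S.R₀ j ω) j

lemma umeas_bary (S : StepData PP D F) {R : ℕ → Θ → Measure X} (hR : ∀ j, UMeas (R j))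
    (hp : ∀ j ω, IsProbabilityMeasure (R j ω)) (j : ℕ) (i : Fin d) :
    UMeas fun ω => bary (fun x => D (ω, x)) (fun j => R j ω) j i :=
  umeas_integral (u := fun z => D z i) (hR j) (hp j)
    (UMeas.of_measurable ((measurable_pi_apply i).comp S.measD))

lemma umeas_z (S : StepData PP D F) (j : ℕ) (i : Fin d) : UMeas fun ω => S.z j ω i :=
  S.umeas_bary S.umeas_R₀ (fun j ω => (S.atomsAt_R₀ ω).prob j) j i

/-- The parameters at which the one-step market admits an arbitrage charging the `n`-th cell. -/
def bad (S : StepData PP D F) (n : ℕ) : Set Θ :=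
  {ω | n ∈ S.act ω ∧ ∃ y : Fin d → ℝ, (∀ m, m ∈ S.act ω → 0 ≤ ∑ i, y i * S.z m ω i) ∧
    1 ≤ ∑ i, y i * S.z n ω i}

lemma exists_bad_selector (S : StepData PP D F) (n : ℕ) : USet (S.bad n) ∧
    ∃ y : Θ → Fin d → ℝ, UMeas y ∧ ∀ ω ∈ S.bad n,
      (∀ m, m ∈ S.act ω → 0 ≤ ∑ i, y ω i * S.z m ω i) ∧ 1 ≤ ∑ i, y ω i * S.z n ω i := by
  have hl : ∀ m, IsCarath (mΘ := univComp Θ) fun ω (y : Fin d → ℝ) => ∑ i, y i * S.z m ω i :=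
    fun m => IsCarath.linear (mΘ := univComp Θ) (S.umeas_z m)
  have hc : ∀ c : ℝ, IsCarath (mΘ := univComp Θ) fun ω (y : Fin d → ℝ) => c :=
    fun c => IsCarath.of_left (mΘ := univComp Θ) (UMeas.const c)
  have h1 : IsConstraint (mΘ := univComp Θ) fun ω (y : Fin d → ℝ) =>
      (∀ m, m ∈ S.act ω → 0 ≤ ∑ i, y i * S.z m ω i) ∧ 1 ≤ ∑ i, y i * S.z n ω i :=
    IsConstraint.and (mΘ := univComp Θ)
      (IsConstraint.forall (mΘ := univComp Θ) fun m =>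
        IsConstraint.imp (mΘ := univComp Θ)
          (IsConstraint.le (mΘ := univComp Θ) (hc 0) (hl m)) (S.uset_act m))
      (IsConstraint.le (mΘ := univComp Θ) (hc 1) (hl n))
  obtain ⟨h2, y, hy, h3⟩ := IsConstraint.exists_selector (mΘ := univComp Θ) h1
  exact ⟨MeasurableSet.inter (m := univComp Θ) (S.uset_act n) h2, y, hy, fun ω hω => h3 ω hω.2⟩

/-- The parameters at which the one-step market is free of arbitrage. -/
def good (S : StepData PP D F) : Set Θ := {ω | (∃ n, n ∈ S.act ω) ∧ ∀ n, ω ∉ S.bad n}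

lemma uset_good (S : StepData PP D F) : USet S.good := by
  have : S.good = (⋃ n, {ω | n ∈ S.act ω}) ∩ ⋂ n, (S.bad n)ᶜ := by
    ext ω
    simp [good]
  rw [this]
  exact MeasurableSet.inter (m := univComp Θ) (MeasurableSet.iUnion S.uset_act)
    (MeasurableSet.iInter fun n => MeasurableSet.compl (S.exists_bad_selector n).1)

lemma ina_of_good (S : StepData PP D F) {ω : Θ} (hω : ω ∈ S.good) :
    INA (PP ω) (fun x => D (ω, x)) fun x => F (ω, x) := by
  refine (S.atomsAt_R₀ ω).ina_of_bary fun y hy j hj => ?_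
  by_contra hne
  have hpos : 0 < ∑ i, y i * S.z j ω i := lt_of_le_of_ne (hy j hj) (Ne.symm hne)
  set c := ∑ i, y i * S.z j ω i
  have hsc : ∀ m, ∑ i, (c⁻¹ • y) i * S.z m ω i = c⁻¹ * ∑ i, y i * S.z m ω i := fun m => by
    rw [Finset.mul_sum]
    exact Finset.sum_congr rfl fun i _ => by simp [mul_assoc]
  refine hω.2 j ⟨hj, c⁻¹ • y, fun m hm => ?_, ?_⟩
  · rw [hsc]
    exact mul_nonneg (inv_nonneg.2 hpos.le) (hy m hm)
  · rw [hsc, inv_mul_cancel₀ hpos.ne']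

lemma V_ne_bot (S : StepData PP D F) {ω : Θ} (hω : ω ∈ S.good) : S.V ω ≠ ⊥ :=
  (S.atomsAt_R₀ ω).val_ne_bot (S.ina_of_good hω) hω.1

/-- Measurable selection of hedges. -/
lemma exists_hedge_selector (S : StepData PP D F) (b : ℕ → ℝ) {g : Θ → ℝ} (hg : UMeas g) :
    USet {ω | ∃ y : Fin d → ℝ, ∀ m, m ∈ S.act ω → b m ≤ g ω + ∑ i, y i * S.z m ω i} ∧
    ∃ y : Θ → Fin d → ℝ, UMeas y ∧ ∀ ω,
      (∃ y : Fin d → ℝ, ∀ m, m ∈ S.act ω → b m ≤ g ω + ∑ i, y i * S.z m ω i) →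
        ∀ m, m ∈ S.act ω → b m ≤ g ω + ∑ i, y ω i * S.z m ω i := by
  have hl : ∀ m, IsCarath (mΘ := univComp Θ) fun ω (y : Fin d → ℝ) => ∑ i, y i * S.z m ω i :=
    fun m => IsCarath.linear (mΘ := univComp Θ) (S.umeas_z m)
  have h1 : IsConstraint (mΘ := univComp Θ) fun ω (y : Fin d → ℝ) =>
      ∀ m, m ∈ S.act ω → b m - g ω ≤ ∑ i, y i * S.z m ω i :=
    IsConstraint.forall (mΘ := univComp Θ) fun m =>
        IsConstraint.imp (mΘ := univComp Θ)
          (IsConstraint.le (mΘ := univComp Θ) (IsCarath.of_left (mΘ := univComp Θ)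
            (Measurable.sub (m := univComp Θ) (UMeas.const _) hg)) (hl m)) (S.uset_act m)
  simp only [sub_le_iff_le_add'] at h1
  exact IsConstraint.exists_selector (mΘ := univComp Θ) h1

lemma umeas_V (S : StepData PP D F) : UMeas S.V := S.upperSemianalyticE_V.umeas

/-- Superhedging over one period, starting from the one-step value. -/
lemma exists_superhedge (S : StepData PP D F) : ∃ y : Θ → Fin d → ℝ, UMeas y ∧
    ∀ ω ∈ S.good, S.V ω ≠ ⊤ → ∀ P ∈ PP ω, ∀ᵐ x ∂(P : Measure X),
      F (ω, x) ≤ (((S.V ω).toReal + ∑ i, y ω i * D (ω, x) i : ℝ) : EReal) := by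
  obtain ⟨-, y, hy, h⟩ := S.exists_hedge_selector lev (g := fun ω => (S.V ω).toReal)
    (measurable_ereal_toReal.comp S.umeas_V)
  refine ⟨y, hy, fun ω hω htop P hP => ?_⟩
  have hA := S.atomsAt_R₀ ω
  have hV : S.V ω ≤ ((S.V ω).toReal : EReal) := EReal.le_coe_toReal htop
  obtain ⟨y', hy'⟩ := (hA.val_le_iff (S.ina_of_good hω) _).1 hV
  have h1 := h ω ⟨y', fun m hm => hA.le_of_iHedge hy' hm⟩
  have h2 := hA.iHedge monotone_id 0 (y := y ω) (a := (S.V ω).toReal) fun j hj _ => h1 j hj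
  filter_upwards [h2 P hP] with x hx
  by_contra! hlt
  obtain ⟨c, hc1, hc2⟩ := EReal.lt_iff_exists_real_btwn.1 hlt
  exact absurd (hx c hc2) (not_le.2 (EReal.coe_lt_coe_iff.1 hc1))

/-- Outside the arbitrage-free parameters, either `F = ⊥` or there is an arbitrage on `F ≠ ⊥`. -/
lemma eq_bot_or_bad (S : StepData PP D F) {ω : Θ} (hω : ω ∉ S.good) :
    (∀ P ∈ PP ω, ∀ᵐ x ∂(P : Measure X), F (ω, x) = ⊥) ∨ ∃ n, ω ∈ S.bad n := by
  by_contra! h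
  refine hω ⟨?_, h.2⟩
  by_contra! hn
  obtain ⟨P, hP, h1⟩ := h.1
  refine h1 ?_
  filter_upwards [(S.atomsAt_R₀ ω).ae_mem hP] with x hx
  by_contra hbot
  obtain ⟨c, -, hc⟩ := EReal.lt_iff_exists_real_btwn.1 (bot_lt_iff_ne_bot.2 hbot)
  obtain ⟨j, hj, -⟩ := exists_mem_cell (fun x => D (ω, x)) (fun x => F (ω, x)) hc 0
  exact hn j (hx j hj)

/-- Arbitrage strategies on the bad parameters. -/
lemma exists_arbitrage (S : StepData PP D F) (n : ℕ) : ∃ y : Θ → Fin d → ℝ, UMeas y ∧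
    ∀ ω ∈ S.bad n, (∀ P ∈ PP ω, ∀ᵐ x ∂(P : Measure X), F (ω, x) ≠ ⊥ →
      0 ≤ ∑ i, y ω i * D (ω, x) i) ∧
      ¬ ∀ᵐ x ∂(S.P n ω : Measure X), ∑ i, y ω i * D (ω, x) i = 0 := by
  obtain ⟨-, y, hy, h⟩ := S.exists_bad_selector n
  refine ⟨y, hy, fun ω hω => ?_⟩
  have hA := S.atomsAt_R₀ ω
  obtain ⟨h1, h2⟩ := h ω hω
  refine ⟨fun P hP => ?_, fun h0 => ?_⟩
  · have h3 := hA.iHedge (p := 0) (fun _ _ _ => le_rfl) 0 (y := y ω) (a := 0)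
      fun j hj _ => by simpa [z] using h1 j hj
    filter_upwards [h3 P hP] with x hx hbot
    obtain ⟨c, -, hc⟩ := EReal.lt_iff_exists_real_btwn.1 (bot_lt_iff_ne_bot.2 hbot)
    simpa using hx c hc
  · have h4 := (hA.sum_bary hω.1 (y ω)).2
    rw [integral_congr_ae ((S.R₀_ac n ω).ae_le h0)] at h4
    simp only [integral_zero] at h4
    exact absurd (h2.trans h4.le) (by norm_num)

end StepData

end Step

section Cap

/-- Truncation from above with a small downward shift. -/
def cap (k : ℕ) (v : ℝ) : ℝ := min (v - 1 / ((k : ℝ) + 1)) k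

/-- Extension of `cap` to the extended reals. -/
def capE (k : ℕ) (e : EReal) : ℝ := if e = ⊤ then k else if e = ⊥ then 0 else cap k e.toReal

lemma monotone_cap (k : ℕ) : Monotone (cap k) := fun _ _ h =>
  min_le_min (sub_le_sub_right h _) le_rfl

lemma capE_lt (k : ℕ) {e : EReal} (h : e ≠ ⊥) : (capE k e : EReal) < e := by
  induction e with
  | bot => exact absurd rfl h
  | top => exact EReal.coe_lt_top _
  | coe v =>
    have : (0 : ℝ) < 1 / ((k : ℝ) + 1) := by positivity
    simp only [capE, EReal.coe_ne_top, EReal.coe_ne_bot, if_false, EReal.toReal_coe,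
      EReal.coe_lt_coe_iff, cap]
    exact (min_le_left _ _).trans_lt (by linarith)

lemma cap_le_capE (k : ℕ) {c : ℝ} {e : EReal} (h : (c : EReal) < e) : cap k c ≤ capE k e := by
  induction e with
  | bot => exact absurd h not_lt_bot
  | top => simp [capE, cap]
  | coe v =>
    simp only [capE, EReal.coe_ne_top, EReal.coe_ne_bot, if_false, EReal.toReal_coe]
    exact monotone_cap k (EReal.coe_lt_coe_iff.1 h).le

lemma measurable_capE (k : ℕ) : Measurable (capE k) := by
  refine Measurable.ite (measurableSet_singleton _) measurable_const
    (Measurable.ite (measurableSet_singleton _) measurable_const ?_)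
  exact (measurable_ereal_toReal.sub_const _).min measurable_const

lemma tendsto_cap (v : ℝ) : Tendsto (fun k => cap k v) atTop (𝓝 v) := by
  have h1 : Tendsto (fun k : ℕ => v - 1 / ((k : ℝ) + 1)) atTop (𝓝 (v - 0)) :=
    tendsto_one_div_add_atTop_nhds_zero_nat.const_sub _
  rw [sub_zero] at h1
  refine h1.congr' ?_
  filter_upwards [tendsto_natCast_atTop_atTop.eventually_ge_atTop v] with k hk
  have : (0 : ℝ) < 1 / ((k : ℝ) + 1) := by positivity
  exact (min_eq_left (by linarith)).symm

variable {X : Type*} [MeasurableSpace X] {d : ℕ} {C : Set (ProbabilityMeasure X)}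
  {D : X → Fin d → ℝ} {F : X → EReal} {A : Set ℕ} {R : ℕ → Measure X}

lemma AtomsAt.exists_cap_not_iHedge (h : AtomsAt C D F A R) (hNA : INA C D F) {a : ℝ}
    (hno : ¬ ∃ y, IHedge C D F id a y) : ∃ k, ¬ ∃ y, IHedge C D F (cap k) a y := by
  obtain ⟨l, h0, h1, h2, h3, h4⟩ :=
    (h.cert_or_iHedge hNA monotone_id a 0).resolve_right hno
  have hlim : Tendsto (fun k => l.sum fun j c => c * cap k (lev j)) atTop
      (𝓝 (l.sum fun j c => c * lev j)) :=
    tendsto_finsetSum _ fun j _ => (tendsto_cap _).const_mul _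
  obtain ⟨k, hk⟩ := (hlim.eventually_const_lt h4).exists
  exact ⟨k, fun ⟨y, hy⟩ => h.not_iHedge_of_cert ⟨h0, h1, h2, h3, hk⟩ y hy⟩

lemma AtomsAt.exists_fin_cert (h : AtomsAt C D F A R) (hNA : INA C D F) {p : ℝ → ℝ}
    (hp : Monotone p) {a : ℝ} (hno : ¬ ∃ y, IHedge C D F p a y) :
    ∃ (N : ℕ) (l : Fin N → ℝ), (∀ j, 0 ≤ l j) ∧ (∀ j : Fin N, (j : ℕ) ∉ A → l j = 0) ∧ ∑ j, l j * 1 = 1 ∧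
      (∀ i, ∑ j : Fin N, l j * bary D R j i = 0) ∧ a ≤ ∑ j : Fin N, l j * p (lev j) := by
  obtain ⟨l, h0, h1, h2, h3, h4⟩ := (h.cert_or_iHedge hNA hp a 0).resolve_right hno
  obtain ⟨N, hN⟩ := l.support.exists_nat_subset_range
  have hs : ∀ G : ℕ → ℝ, (l.sum fun j c => c * G j) = ∑ j : Fin N, l j * G j := fun G => by
    rw [Finsupp.sum_of_support_subset l hN (fun j c => c * G j) (fun j _ => zero_mul (G j)),
      Finset.sum_range fun j => l j * G j]
  refine ⟨N, fun j => l j, fun j => h1 j, fun j hj => ?_, ?_, fun i => ?_, ?_⟩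
  · by_contra hne
    exact hj (h0 j (Finsupp.mem_support_iff.2 hne)).1
  · rw [← hs fun _ => 1]
    simpa using h2
  · rw [← hs fun j => bary D R j i, h3]
  · rw [← hs fun j => p (lev j)]
    exact h4.le

end Cap

section WeightedSum

variable {X : Type*} [MeasurableSpace X] {N : ℕ}

/-- The weighted sum of finitely many measures. -/
def wsum (l : Fin N → ℝ) (R : Fin N → Measure X) : Measure X := ∑ j, ENNReal.ofReal (l j) • R j

lemma wsum_apply (l : Fin N → ℝ) (R : Fin N → Measure X) (s : Set X) :
    wsum l R s = ∑ j, ENNReal.ofReal (l j) * R j s := by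
  simp [wsum, Measure.finsetSum_apply]

lemma isProbabilityMeasure_wsum {l : Fin N → ℝ} {R : Fin N → Measure X} (h0 : ∀ j, 0 ≤ l j)
    (h1 : ∑ j, l j = 1) (hR : ∀ j, IsProbabilityMeasure (R j)) :
    IsProbabilityMeasure (wsum l R) := by
  refine ⟨?_⟩
  simp only [wsum_apply, measure_univ, mul_one]
  rw [← ENNReal.ofReal_sum_of_nonneg fun j _ => h0 j, h1, ENNReal.ofReal_one]

lemma wsum_null {l : Fin N → ℝ} {R : Fin N → Measure X} {s : Set X}
    (h : ∀ j, l j = 0 ∨ R j s = 0) : wsum l R s = 0 := by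
  rw [wsum_apply]
  refine Finset.sum_eq_zero fun j _ => ?_
  rcases h j with h | h <;> simp [h]

lemma integral_wsum {l : Fin N → ℝ} {R : Fin N → Measure X} (h0 : ∀ j, 0 ≤ l j) {u : X → ℝ}
    (h : ∀ j, l j = 0 ∨ Integrable u (R j)) :
    Integrable u (wsum l R) ∧ ∫ x, u x ∂(wsum l R) = ∑ j, l j * ∫ x, u x ∂(R j) := by
  have hi : ∀ j ∈ Finset.univ, Integrable u (ENNReal.ofReal (l j) • R j) := fun j _ => by
    rcases h j with h | h
    · simp [h]
    · exact h.smul_measure ENNReal.ofReal_ne_top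
  refine ⟨integrable_finsetSum_measure.2 hi, ?_⟩
  rw [wsum, integral_finsetSum_measure hi]
  refine Finset.sum_congr rfl fun j _ => ?_
  rw [integral_smul_measure, ENNReal.toReal_ofReal (h0 j), smul_eq_mul]

lemma umeas_wsum {Θ : Type*} [MeasurableSpace Θ] {l : Θ → Fin N → ℝ} {R : Fin N → Θ → Measure X}
    (hl : UMeas l) (hR : ∀ j, UMeas (R j)) : UMeas fun ω => wsum (l ω) fun j => R j ω := by
  refine Measure.measurable_of_measurable_coe (mβ := univComp Θ) _ fun s hs => ?_
  simp only [wsum_apply]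
  refine Finset.measurable_fun_sum (m := univComp Θ) _ fun j _ => ?_
  exact Measurable.mul (m := univComp Θ)
    (ENNReal.measurable_ofReal.comp ((measurable_pi_apply j).comp hl))
    ((Measure.measurable_coe hs).comp (hR j))

end WeightedSum

section Step

variable {Θ X : Type*} [TopologicalSpace Θ] [PolishSpace Θ] [MeasurableSpace Θ] [BorelSpace Θ]
  [TopologicalSpace X] [PolishSpace X] [MeasurableSpace X] [BorelSpace X] {d : ℕ}
  {PP : Θ → Set (ProbabilityMeasure X)} {D : Θ × X → Fin d → ℝ} {F : Θ × X → EReal}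

namespace StepData

/-- Measurable choice of a truncation level preserving the impossibility of hedging. -/
lemma exists_cap_level (S : StepData PP D F) {g : Θ → ℝ} (hg : UMeas g) :
    ∃ k : Θ → ℕ, UMeas k ∧ ∀ ω ∈ S.good, (g ω : EReal) < S.V ω →
      ¬ ∃ y, IHedge (PP ω) (fun x => D (ω, x)) (fun x => F (ω, x)) (cap (k ω)) (g ω) y := by
  let K : ℕ → Set Θ := fun k => {ω | ∃ y : Fin d → ℝ, ∀ m, m ∈ S.act ω →
    cap k (lev m) ≤ g ω + ∑ i, y i * S.z m ω i}ᶜ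
  have hK : ∀ k, USet (K k) := fun k =>
    MeasurableSet.compl (S.exists_hedge_selector (fun m => cap k (lev m)) hg).1
  have hiff : ∀ k ω, ω ∈ K k ↔
      ¬ ∃ y, IHedge (PP ω) (fun x => D (ω, x)) (fun x => F (ω, x)) (cap k) (g ω) y := by
    intro k ω
    refine not_congr ⟨fun ⟨y, hy⟩ => ⟨y, ?_⟩, fun ⟨y, hy⟩ => ⟨y, fun m hm => ?_⟩⟩
    · exact (S.atomsAt_R₀ ω).iHedge (monotone_cap k) 0 fun j hj _ => hy j hj
    · exact (S.atomsAt_R₀ ω).le_of_iHedge hy hm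
  refine ⟨fun ω => sInf {k | ω ∈ K k}, measurable_nat_sInf hK, fun ω hω hlt => ?_⟩
  rw [← hiff]
  refine Nat.sInf_mem (s := {k | ω ∈ K k}) ?_
  obtain ⟨k, hk⟩ := (S.atomsAt_R₀ ω).exists_cap_not_iHedge (S.ina_of_good hω) (a := g ω)
    fun h => absurd (((S.atomsAt_R₀ ω).val_le_iff (S.ina_of_good hω) _).2 h) (not_le.2 hlt)
  exact ⟨k, (hiff k ω).2 hk⟩

/-- Measurable choice of martingale weights on finitely many atoms. -/
lemma exists_weights (S : StepData PP D F) {g : Θ → ℝ} (hg : UMeas g) {k : Θ → ℕ} (hk : UMeas k)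
    {R : ℕ → Θ → Measure X} (hR : ∀ j, UMeas (R j)) (hp : ∀ j ω, IsProbabilityMeasure (R j ω)) :
    ∃ (N : Θ → ℕ) (l : (N : ℕ) → Θ → Fin N → ℝ), UMeas N ∧ (∀ N, UMeas (l N)) ∧
      ∀ ω, (∃ (N : ℕ) (l : Fin N → ℝ), (∀ j, 0 ≤ l j) ∧ (∀ j : Fin N, (j : ℕ) ∉ S.act ω → l j = 0) ∧
        ∑ j, l j * 1 = 1 ∧
        (∀ i, ∑ j : Fin N, l j * bary (fun x => D (ω, x)) (fun j => R j ω) j i = 0) ∧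
        g ω ≤ ∑ j : Fin N, l j * cap (k ω) (lev j)) →
      (∀ j, 0 ≤ l (N ω) ω j) ∧ (∀ j : Fin (N ω), (j : ℕ) ∉ S.act ω → l (N ω) ω j = 0) ∧
        ∑ j, l (N ω) ω j * 1 = 1 ∧
        (∀ i, ∑ j : Fin (N ω), l (N ω) ω j *
          bary (fun x => D (ω, x)) (fun j => R j ω) j i = 0) ∧
        g ω ≤ ∑ j : Fin (N ω), l (N ω) ω j * cap (k ω) (lev j) := by
  have hcon : ∀ N : ℕ, IsConstraint (mΘ := univComp Θ) fun ω (l : Fin N → ℝ) =>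
      (∀ j, 0 ≤ l j) ∧ (∀ j : Fin N, (j : ℕ) ∉ S.act ω → l j = 0) ∧ ∑ j, l j * 1 = 1 ∧
        (∀ i, ∑ j : Fin N, l j * bary (fun x => D (ω, x)) (fun j => R j ω) j i = 0) ∧
        g ω ≤ ∑ j : Fin N, l j * cap (k ω) (lev j) := by
    intro N
    have hc : ∀ c : ℝ, IsCarath (mΘ := univComp Θ) fun ω (y : Fin N → ℝ) => c :=
      fun c => IsCarath.of_left (mΘ := univComp Θ) (UMeas.const c)
    have hj : ∀ j, IsCarath (mΘ := univComp Θ) fun ω (y : Fin N → ℝ) => y j :=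
      fun j => @IsCarath.mk _ _ (univComp Θ) _ _ (fun y => UMeas.const (y j)) (fun _ => continuous_apply j)
    refine IsConstraint.and (mΘ := univComp Θ) (IsConstraint.forall (mΘ := univComp Θ) fun j =>
        IsConstraint.le (mΘ := univComp Θ) (hc 0) (hj j)) ?_
    refine IsConstraint.and (mΘ := univComp Θ) (IsConstraint.forall (mΘ := univComp Θ) fun j =>
        IsConstraint.imp (mΘ := univComp Θ) (IsConstraint.eq (mΘ := univComp Θ) (hj j) (hc 0))
          (MeasurableSet.compl (S.uset_act j))) ?_
    refine IsConstraint.and (mΘ := univComp Θ) (IsConstraint.eq (mΘ := univComp Θ)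
      (IsCarath.linear (mΘ := univComp Θ) (z := fun _ _ => 1) fun _ => UMeas.const 1) (hc 1)) ?_
    refine IsConstraint.and (mΘ := univComp Θ) (IsConstraint.forall (mΘ := univComp Θ) fun i =>
      IsConstraint.eq (mΘ := univComp Θ) (IsCarath.linear (mΘ := univComp Θ)
        fun j => S.umeas_bary hR hp j i) (hc 0)) ?_
    exact IsConstraint.le (mΘ := univComp Θ) (IsCarath.of_left (mΘ := univComp Θ) hg)
      (IsCarath.linear (mΘ := univComp Θ) fun j =>
        UMeas.comp_nat (f := fun k _ => cap k (lev j)) (fun _ => UMeas.const _) hk)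
  choose hm l hl hsel using fun N => IsConstraint.exists_selector (mΘ := univComp Θ) (hcon N)
  exact ⟨_, l, measurable_nat_sInf hm, hl, fun ω hω => hsel _ ω (Nat.sInf_mem hω)⟩

/-- Any level strictly below the one-step value is attained by a martingale kernel integrating a
function strictly below `F`, with arbitrary prescribed bounds. -/
lemma exists_martingale_kernel (S : StepData PP D F) {g : Θ → ℝ} (hg : UMeas g) :
    ∃ g' : Θ × X → ℝ, UMeas g' ∧ (∀ z, F z ≠ ⊥ → (g' z : EReal) < F z) ∧
      ∀ Φ' : Θ × X → ℝ, UMeas Φ' → (∀ z, |g' z| ≤ Φ' z) →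
        ∃ (κ : Θ → Measure X) (P : Θ → ProbabilityMeasure X) (Φ : Θ → ℝ),
          UMeas κ ∧ (∀ ω, IsProbabilityMeasure (κ ω)) ∧
          @Measurable _ _ (univComp Θ) (borel (ProbabilityMeasure X)) P ∧ (∀ ω, P ω ∈ PP ω) ∧
          UMeas Φ ∧ (∀ ω, κ ω ≪ (P ω : Measure X)) ∧
          ∀ ω ∈ S.good, (g ω : EReal) < S.V ω →
            (∀ᵐ x ∂(κ ω), F (ω, x) ≠ ⊥ ∧ Φ' (ω, x) ≤ Φ ω) ∧
            (∀ i, Integrable (fun x => D (ω, x) i) (κ ω) ∧ ∫ x, D (ω, x) i ∂(κ ω) = 0) ∧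
            g ω ≤ ∫ x, g' (ω, x) ∂(κ ω) := by
  classical
  obtain ⟨k, hk, hno⟩ := S.exists_cap_level hg
  have hFm : UMeas F := S.usa.umeas
  have hg' : UMeas fun z : Θ × X => capE (k z.1) (F z) :=
    UMeas.comp_nat (f := fun n z => capE n (F z)) (fun n => (measurable_capE n).comp hFm)
      (hk.comp_measurable measurable_fst)
  refine ⟨fun z => capE (k z.1) (F z), hg', fun z hz => capE_lt _ hz, fun Φ' hΦ' hb => ?_⟩
  obtain ⟨R, M, hR, hM, hA, hac, hRM⟩ := S.exists_atoms hΦ'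
  have hp : ∀ j ω, IsProbabilityMeasure (R j ω) := fun j ω => (hA ω).prob j
  obtain ⟨N, l, hN, hl, hsel⟩ := S.exists_weights hg hk hR hp
  let B : Set Θ := S.good ∩ {ω | (g ω : EReal) < S.V ω}
  have hB : USet B := MeasurableSet.inter (m := univComp Θ) S.uset_good
    (USet.lt (measurable_coe_real_ereal.comp hg) S.umeas_V)
  have hsel' : ∀ ω ∈ B, _ := fun ω hω => hsel ω
    ((hA ω).exists_fin_cert (S.ina_of_good hω.1) (monotone_cap _) (hno ω hω.1 hω.2))
  let P : Θ → ProbabilityMeasure X := fun ω => mixSeq (fun n => S.P n ω) (N ω)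
  have hP : @Measurable _ _ (univComp Θ) (borel (ProbabilityMeasure X)) P :=
    measurable_borel_mixSeq S.G.cp S.us hN
  let κ : Θ → Measure X := fun ω =>
    if ω ∈ B then wsum (l (N ω) ω) (fun j => R j ω) else (P ω : Measure X)
  have hκB : ∀ ω ∈ B, κ ω = wsum (l (N ω) ω) fun j => R j ω := fun ω hω => if_pos hω
  refine ⟨κ, P, fun ω => ∑ j ∈ Finset.range (N ω), |M j ω|, ?_, fun ω => ?_, hP,
    fun ω => (S.conv ω).mixSeq_mem (fun n => S.P_mem n ω) _, ?_, fun ω => ?_, fun ω hω hlt => ?_⟩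
  · exact UMeas.ite hB (UMeas.comp_nat (f := fun n ω => wsum (l n ω) fun j : Fin n => R j ω)
      (fun n => umeas_wsum (hl n) fun j => hR j) hN) (umeas_toMeasure hP)
  · by_cases hω : ω ∈ B
    · rw [hκB ω hω]
      obtain ⟨h0, -, h1, -⟩ := hsel' ω hω
      exact isProbabilityMeasure_wsum h0 (by simpa using h1) fun j => hp j ω
    · simp only [κ, if_neg hω]
      infer_instance
  · exact UMeas.comp_nat (f := fun n ω => ∑ j ∈ Finset.range n, |M j ω|) (fun n =>
      Finset.measurable_fun_sum (m := univComp Θ) _ fun j _ => measurable_norm.comp (hM j)) hN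
  · by_cases hω : ω ∈ B
    · rw [hκB ω hω]
      refine fun s hs => wsum_null fun j => Or.inr ?_
      exact hac j ω (absolutelyContinuous_mixSeq (fun n => S.P n ω) j.2.le hs)
    · simp only [κ, if_neg hω]
      exact Measure.AbsolutelyContinuous.rfl
  · have hωB : ω ∈ B := ⟨hω, hlt⟩
    rw [hκB ω hωB]
    obtain ⟨h0, h1, h2, h3, h4⟩ := hsel' ω hωB
    have hae : ∀ᵐ x ∂(wsum (l (N ω) ω) fun j => R j ω), F (ω, x) ≠ ⊥ ∧
        Φ' (ω, x) ≤ ∑ j ∈ Finset.range (N ω), |M j ω| := by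
      refine wsum_null fun j => ?_
      by_cases hj : (j : ℕ) ∈ S.act ω
      · right
        change ∀ᵐ x ∂(R j ω), _
        filter_upwards [(hA ω).ae_cell j hj, hRM ω j hj] with x hx1 hx2
        refine ⟨fun h => ?_, hx2.trans ((le_abs_self _).trans
          (Finset.single_le_sum (f := fun j => |M j ω|) (fun _ _ => abs_nonneg _)
            (Finset.mem_range.2 j.2)))⟩
        have : (lev j : EReal) < F (ω, x) := hx1.2
        rw [h] at this
        exact not_lt_bot this
      · exact Or.inl (h1 j hj)
    refine ⟨hae, fun i => ?_, ?_⟩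
    · obtain ⟨hi, he⟩ := integral_wsum (u := fun x => D (ω, x) i) (R := fun j => R j ω) h0 fun j => by
        by_cases hj : (j : ℕ) ∈ S.act ω
        · exact Or.inr ((hA ω).integrable hj i)
        · exact Or.inl (h1 j hj)
      exact ⟨hi, he.trans (h3 i)⟩
    · have hInteg : ∀ j, j ∈ S.act ω → Integrable (fun x => capE (k ω) (F (ω, x))) (R j ω) := by
        intro j hj
        have := hp j ω
        refine Integrable.of_bound ((hg'.section ω).aemeasurable _).aestronglyMeasurable (M j ω) ?_
        filter_upwards [hRM ω j hj] with x hx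
        exact (hb (ω, x)).trans hx
      obtain ⟨hi, he⟩ := integral_wsum (u := fun x => capE (k ω) (F (ω, x)))
        (R := fun j => R j ω) h0 fun j => by
          by_cases hj : (j : ℕ) ∈ S.act ω
          · exact Or.inr (hInteg j hj)
          · exact Or.inl (h1 j hj)
      refine h4.trans ?_
      change _ ≤ ∫ x, capE (k ω) (F (ω, x)) ∂_
      rw [he]
      refine Finset.sum_le_sum fun j _ => ?_
      by_cases hj : (j : ℕ) ∈ S.act ω
      · refine mul_le_mul_of_nonneg_left ?_ (h0 j)
        have := hp j ω
        have h5 := integral_mono_ae (integrable_const (cap (k ω) (lev j))) (hInteg j hj) (by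
          filter_upwards [(hA ω).ae_cell j hj] with x hx
          exact cap_le_capE _ hx.2)
        simpa using h5
      · simp [h1 j hj]

end StepData

end Step

section QuasiSure

variable {α : Type*} [MeasurableSpace α] {PP : Set (Measure α)} {p : α → Prop}

lemma QuasiSure.ae (h : QuasiSure PP (univComp α) p) {P : Measure α} (hP : P ∈ PP) :
    ∀ᵐ ω ∂P, p ω := by
  obtain ⟨A, -, hA, h0⟩ := h
  exact measure_mono_null hA (h0 P hP)

lemma quasiSure_of_ae (hp : USet {ω | p ω}) (h : ∀ P ∈ PP, ∀ᵐ ω ∂P, p ω) :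
    QuasiSure PP (univComp α) p :=
  ⟨{ω | ¬ p ω}, MeasurableSet.compl hp, subset_rfl, fun P hP => h P hP⟩

end QuasiSure

lemma exists_backward_family {A : ℕ → Type*} {r : (t : ℕ) → A t → A (t + 1) → Prop} {T : ℕ}
    [∀ t, Nonempty (A t)] (b : A T) (h : ∀ t, t < T → ∀ y : A (t + 1), ∃ x, r t x y) :
    ∃ a : (t : ℕ) → A t, a T = b ∧ ∀ t, t < T → r t (a t) (a (t + 1)) := by
  have key : ∀ n t, t + n = T → ∃ a : (t : ℕ) → A t, a T = b ∧
      ∀ s, t ≤ s → s < T → r s (a s) (a (s + 1)) := by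
    intro n
    induction n with
    | zero =>
      intro t ht
      exact ⟨Function.update (fun t => Classical.arbitrary _) T b, Function.update_self _ _ _,
        fun s h1 h2 => by omega⟩
    | succ n ih =>
      intro t ht
      obtain ⟨a, ha, hr⟩ := ih (t + 1) (by omega)
      obtain ⟨x, hx⟩ := h t (by omega) (a (t + 1))
      refine ⟨Function.update a t x, ?_, fun s h1 h2 => ?_⟩
      · rw [Function.update_of_ne (by omega), ha]
      · rw [Function.update_of_ne (show s + 1 ≠ t by omega)]
        rcases eq_or_lt_of_le h1 with rfl | h3
        · rwa [Function.update_self]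
        · rw [Function.update_of_ne (by omega)]
          exact hr s h3 h2
  obtain ⟨a, ha, hr⟩ := key T 0 (by omega)
  exact ⟨a, ha, fun t ht => hr t (Nat.zero_le _) ht⟩

lemma exists_forward_family {A : ℕ → Type*} {r : (t : ℕ) → A t → A (t + 1) → Prop}
    (b : A 0) (h : ∀ t (x : A t), ∃ y, r t x y) :
    ∃ a : (t : ℕ) → A t, a 0 = b ∧ ∀ t, r t (a t) (a (t + 1)) := by
  choose next hnext using h
  exact ⟨fun t => Nat.rec b (fun t x => next t x) t, rfl, fun t => hnext t _⟩

section Paths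

variable {Ω₁ : Type} [MeasurableSpace Ω₁]

/-- Appending a coordinate to a path. -/
def app (t : ℕ) (z : (Fin t → Ω₁) × Ω₁) : Fin (t + 1) → Ω₁ :=
  Fin.snoc (α := fun _ => Ω₁) z.1 z.2

/-- Splitting off the last coordinate of a path. -/
def unapp (t : ℕ) (η : Fin (t + 1) → Ω₁) : (Fin t → Ω₁) × Ω₁ :=
  (restr Ω₁ t (Nat.le_succ t) η, η (Fin.last t))

lemma app_unapp (t : ℕ) (η : Fin (t + 1) → Ω₁) : app t (unapp t η) = η :=
  Fin.snoc_init_self (α := fun _ => Ω₁) η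

lemma restr_app {s t : ℕ} (h : s ≤ t) (z : (Fin t → Ω₁) × Ω₁) :
    restr Ω₁ s (h.trans (Nat.le_succ t)) (app t z) = restr Ω₁ s h z.1 := by
  ext i
  exact Fin.snoc_castSucc (α := fun _ => Ω₁) z.2 z.1 (Fin.castLE h i)

lemma unapp_app (t : ℕ) (z : (Fin t → Ω₁) × Ω₁) : unapp t (app t z) = z :=
  Prod.ext (restr_app le_rfl z) (Fin.snoc_last (α := fun _ => Ω₁) z.2 z.1)

lemma measurable_app (t : ℕ) : Measurable (app (Ω₁ := Ω₁) t) := by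
  refine measurable_pi_lambda _ fun i => ?_
  refine Fin.lastCases ?_ (fun j => ?_) i
  · simpa [app] using measurable_snd
  · simp only [app, Fin.snoc_castSucc]
    exact (measurable_pi_apply j).comp measurable_fst

lemma measurable_restr {t T : ℕ} (h : t ≤ T) : Measurable (restr Ω₁ t h) :=
  measurable_pi_lambda _ fun _ => measurable_pi_apply _

lemma measurable_unapp (t : ℕ) : Measurable (unapp (Ω₁ := Ω₁) t) :=
  (measurable_restr _).prodMk (measurable_pi_apply _)

lemma continuous_app [TopologicalSpace Ω₁] (t : ℕ) : Continuous (app (Ω₁ := Ω₁) t) := by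
  refine continuous_pi fun i => ?_
  refine Fin.lastCases ?_ (fun j => ?_) i
  · simpa [app] using continuous_snd
  · simp only [app, Fin.snoc_castSucc]
    exact (continuous_apply j).comp continuous_fst

variable {d : ℕ} {S : (t : ℕ) → (Fin t → Ω₁) → Fin d → ℝ}
  {H : (u : ℕ) → (Fin u → Ω₁) → Fin d → ℝ}

lemma gain_app (t : ℕ) (z : (Fin t → Ω₁) × Ω₁) :
    gain Ω₁ S H (t + 1) le_rfl (app t z) =
      gain Ω₁ S H t le_rfl z.1 + ∑ i, H t z.1 i * incr Ω₁ S t z.1 z.2 i := by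
  rw [gain, Fin.sum_univ_castSucc, gain]
  congr 1
  · refine Finset.sum_congr rfl fun u _ => Finset.sum_congr rfl fun i _ => ?_
    rw [← restr_app u.2.le z, ← restr_app (Nat.succ_le_of_lt u.2) z]
    rfl
  · refine Finset.sum_congr rfl fun i _ => ?_
    have h : restr Ω₁ t (Nat.le_succ t) (app t z) = z.1 := restr_app le_rfl z
    change H t (restr Ω₁ t _ (app t z)) i *
      (S (t + 1) (app t z) i - S t (restr Ω₁ t _ (app t z)) i) = _
    rw [h]
    rfl

lemma gain_update {T t : ℕ} (ht : t < T) (h : (Fin t → Ω₁) → Fin d → ℝ) (ω : Fin T → Ω₁) :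
    gain Ω₁ S (Function.update (fun _ _ => 0) t h) T le_rfl ω =
      ∑ i, h (restr Ω₁ t ht.le ω) i *
        (S (t + 1) (restr Ω₁ (t + 1) ht ω) i - S t (restr Ω₁ t ht.le ω) i) := by
  rw [gain, Finset.sum_eq_single ⟨t, ht⟩]
  · simp
  · intro u _ hu
    rw [Function.update_of_ne fun h => hu (Fin.ext h)]
    simp
  · simp

lemma umeas_gain {T : ℕ} (hS : ∀ t, t ≤ T → Measurable (S t)) (hH : Pred Ω₁ d H) {t : ℕ}
    (h : t ≤ T) : UMeas (gain Ω₁ S H t h) := by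
  refine Finset.measurable_fun_sum (m := univComp _) _ fun u _ =>
    Finset.measurable_fun_sum (m := univComp _) _ fun i _ => Measurable.mul (m := univComp _) ?_ ?_
  · have : UMeas (H u) := hH u
    exact (measurable_pi_apply i).comp (this.comp_measurable (measurable_restr _))
  · exact UMeas.of_measurable
      ((((measurable_pi_apply i).comp (hS _ (Nat.succ_le_of_lt (u.2.trans_le h)))).comp
        (measurable_restr _)).sub
        (((measurable_pi_apply i).comp (hS _ (u.2.le.trans h))).comp (measurable_restr _)))

end Paths

section Family

variable {Ω₁ : Type} [MeasurableSpace Ω₁] [TopologicalSpace Ω₁] [PolishSpace Ω₁] [BorelSpace Ω₁]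
  {Pt : (t : ℕ) → (Fin t → Ω₁) → Set (ProbabilityMeasure Ω₁)} {t : ℕ}

lemma MeasFam.step {ν : Measure (Fin t → Ω₁)} (hν : ν ∈ MeasFam Ω₁ Pt t)
    {κ : (Fin t → Ω₁) → ProbabilityMeasure Ω₁}
    (hκ : @Measurable _ _ (univComp (Fin t → Ω₁)) (borel (ProbabilityMeasure Ω₁)) κ)
    (hmem : ∀ ω, κ ω ∈ Pt t ω) :
    stepM (app t) ν (fun ω => (κ ω : Measure Ω₁)) ∈ MeasFam Ω₁ Pt (t + 1) :=
  ⟨ν, hν, κ, hκ, hmem, rfl⟩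

lemma MeasFam.exists_step {μ : Measure (Fin (t + 1) → Ω₁)} (hμ : μ ∈ MeasFam Ω₁ Pt (t + 1)) :
    ∃ ν ∈ MeasFam Ω₁ Pt t, ∃ κ : (Fin t → Ω₁) → ProbabilityMeasure Ω₁,
      @Measurable _ _ (univComp (Fin t → Ω₁)) (borel (ProbabilityMeasure Ω₁)) κ ∧
      (∀ ω, κ ω ∈ Pt t ω) ∧ μ = stepM (app t) ν fun ω => (κ ω : Measure Ω₁) := hμ

lemma MeasFam.prob : ∀ {t : ℕ} {μ : Measure (Fin t → Ω₁)}, μ ∈ MeasFam Ω₁ Pt t →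
    IsProbabilityMeasure μ
  | 0, μ, h => by
    have : μ = Measure.dirac Fin.elim0 := h
    rw [this]
    infer_instance
  | t + 1, μ, h => by
    obtain ⟨ν, hν, κ, hκ, -, rfl⟩ := MeasFam.exists_step h
    have := MeasFam.prob hν
    exact isProbabilityMeasure_stepM (measurable_app t) (umeas_toMeasure hκ) fun ω => inferInstance

/-- Marginals of a one-step extension. -/
lemma map_restr_stepM {ν : Measure (Fin t → Ω₁)} [IsProbabilityMeasure ν]
    {K : (Fin t → Ω₁) → Measure Ω₁} (hK : UMeas K) (hp : ∀ ω, IsProbabilityMeasure (K ω)) {s : ℕ}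
    (hs : s ≤ t) :
    (stepM (app t) ν K).map (restr Ω₁ s (hs.trans (Nat.le_succ t))) = ν.map (restr Ω₁ s hs) := by
  ext B hB
  rw [Measure.map_apply (measurable_restr _) hB, Measure.map_apply (measurable_restr _) hB,
    stepM_apply (measurable_app t) hK hp (USet.of_measurable (measurable_restr _ hB)),
    ← lintegral_indicator_one (measurable_restr _ hB)]
  refine lintegral_congr fun ω => ?_
  simp only [mem_preimage, restr_app hs]
  by_cases h : restr Ω₁ s hs ω ∈ B
  · simp [h, Set.indicator]
  · simp [h, Set.indicator]

lemma map_restr_stepM_self {ν : Measure (Fin t → Ω₁)} [IsProbabilityMeasure ν]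
    {K : (Fin t → Ω₁) → Measure Ω₁} (hK : UMeas K) (hp : ∀ ω, IsProbabilityMeasure (K ω)) :
    (stepM (app t) ν K).map (restr Ω₁ t (Nat.le_succ t)) = ν :=
  (map_restr_stepM hK hp le_rfl).trans Measure.map_id

lemma MeasFam.map_restr {s : ℕ} (hs : s ≤ t) {μ : Measure (Fin t → Ω₁)}
    (hμ : μ ∈ MeasFam Ω₁ Pt t) : μ.map (restr Ω₁ s hs) ∈ MeasFam Ω₁ Pt s := by
  induction t, hs using Nat.le_induction with
  | base => exact (Measure.map_id (μ := μ)).symm ▸ hμ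
  | succ t hst ih =>
    obtain ⟨ν, hν, κ, hκ, -, rfl⟩ := MeasFam.exists_step hμ
    have := MeasFam.prob hν
    rw [map_restr_stepM (umeas_toMeasure hκ) (fun ω => inferInstance) hst]
    exact ih hν

lemma MeasFam.exists_extension {T s : ℕ} (hs : s ≤ T)
    (hsel : ∀ t, t < T → ∃ κ : (Fin t → Ω₁) → ProbabilityMeasure Ω₁,
      @Measurable _ _ (univComp (Fin t → Ω₁)) (borel (ProbabilityMeasure Ω₁)) κ ∧
      ∀ ω, κ ω ∈ Pt t ω)
    {ν : Measure (Fin s → Ω₁)} (hν : ν ∈ MeasFam Ω₁ Pt s) :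
    ∃ μ ∈ MeasFam Ω₁ Pt T, μ.map (restr Ω₁ s hs) = ν := by
  induction T, hs using Nat.le_induction with
  | base => exact ⟨ν, hν, Measure.map_id⟩
  | succ t hst ih =>
    obtain ⟨μ, hμ, rfl⟩ := ih fun t ht => hsel t (ht.trans (Nat.lt_succ_self _))
    obtain ⟨κ, hκ, hmem⟩ := hsel t (Nat.lt_succ_self _)
    have := MeasFam.prob hμ
    exact ⟨_, MeasFam.step hμ hκ hmem,
      map_restr_stepM (umeas_toMeasure hκ) (fun ω => inferInstance) hst⟩

end Family

section Value

variable {Ω₁ : Type} [MeasurableSpace Ω₁] [TopologicalSpace Ω₁] [PolishSpace Ω₁] [BorelSpace Ω₁]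
  {T d : ℕ} {Pt : (t : ℕ) → (Fin t → Ω₁) → Set (ProbabilityMeasure Ω₁)}
  {S : (t : ℕ) → (Fin t → Ω₁) → Fin d → ℝ} {f : (Fin T → Ω₁) → ℝ}

/-- The dynamic superhedging values of a claim, obtained by backward recursion. -/
structure ValueProcess (Pt : (t : ℕ) → (Fin t → Ω₁) → Set (ProbabilityMeasure Ω₁))
    (S : (t : ℕ) → (Fin t → Ω₁) → Fin d → ℝ) (f : (Fin T → Ω₁) → ℝ) where
  F : (t : ℕ) → (Fin t → Ω₁) → EReal
  usa : ∀ t, UpperSemianalyticE (F t)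
  step : ∀ t, t < T → StepData (Pt t) (fun z => incr Ω₁ S t z.1 z.2) (fun z => F (t + 1) (app t z))
  V_eq : ∀ t ht ω, (step t ht).V ω = F t ω
  terminal : ∀ ω, F T ω = f ω

lemma measurable_incr {t : ℕ} (ht : t < T) (hS : ∀ t, t ≤ T → Measurable (S t)) :
    Measurable fun z : (Fin t → Ω₁) × Ω₁ => incr Ω₁ S t z.1 z.2 := by
  refine measurable_pi_lambda _ fun i => ?_
  exact ((measurable_pi_apply i).comp ((hS (t + 1) ht).comp (measurable_app t))).sub
    ((measurable_pi_apply i).comp ((hS t ht.le).comp measurable_fst))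

lemma UpperSemianalyticE.comp_continuous {α β : Type*} [TopologicalSpace α] [TopologicalSpace β]
    [PolishSpace α] [T2Space β] {F : β → EReal} (hF : UpperSemianalyticE F) {g : α → β}
    (hg : Continuous g) : UpperSemianalyticE fun x => F (g x) :=
  fun c => (hF c).preimage hg

lemma nonempty_valueProcess [Nonempty Ω₁] (hne : ∀ t, t < T → ∀ ω, (Pt t ω).Nonempty)
    (hconv : ∀ t, t < T → ∀ ω, ConvexPM (Pt t ω))
    (hgraph : ∀ t, t < T →
      AnalyticSet {p : (Fin t → Ω₁) × ProbabilityMeasure Ω₁ | p.2 ∈ Pt t p.1})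
    (hS : ∀ t, t ≤ T → Measurable (S t)) (hf : UpperSemianalytic f) :
    Nonempty (ValueProcess Pt S f) := by
  have hb : UpperSemianalyticE fun ω => (f ω : EReal) := fun c => by
    simpa only [EReal.coe_lt_coe_iff] using hf c
  have : ∀ t, Nonempty {F : (Fin t → Ω₁) → EReal // UpperSemianalyticE F} := fun t =>
    ⟨⟨fun _ => ⊥, fun c => by simpa using analyticSet_empty⟩⟩
  obtain ⟨F, hFT, hr⟩ := exists_backward_family
    (A := fun t => {F : (Fin t → Ω₁) → EReal // UpperSemianalyticE F})
    (r := fun t F F' => ∃ D : StepData (Pt t) (fun z => incr Ω₁ S t z.1 z.2)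
      (fun z => F'.1 (app t z)), ∀ ω, D.V ω = F.1 ω) ⟨_, hb⟩
    (fun t ht F' => by
      obtain ⟨D⟩ := nonempty_stepData (hne t ht) (hconv t ht) (hgraph t ht) (measurable_incr ht hS)
        (F'.2.comp_continuous (continuous_app t))
      exact ⟨⟨D.V, D.upperSemianalyticE_V⟩, D, fun _ => rfl⟩)
  choose D hD using hr
  exact ⟨⟨fun t => (F t).1, fun t => (F t).2, D, hD, fun ω => by rw [hFT]⟩⟩

lemma MeasFam.ae_step {t : ℕ} {ν : Measure (Fin t → Ω₁)}
    (hν : ν ∈ MeasFam Ω₁ Pt t) {κ : (Fin t → Ω₁) → ProbabilityMeasure Ω₁}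
    (hκ : @Measurable _ _ (univComp (Fin t → Ω₁)) (borel (ProbabilityMeasure Ω₁)) κ)
    {p : (Fin (t + 1) → Ω₁) → Prop} (hp : USet {η | p η}) :
    (∀ᵐ η ∂(stepM (app t) ν fun ω => (κ ω : Measure Ω₁)), p η) ↔
      ∀ᵐ ω ∂ν, ∀ᵐ x ∂(κ ω : Measure Ω₁), p (app t (ω, x)) := by
  have := MeasFam.prob hν
  exact ae_stepM_iff (measurable_app t) (umeas_toMeasure hκ) (fun ω => inferInstance) hp

namespace ValueProcess

lemma exists_selector (V : ValueProcess Pt S f) {t : ℕ} (ht : t < T) :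
    ∃ κ : (Fin t → Ω₁) → ProbabilityMeasure Ω₁,
      @Measurable _ _ (univComp (Fin t → Ω₁)) (borel (ProbabilityMeasure Ω₁)) κ ∧
      ∀ ω, κ ω ∈ Pt t ω :=
  ⟨(V.step t ht).P 0, (V.step t ht).measurable_P 0, (V.step t ht).P_mem 0⟩

/-- A set of histories admitting a one-step arbitrage is negligible. -/
lemma measure_bad_eq_zero (V : ValueProcess Pt S f) (hS : ∀ t, t ≤ T → Measurable (S t))
    (hNA : NA Ω₁ (MeasFam Ω₁ Pt T) S (fun i : Fin 0 => i.elim0)) {t : ℕ} (ht : t < T)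
    (hF : ∀ μ ∈ MeasFam Ω₁ Pt (t + 1), ∀ᵐ η ∂μ, V.F (t + 1) η ≠ ⊥)
    {ν : Measure (Fin t → Ω₁)} (hν : ν ∈ MeasFam Ω₁ Pt t) (n : ℕ) :
    ν ((V.step t ht).bad n) = 0 := by
  classical
  obtain ⟨y, hy, hbad⟩ := (V.step t ht).exists_arbitrage n
  have hbadU : USet ((V.step t ht).bad n) := ((V.step t ht).exists_bad_selector n).1
  set h : (Fin t → Ω₁) → Fin d → ℝ := fun ω => if ω ∈ (V.step t ht).bad n then y ω else 0 with hh
  have hhU : UMeas h := UMeas.ite hbadU hy (UMeas.const 0)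
  set H : (u : ℕ) → (Fin u → Ω₁) → Fin d → ℝ := Function.update (fun _ _ => 0) t h with hH
  have hPred : Pred Ω₁ d H := by
    intro u
    rcases eq_or_ne u t with rfl | hu
    · rw [hH, Function.update_self]
      exact hhU
    · rw [hH, Function.update_of_ne hu]
      exact UMeas.const 0
  have hsetF : USet {η : Fin (t + 1) → Ω₁ | V.F (t + 1) η ≠ ⊥} :=
    (V.usa (t + 1)).umeas (measurableSet_singleton ⊥).compl
  set G : (Fin (t + 1) → Ω₁) → ℝ := fun η => ∑ i, h (unapp t η).1 i *
    incr Ω₁ S t (unapp t η).1 (unapp t η).2 i with hG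
  have hGU : UMeas G := by
    refine Finset.measurable_fun_sum (m := univComp _) _ fun i _ =>
      Measurable.mul (m := univComp _) ?_ ?_
    · exact (measurable_pi_apply i).comp
        (hhU.comp_measurable (measurable_fst.comp (measurable_unapp t)))
    · exact UMeas.of_measurable ((measurable_pi_apply i).comp
        ((measurable_incr ht hS).comp (measurable_unapp t)))
  have hgain : ∀ ω : Fin T → Ω₁, gain Ω₁ S H T le_rfl ω = G (restr Ω₁ (t + 1) ht ω) := by
    intro ω
    rw [hH, gain_update ht, hG]
    refine Finset.sum_congr rfl fun i _ => ?_
    have : app t (unapp t (restr Ω₁ (t + 1) ht ω)) = restr Ω₁ (t + 1) ht ω := app_unapp _ _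
    change _ = _ * (S (t + 1) (app t (unapp t (restr Ω₁ (t + 1) ht ω))) i - _)
    rw [this]
    rfl
  have hnn : QuasiSure (MeasFam Ω₁ Pt T) (univComp (Fin T → Ω₁)) (fun ω =>
      0 ≤ gain Ω₁ S H T le_rfl ω + ∑ i : Fin 0, (fun i : Fin 0 => (0 : ℝ)) i *
        (fun i : Fin 0 => (i.elim0 : (Fin T → Ω₁) → ℝ)) i ω) := by
    simp only [Finset.univ_eq_empty, Finset.sum_empty, add_zero]
    refine quasiSure_of_ae (USet.le (UMeas.const 0) (umeas_gain hS hPred le_rfl)) fun P hP => ?_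
    have hP' := MeasFam.map_restr (show t + 1 ≤ T from ht) hP
    simp only [hgain]
    refine ae_of_ae_map (measurable_restr _).aemeasurable (p := fun η => 0 ≤ G η) ?_
    have hne := hF _ hP'
    generalize P.map (restr Ω₁ (t + 1) ht) = μ at hP' hne
    obtain ⟨ν', hν', κ, hκ, hmem, rfl⟩ := MeasFam.exists_step hP'
    rw [MeasFam.ae_step hν' hκ hsetF] at hne
    rw [MeasFam.ae_step hν' hκ (USet.le (UMeas.const 0) hGU)]
    filter_upwards [hne] with ω hω
    by_cases hb : ω ∈ (V.step t ht).bad n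
    · filter_upwards [hω, (hbad ω hb).1 _ (hmem ω)] with x hx1 hx2
      simpa only [hG, unapp_app, hh, if_pos hb] using hx2 hx1
    · refine Eventually.of_forall fun x => ?_
      simp [hG, unapp_app, hh, if_neg hb]
  have hz := hNA H hPred (fun _ => 0) hnn
  simp only [Finset.univ_eq_empty, Finset.sum_empty, add_zero] at hz
  obtain ⟨μ, hμ, hμr⟩ := MeasFam.exists_extension (show t + 1 ≤ T from ht)
    (fun s hs => V.exists_selector hs)
    (MeasFam.step hν ((V.step t ht).measurable_P n) ((V.step t ht).P_mem n))
  have hG0 : USet {η | G η = 0} := hGU (measurableSet_singleton 0)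
  have h1 : ∀ᵐ η ∂(stepM (app t) ν fun ω => ((V.step t ht).P n ω : Measure Ω₁)), G η = 0 := by
    rw [← hμr, ae_iff, Measure.map_apply₀ (measurable_restr _).aemeasurable]
    · have := hz.ae hμ
      simp only [hgain] at this
      exact this
    · have := MeasFam.prob hμ
      have := Measure.isProbabilityMeasure_map (μ := μ) (measurable_restr ht).aemeasurable
      exact USet.nullMeasurableSet (MeasurableSet.compl hG0) _
  rw [MeasFam.ae_step hν ((V.step t ht).measurable_P n) hG0] at h1
  have : ∀ᵐ ω ∂ν, ω ∉ (V.step t ht).bad n := by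
    filter_upwards [h1] with ω hω hb
    refine (hbad ω hb).2 ?_
    filter_upwards [hω] with x hx
    simpa only [hG, unapp_app, hh, if_pos hb] using hx
  simpa [ae_iff] using this

lemma ae_good (V : ValueProcess Pt S f) (hS : ∀ t, t ≤ T → Measurable (S t))
    (hNA : NA Ω₁ (MeasFam Ω₁ Pt T) S (fun i : Fin 0 => i.elim0)) {t : ℕ} (ht : t < T)
    (hF : ∀ μ ∈ MeasFam Ω₁ Pt (t + 1), ∀ᵐ η ∂μ, V.F (t + 1) η ≠ ⊥)
    {ν : Measure (Fin t → Ω₁)} (hν : ν ∈ MeasFam Ω₁ Pt t) :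
    ∀ᵐ ω ∂ν, ω ∈ (V.step t ht).good := by
  have hsetF : USet {η : Fin (t + 1) → Ω₁ | V.F (t + 1) η ≠ ⊥} :=
    (V.usa (t + 1)).umeas (measurableSet_singleton ⊥).compl
  have h1 := hF _ (MeasFam.step hν ((V.step t ht).measurable_P 0) ((V.step t ht).P_mem 0))
  rw [MeasFam.ae_step hν ((V.step t ht).measurable_P 0) hsetF] at h1
  have h2 : ∀ᵐ ω ∂ν, ∀ n, ω ∉ (V.step t ht).bad n :=
    ae_all_iff.2 fun n => by simpa [ae_iff] using V.measure_bad_eq_zero hS hNA ht hF hν n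
  filter_upwards [h1, h2] with ω hω1 hω2
  by_contra hg
  rcases (V.step t ht).eq_bot_or_bad hg with h | ⟨n, hn⟩
  · obtain ⟨x, hx1, hx2⟩ := (hω1.and (h _ ((V.step t ht).P_mem 0 ω))).exists
    exact hx1 hx2
  · exact hω2 n hn

lemma ae_ne_bot (V : ValueProcess Pt S f) (hS : ∀ t, t ≤ T → Measurable (S t))
    (hNA : NA Ω₁ (MeasFam Ω₁ Pt T) S (fun i : Fin 0 => i.elim0)) {t : ℕ} (ht : t ≤ T) :
    ∀ μ ∈ MeasFam Ω₁ Pt t, ∀ᵐ ω ∂μ, V.F t ω ≠ ⊥ := by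
  induction ht using Nat.decreasingInduction with
  | self => exact fun μ _ => Eventually.of_forall fun ω => by simp [V.terminal]
  | of_succ t ht ih =>
    intro μ hμ
    filter_upwards [V.ae_good hS hNA ht ih hμ] with ω hω
    rw [← V.V_eq t ht]
    exact (V.step t ht).V_ne_bot hω

lemma ae_mem_good (V : ValueProcess Pt S f) (hS : ∀ t, t ≤ T → Measurable (S t))
    (hNA : NA Ω₁ (MeasFam Ω₁ Pt T) S (fun i : Fin 0 => i.elim0)) {t : ℕ} (ht : t < T)
    {ν : Measure (Fin t → Ω₁)} (hν : ν ∈ MeasFam Ω₁ Pt t) : ∀ᵐ ω ∂ν, ω ∈ (V.step t ht).good :=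
  V.ae_good hS hNA ht (V.ae_ne_bot hS hNA ht) hν

end ValueProcess

end Value

namespace ValueProcess

variable {Ω₁ : Type} [MeasurableSpace Ω₁] [TopologicalSpace Ω₁] [PolishSpace Ω₁] [BorelSpace Ω₁]
  {T d : ℕ} {Pt : (t : ℕ) → (Fin t → Ω₁) → Set (ProbabilityMeasure Ω₁)}
  {S : (t : ℕ) → (Fin t → Ω₁) → Fin d → ℝ} {f : (Fin T → Ω₁) → ℝ}

lemma umeas_claim (V : ValueProcess Pt S f) : UMeas f := by
  have h : UMeas (V.F T) := (V.usa T).umeas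
  have : f = fun ω => (V.F T ω).toReal := by
    ext ω
    simp [V.terminal]
  rw [this]
  exact measurable_ereal_toReal.comp h

lemma superPrice_le (V : ValueProcess Pt S f) (hS : ∀ t, t ≤ T → Measurable (S t))
    (hNA : NA Ω₁ (MeasFam Ω₁ Pt T) S (fun i : Fin 0 => i.elim0)) {a : ℝ}
    (ha : V.F 0 Fin.elim0 = a) :
    superPrice Ω₁ (MeasFam Ω₁ Pt T) S (fun i : Fin 0 => i.elim0) f ≤ a := by
  have hex : ∀ t, ∃ y : (Fin t → Ω₁) → Fin d → ℝ, UMeas y ∧ ∀ ht : t < T,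
      ∀ ω ∈ (V.step t ht).good, V.F t ω ≠ ⊤ → ∀ P ∈ Pt t ω, ∀ᵐ x ∂(P : Measure Ω₁),
        V.F (t + 1) (app t (ω, x)) ≤
          (((V.F t ω).toReal + ∑ i, y ω i * incr Ω₁ S t ω x i : ℝ) : EReal) := by
    intro t
    by_cases ht : t < T
    · obtain ⟨y, hy, h⟩ := (V.step t ht).exists_superhedge
      refine ⟨y, hy, fun ht ω hω h1 P hP => ?_⟩
      have := h ω hω (by rwa [V.V_eq]) P hP
      rwa [V.V_eq] at this
    · exact ⟨fun _ => 0, UMeas.const 0, fun h => absurd h ht⟩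
  choose H hH hedge using hex
  have hstep : ∀ t, t ≤ T → ∀ μ ∈ MeasFam Ω₁ Pt t, ∀ᵐ ω ∂μ,
      V.F t ω ≤ ((a + gain Ω₁ S H t le_rfl ω : ℝ) : EReal) := by
    intro t
    induction t with
    | zero =>
      refine fun _ μ _ => Eventually.of_forall fun ω => ?_
      rw [Subsingleton.elim ω Fin.elim0, ha]
      simp [gain]
    | succ t ih =>
      intro ht μ hμ
      obtain ⟨ν, hν, κ, hκ, hmem, rfl⟩ := MeasFam.exists_step hμ
      have hg : UMeas fun η => ((a + gain Ω₁ S H (t + 1) le_rfl η : ℝ) : EReal) :=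
        measurable_coe_real_ereal.comp (Measurable.const_add (m := univComp _)
          (umeas_gain (fun s hs => hS s (hs.trans ht)) hH le_rfl) a)
      rw [MeasFam.ae_step hν hκ (USet.le (V.usa (t + 1)).umeas hg)]
      filter_upwards [ih (Nat.le_of_succ_le ht) ν hν, V.ae_mem_good hS hNA ht hν] with ω h1 h2
      have htop : V.F t ω ≠ ⊤ := ne_top_of_le_ne_top (EReal.coe_ne_top _) h1
      have hbot : V.F t ω ≠ ⊥ := by
        rw [← V.V_eq t ht]
        exact (V.step t ht).V_ne_bot h2
      have h3 : (V.F t ω).toReal ≤ a + gain Ω₁ S H t le_rfl ω := by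
        rw [← EReal.coe_le_coe_iff, EReal.coe_toReal htop hbot]
        exact h1
      filter_upwards [hedge t ht ω h2 htop _ (hmem ω)] with x hx
      refine hx.trans (EReal.coe_le_coe_iff.2 ?_)
      rw [gain_app]
      linarith
  refine sInf_le ⟨a, ⟨H, fun _ => 0, hH, ?_⟩, rfl⟩
  simp only [Finset.univ_eq_empty, Finset.sum_empty, add_zero]
  refine quasiSure_of_ae (USet.le V.umeas_claim (Measurable.const_add (m := univComp _)
    (umeas_gain hS hH le_rfl) a)) fun P hP => ?_
  filter_upwards [hstep T le_rfl P hP] with ω hω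
  rw [V.terminal] at hω
  exact_mod_cast hω

end ValueProcess

lemma expec_eq_integral {α : Type*} [MeasurableSpace α] {Q : Measure α} {f : α → ℝ}
    (hf : Integrable f Q) : expec Q f = ((∫ x, f x ∂Q : ℝ) : EReal) := by
  have h1 : ∫⁻ x, ENNReal.ofReal (f x) ∂Q ≠ ⊤ := hf.lintegral_lt_top.ne
  have h2 : ∫⁻ x, ENNReal.ofReal (-f x) ∂Q ≠ ⊤ := hf.neg.lintegral_lt_top.ne
  rw [expec, integral_eq_lintegral_pos_part_sub_lintegral_neg_part hf, EReal.coe_sub,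
    EReal.coe_ennreal_toReal h1, EReal.coe_ennreal_toReal h2]

lemma UMeas.aestronglyMeasurable {α : Type*} [MeasurableSpace α] {u : α → ℝ} (hu : UMeas u)
    (μ : Measure α) [IsProbabilityMeasure μ] : AEStronglyMeasurable u μ :=
  (hu.aemeasurable μ).aestronglyMeasurable

lemma setIntegral_map_of_uset {α β : Type*} [MeasurableSpace α] [MeasurableSpace β]
    {Q : Measure α} [IsProbabilityMeasure Q] {r : α → β} (hr : Measurable r) {A : Set β}
    (hA : USet A) {u : β → ℝ} (hu : UMeas u) :
    ∫ y in A, u y ∂(Q.map r) = ∫ x in r ⁻¹' A, u (r x) ∂Q := by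
  have := Measure.isProbabilityMeasure_map (μ := Q) hr.aemeasurable
  have hA' : USet (r ⁻¹' A) := hA.preimage hr
  rw [← integral_indicator₀ (hA.nullMeasurableSet _), ← integral_indicator₀
    (hA'.nullMeasurableSet _), integral_map hr.aemeasurable]
  · rfl
  · exact UMeas.aestronglyMeasurable (Measurable.indicator (m := univComp _) hu hA) _

section Step

open ProbabilityTheory

variable {Θ X Y : Type*} [MeasurableSpace Θ] [MeasurableSpace X] [MeasurableSpace Y]
  [MeasurableSpace.CountablyGenerated X]
  {e : Θ × X → Y} {μ : Measure Θ} [IsProbabilityMeasure μ] {K : Θ → Measure X}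

lemma exists_stepM_eq_map (he : Measurable e) (hK : UMeas K)
    (hp : ∀ ω, IsProbabilityMeasure (K ω)) :
    ∃ K' : Kernel Θ X, IsMarkovKernel K' ∧ (∀ᵐ ω ∂μ, K ω = K' ω) ∧
      stepM e μ K = (μ.compProd K').map e := by
  have := nonempty_of_isProbabilityMeasure μ
  obtain ⟨K', hK', hae⟩ := exists_kernel_ae_eq hK hp μ
  refine ⟨K', hK', hae, ?_⟩
  ext A hA
  rw [stepM_apply he hK hp (USet.of_measurable hA), Measure.map_apply he hA,
    Measure.compProd_apply (he hA)]
  refine lintegral_congr_ae ?_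
  filter_upwards [hae] with ω hω
  rw [hω]
  rfl

lemma integral_stepM (he : Measurable e) (hK : UMeas K) (hp : ∀ ω, IsProbabilityMeasure (K ω))
    {u : Y → ℝ} (hu : Integrable u (stepM e μ K)) :
    Integrable (fun ω => ∫ x, u (e (ω, x)) ∂(K ω)) μ ∧
      ∫ y, u y ∂(stepM e μ K) = ∫ ω, ∫ x, u (e (ω, x)) ∂(K ω) ∂μ := by
  obtain ⟨K', hK', hae, heq⟩ := exists_stepM_eq_map (μ := μ) he hK hp
  rw [heq] at hu ⊢
  have hu' : Integrable (fun z => u (e z)) (μ.compProd K') := hu.comp_measurable he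
  have hcongr : (fun ω => ∫ x, u (e (ω, x)) ∂(K' ω)) =ᵐ[μ] fun ω => ∫ x, u (e (ω, x)) ∂(K ω) := by
    filter_upwards [hae] with ω hω
    rw [hω]
  have hInteg : Integrable (fun ω => ∫ x, u (e (ω, x)) ∂(K' ω)) μ :=
    Integrable.integral_compProd (κ := Kernel.const Unit μ) (η := Kernel.prodMkLeft Unit K')
      (a := ()) hu'
  refine ⟨hInteg.congr hcongr, ?_⟩
  rw [integral_map he.aemeasurable hu.aestronglyMeasurable, Measure.integral_compProd hu']
  exact integral_congr_ae hcongr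

lemma stepM_absolutelyContinuous {ν : Measure Θ} [IsProbabilityMeasure ν] {L : Θ → Measure X}
    (he : Measurable e) (hK : UMeas K) (hp : ∀ ω, IsProbabilityMeasure (K ω)) (hL : UMeas L)
    (hq : ∀ ω, IsProbabilityMeasure (L ω)) (hμν : μ ≪ ν) (hKL : ∀ ω, K ω ≪ L ω) :
    stepM e μ K ≪ stepM e ν L := by
  refine Measure.AbsolutelyContinuous.mk fun A hA h0 => ?_
  have hA' : USet {y | y ∉ A} := USet.of_measurable hA.compl
  have h1 : ∀ᵐ y ∂(stepM e ν L), y ∉ A := by simpa [ae_iff] using h0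
  rw [ae_stepM_iff he hL hq hA'] at h1
  have h2 : ∀ᵐ y ∂(stepM e μ K), y ∉ A := by
    rw [ae_stepM_iff he hK hp hA']
    filter_upwards [hμν.ae_le h1] with ω hω using (hKL ω).ae_le hω
  simpa [ae_iff] using h2

end Step

section Mart

variable {Ω₁ : Type} [MeasurableSpace Ω₁] [TopologicalSpace Ω₁] [PolishSpace Ω₁] [BorelSpace Ω₁]
  {d : ℕ} {S : (t : ℕ) → (Fin t → Ω₁) → Fin d → ℝ}

lemma IsMartMeas.step {t : ℕ} (hS : ∀ s, s ≤ t + 1 → Measurable (S s))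
    {Q : Measure (Fin t → Ω₁)} [IsProbabilityMeasure Q] (hQ : IsMartMeas Ω₁ S Q)
    {κ : (Fin t → Ω₁) → Measure Ω₁} (hκ : UMeas κ) (hp : ∀ ω, IsProbabilityMeasure (κ ω))
    (hInteg : ∀ i, Integrable (fun η => S (t + 1) η i) (stepM (app t) Q κ))
    (hmart : ∀ᵐ ω ∂Q, ∀ i, ∫ x, incr Ω₁ S t ω x i ∂(κ ω) = 0) :
    IsMartMeas Ω₁ S (stepM (app t) Q κ) := by
  have hprob := isProbabilityMeasure_stepM (μ := Q) (measurable_app t) hκ hp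
  have hmap := map_restr_stepM_self (ν := Q) hκ hp
  have hSi : ∀ s, s ≤ t + 1 → ∀ i, Measurable fun ω => S s ω i := fun s hs i =>
    (measurable_pi_apply i).comp (hS s hs)
  have hI : ∀ (s : ℕ) (h : s ≤ t + 1) (i : Fin d),
      Integrable (fun ω => S s (restr Ω₁ s h ω) i) (stepM (app t) Q κ) := by
    intro s h i
    rcases eq_or_lt_of_le h with rfl | hlt
    · exact hInteg i
    · have h1 := hQ.1 s (Nat.lt_succ_iff.1 hlt) i
      rw [← hmap] at h1
      exact h1.comp_measurable (measurable_restr (Nat.le_succ t))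
  refine ⟨hI, fun s h i A hA => ?_⟩
  obtain ⟨B, hB, rfl⟩ := hA
  have hB : USet B := hB
  rcases eq_or_lt_of_le h with heq | hlt
  · obtain rfl : s = t := by omega
    have hA : USet (restr Ω₁ s (Nat.le_succ s) ⁻¹' B) := hB.preimage (measurable_restr _)
    have hd : Integrable (fun a => S (s + 1) (restr Ω₁ (s + 1) h a) i -
        S s (restr Ω₁ s (Nat.le_succ s) a) i) (stepM (app s) Q κ) :=
      (hI (s + 1) le_rfl i).sub (hI s (Nat.le_succ s) i)
    rw [← sub_eq_zero, ← integral_sub (hI (s + 1) h i).integrableOn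
      (hI s (Nat.le_succ s) i).integrableOn, ← integral_indicator₀ (hA.nullMeasurableSet _),
      (integral_stepM (measurable_app s) hκ hp (hd.indicator₀ (hA.nullMeasurableSet _))).2]
    refine integral_eq_zero_of_ae ?_
    filter_upwards [hmart] with ω hω
    have hr : ∀ x, restr Ω₁ s (Nat.le_succ s) (app s (ω, x)) = ω := fun x =>
      restr_app le_rfl (ω, x)
    by_cases hωB : ω ∈ B
    · have : ∀ x, (restr Ω₁ s (Nat.le_succ s) ⁻¹' B).indicator
          (fun a => S (s + 1) (restr Ω₁ (s + 1) h a) i - S s (restr Ω₁ s (Nat.le_succ s) a) i)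
            (app s (ω, x)) = incr Ω₁ S s ω x i := by
        intro x
        rw [indicator_of_mem (by rw [mem_preimage, hr]; exact hωB), hr]
        rfl
      exact (integral_congr_ae (Eventually.of_forall this)).trans (hω i)
    · have : ∀ x, (restr Ω₁ s (Nat.le_succ s) ⁻¹' B).indicator
          (fun a => S (s + 1) (restr Ω₁ (s + 1) h a) i - S s (restr Ω₁ s (Nat.le_succ s) a) i)
            (app s (ω, x)) = 0 := by
        intro x
        rw [indicator_of_notMem (by rw [mem_preimage, hr]; exact hωB)]
      exact (integral_congr_ae (Eventually.of_forall this)).trans (integral_zero _ _)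
  · have hst : s + 1 ≤ t := Nat.lt_succ_iff.1 hlt
    have hst' : s ≤ t := (Nat.le_succ s).trans hst
    have hA : USet (restr Ω₁ s hst' ⁻¹' B) := hB.preimage (measurable_restr _)
    have h1 := hQ.2 s hst i _ ⟨B, hB, rfl⟩
    have hu1 : UMeas fun ω => S (s + 1) (restr Ω₁ (s + 1) hst ω) i :=
      UMeas.of_measurable ((hSi (s + 1) h i).comp (measurable_restr hst))
    have hu2 : UMeas fun ω => S s (restr Ω₁ s hst' ω) i :=
      UMeas.of_measurable ((hSi s ((Nat.le_succ s).trans h) i).comp (measurable_restr hst'))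
    rw [← hmap, setIntegral_map_of_uset (measurable_restr _) hA hu1,
      setIntegral_map_of_uset (measurable_restr _) hA hu2] at h1
    exact h1

end Mart

namespace ValueProcess

variable {Ω₁ : Type} [MeasurableSpace Ω₁] [TopologicalSpace Ω₁] [PolishSpace Ω₁] [BorelSpace Ω₁]
  {T d : ℕ} {Pt : (t : ℕ) → (Fin t → Ω₁) → Set (ProbabilityMeasure Ω₁)}
  {S : (t : ℕ) → (Fin t → Ω₁) → Fin d → ℝ} {f : (Fin T → Ω₁) → ℝ}

/-- A one-step kernel of martingale measures, improving the target `g` to `g'`, under which the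
weight `Φ'` is dominated by `Φ`. -/
structure IsStepKernel (V : ValueProcess Pt S f) {t : ℕ} (ht : t < T) (g : (Fin t → Ω₁) → ℝ)
    (g' Φ' : (Fin (t + 1) → Ω₁) → ℝ) (Φ : (Fin t → Ω₁) → ℝ) (κ : (Fin t → Ω₁) → Measure Ω₁)
    (P : (Fin t → Ω₁) → ProbabilityMeasure Ω₁) : Prop where
  umeas : UMeas κ
  prob : ∀ ω, IsProbabilityMeasure (κ ω)
  measurable_sel : @Measurable _ _ (univComp (Fin t → Ω₁)) (borel (ProbabilityMeasure Ω₁)) P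
  mem : ∀ ω, P ω ∈ Pt t ω
  ac : ∀ ω, κ ω ≪ (P ω : Measure Ω₁)
  ae : ∀ ω ∈ (V.step t ht).good, (g ω : EReal) < V.F t ω →
    ∀ᵐ x ∂(κ ω), (g' (app t (ω, x)) : EReal) < V.F (t + 1) (app t (ω, x)) ∧
      Φ' (app t (ω, x)) ≤ Φ ω
  mart : ∀ ω ∈ (V.step t ht).good, (g ω : EReal) < V.F t ω →
    ∀ i, ∫ x, incr Ω₁ S t ω x i ∂(κ ω) = 0
  le_integral : ∀ ω ∈ (V.step t ht).good, (g ω : EReal) < V.F t ω →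
    g ω ≤ ∫ x, g' (app t (ω, x)) ∂(κ ω)

lemma exists_isStepKernel (V : ValueProcess Pt S f) {t : ℕ} (ht : t < T)
    {g : (Fin t → Ω₁) → ℝ} (hg : UMeas g) :
    ∃ g' : (Fin (t + 1) → Ω₁) → ℝ, UMeas g' ∧
      ∀ Φ' : (Fin (t + 1) → Ω₁) → ℝ, UMeas Φ' → (∀ η, |g' η| ≤ Φ' η) →
        ∃ Φ κ P, UMeas Φ ∧ V.IsStepKernel ht g g' Φ' Φ κ P := by
  obtain ⟨g', hg', hlt, hex⟩ := (V.step t ht).exists_martingale_kernel hg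
  refine ⟨fun η => g' (unapp t η), hg'.comp_measurable (measurable_unapp t), fun Φ' hΦ' hb => ?_⟩
  obtain ⟨κ, P, Φ, hκ, hp, hPm, hP, hΦ, hac, h⟩ := hex (fun z => Φ' (app t z))
    (hΦ'.comp_measurable (measurable_app t)) (fun z => by simpa [unapp_app] using hb (app t z))
  simp only [V.V_eq] at h
  refine ⟨Φ, κ, P, hΦ, hκ, hp, hPm, hP, hac, fun ω hω hgω => ?_,
    fun ω hω hgω i => ((h ω hω hgω).2.1 i).2, fun ω hω hgω => ?_⟩
  · filter_upwards [(h ω hω hgω).1] with x hx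
    rw [unapp_app]
    exact ⟨hlt _ hx.1, hx.2⟩
  · simp only [unapp_app]
    exact (h ω hω hgω).2.2

lemma umeas_weight {t : ℕ} (hS : Measurable (S t)) {g : (Fin t → Ω₁) → ℝ} (hg : UMeas g) :
    UMeas fun ω => |g ω| + ∑ i, |S t ω i| :=
  Measurable.add (m := univComp _) (measurable_norm.comp hg)
    (UMeas.of_measurable (Finset.measurable_fun_sum _ fun i _ =>
      measurable_norm.comp ((measurable_pi_apply i).comp hS)))

lemma exists_martingale_measure (V : ValueProcess Pt S f) (hS : ∀ t, t ≤ T → Measurable (S t))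
    (hNA : NA Ω₁ (MeasFam Ω₁ Pt T) S (fun i : Fin 0 => i.elim0))
    {φ : (Fin T → Ω₁) → ℝ} (hφ : UMeas φ) (hfφ : ∀ ω, |f ω| ≤ φ ω) {a : ℝ}
    (ha : (a : EReal) < V.F 0 Fin.elim0) :
    ∃ Q ∈ QSet Ω₁ (MeasFam Ω₁ Pt T) S (fun i : Fin 0 => i.elim0),
      (∫⁻ ω, ENNReal.ofReal (φ ω) ∂Q) < ⊤ ∧ (a : EReal) ≤ expec Q f := by
  obtain ⟨g, hg0, hg⟩ := exists_forward_family
    (A := fun t => {g : (Fin t → Ω₁) → ℝ // UMeas g})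
    (r := fun t g g' => ∀ ht : t < T,
      ∀ Φ' : (Fin (t + 1) → Ω₁) → ℝ, UMeas Φ' → (∀ η, |g'.1 η| ≤ Φ' η) →
        ∃ Φ κ P, UMeas Φ ∧ V.IsStepKernel ht g.1 g'.1 Φ' Φ κ P)
    ⟨fun _ => a, UMeas.const a⟩ (fun t g => by
      by_cases ht : t < T
      · obtain ⟨g', h1, h2⟩ := V.exists_isStepKernel ht g.2
        exact ⟨⟨g', h1⟩, fun _ => h2⟩
      · exact ⟨⟨fun _ => 0, UMeas.const 0⟩, fun h => absurd h ht⟩)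
  let w : (t : ℕ) → (Fin t → Ω₁) → ℝ := fun t ω => |(g t).1 ω| + ∑ i, |S t ω i|
  have hw : ∀ t, t ≤ T → UMeas (w t) := fun t ht => umeas_weight (hS t ht) (g t).2
  have hgw : ∀ t ω, |(g t).1 ω| ≤ w t ω := fun t ω =>
    le_add_of_nonneg_right (Finset.sum_nonneg fun i _ => abs_nonneg _)
  have hSw : ∀ t ω i, |S t ω i| ≤ w t ω := fun t ω i =>
    (Finset.single_le_sum (f := fun i => |S t ω i|) (fun i _ => abs_nonneg _)
      (Finset.mem_univ i)).trans (le_add_of_nonneg_left (abs_nonneg _))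
  have hne : ∀ t, Nonempty {Φ : (Fin t → Ω₁) → ℝ // t ≤ T → UMeas Φ ∧ ∀ ω, w t ω ≤ Φ ω} :=
    fun t => ⟨⟨w t, fun ht => ⟨hw t ht, fun _ => le_rfl⟩⟩⟩
  obtain ⟨Φ, hΦT, hΦ⟩ := exists_backward_family
    (A := fun t => {Φ : (Fin t → Ω₁) → ℝ // t ≤ T → UMeas Φ ∧ ∀ ω, w t ω ≤ Φ ω})
    (r := fun t Φ Φ' => ∃ ht : t < T, ∃ κ P,
      V.IsStepKernel ht (g t).1 (g (t + 1)).1 Φ'.1 Φ.1 κ P)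
    ⟨fun ω => w T ω + φ ω, fun _ => ⟨Measurable.add (m := univComp _) (hw T le_rfl) hφ,
      fun ω => le_add_of_nonneg_right ((abs_nonneg _).trans (hfφ ω))⟩⟩
    (fun t ht Φ' => by
      obtain ⟨Φ, κ, P, h1, h2⟩ := hg t ht Φ'.1 (Φ'.2 ht).1 fun η =>
        (hgw (t + 1) η).trans ((Φ'.2 ht).2 η)
      refine ⟨⟨fun ω => |Φ ω| + w t ω, fun _ => ⟨Measurable.add (m := univComp _)
        (measurable_norm.comp h1) (hw t ht.le), fun ω => le_add_of_nonneg_left (abs_nonneg _)⟩⟩,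
        ht, κ, P, { h2 with ae := fun ω hω hgω => ?_ }⟩
      filter_upwards [h2.ae ω hω hgω] with x hx
      refine ⟨hx.1, hx.2.trans ((le_abs_self _).trans (le_add_of_nonneg_right ?_))⟩
      exact (abs_nonneg _).trans (hgw t ω))
  choose _ κ P hker using hΦ
  set c : ℝ := (Φ 0).1 Fin.elim0
  have hbdd : ∀ t, t ≤ T → ∀ (Q : Measure (Fin t → Ω₁)) [IsProbabilityMeasure Q],
      (∀ᵐ ω ∂Q, (Φ t).1 ω ≤ c) → Integrable (g t).1 Q ∧ ∀ i, Integrable (fun ω => S t ω i) Q := by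
    intro t ht Q _ hQ
    have hle := (Φ t).2 ht
    refine ⟨Integrable.of_bound ((g t).2.aestronglyMeasurable Q) c ?_, fun i =>
      Integrable.of_bound ((measurable_pi_apply i).comp (hS t ht)).aestronglyMeasurable c ?_⟩
    · filter_upwards [hQ] with ω hω using (hgw t ω).trans ((hle.2 ω).trans hω)
    · filter_upwards [hQ] with ω hω using (hSw t ω i).trans ((hle.2 ω).trans hω)
  have main : ∀ t, t ≤ T → ∃ Q : Measure (Fin t → Ω₁), ∃ μ ∈ MeasFam Ω₁ Pt t,
      IsProbabilityMeasure Q ∧ Q ≪ μ ∧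
      (∀ᵐ ω ∂Q, ((g t).1 ω : EReal) < V.F t ω ∧ (Φ t).1 ω ≤ c) ∧ a ≤ ∫ ω, (g t).1 ω ∂Q ∧
      IsMartMeas Ω₁ S Q := by
    intro t
    induction t with
    | zero =>
      intro _
      refine ⟨Measure.dirac Fin.elim0, Measure.dirac Fin.elim0, rfl, inferInstance,
        Measure.AbsolutelyContinuous.rfl, Eventually.of_forall fun ω => ?_, ?_, ?_⟩
      · rw [hg0, Subsingleton.elim ω Fin.elim0]
        exact ⟨ha, le_rfl⟩
      · rw [hg0]
        simp
      · refine ⟨fun t h i => ?_, fun t h => by omega⟩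
        obtain rfl : t = 0 := by omega
        have : (fun ω : Fin 0 → Ω₁ => S 0 (restr Ω₁ 0 h ω) i) = fun _ => S 0 Fin.elim0 i := by
          ext ω
          rw [Subsingleton.elim (restr Ω₁ 0 h ω) Fin.elim0]
        rw [this]
        exact integrable_const _
    | succ t ih =>
      intro ht
      obtain ⟨Q, μ, hμ, hQ, hac, hae, haQ, hmart⟩ := ih (Nat.le_of_succ_le ht)
      have hk := hker t ht
      have := MeasFam.prob hμ
      have hQ' := isProbabilityMeasure_stepM (μ := Q) (measurable_app t) hk.umeas hk.prob
      have hgood : ∀ᵐ ω ∂Q, ω ∈ (V.step t ht).good ∧ ((g t).1 ω : EReal) < V.F t ω := by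
        filter_upwards [hac.ae_le (V.ae_mem_good hS hNA ht hμ), hae] with ω h1 h2 using ⟨h1, h2.1⟩
      have hae' : ∀ᵐ η ∂(stepM (app t) Q (κ t ht)),
          ((g (t + 1)).1 η : EReal) < V.F (t + 1) η ∧ (Φ (t + 1)).1 η ≤ c := by
        have hset : USet {η | ((g (t + 1)).1 η : EReal) < V.F (t + 1) η ∧ (Φ (t + 1)).1 η ≤ c} :=
          MeasurableSet.inter (m := univComp _)
            (USet.lt (measurable_coe_real_ereal.comp (g (t + 1)).2) (V.usa (t + 1)).umeas)
            (USet.le ((Φ (t + 1)).2 ht).1 (UMeas.const c))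
        rw [ae_stepM_iff (measurable_app t) hk.umeas hk.prob hset]
        filter_upwards [hgood, hae] with ω h1 h2
        filter_upwards [hk.ae ω h1.1 h1.2] with x hx using ⟨hx.1, hx.2.trans h2.2⟩
      have hInteg := hbdd (t + 1) ht _ (hae'.mono fun _ h => h.2)
      refine ⟨_, _, MeasFam.step hμ hk.measurable_sel hk.mem, hQ',
        stepM_absolutelyContinuous (measurable_app t) hk.umeas hk.prob
          (umeas_toMeasure hk.measurable_sel) (fun _ => inferInstance) hac hk.ac, hae', ?_, ?_⟩
      · have h2 := integral_stepM (μ := Q) (measurable_app t) hk.umeas hk.prob hInteg.1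
        rw [h2.2]
        refine haQ.trans (integral_mono_ae (hbdd t (Nat.le_of_succ_le ht) Q
          (hae.mono fun _ h => h.2)).1 h2.1 ?_)
        filter_upwards [hgood] with ω hω using hk.le_integral ω hω.1 hω.2
      · refine hmart.step (fun s hs => hS s (hs.trans ht)) hk.umeas hk.prob hInteg.2 ?_
        filter_upwards [hgood] with ω hω using hk.mart ω hω.1 hω.2
  obtain ⟨Q, μ, hμ, hQ, hac, hae, haQ, hmart⟩ := main T le_rfl
  have hφc : ∀ᵐ ω ∂Q, φ ω ≤ c := by
    filter_upwards [hae] with ω hω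
    have h1 := hω.2
    rw [hΦT] at h1
    have h2 := (abs_nonneg _).trans (hgw T ω)
    linarith
  have hfi : Integrable f Q := Integrable.of_bound (V.umeas_claim.aestronglyMeasurable Q) c
    (hφc.mono fun ω h => (hfφ ω).trans h)
  refine ⟨Q, ⟨hQ, ⟨μ, hμ, hac⟩, hmart, fun i => i.elim0⟩, ?_, ?_⟩
  · refine (lintegral_mono_ae (hφc.mono fun ω h => ENNReal.ofReal_le_ofReal h)).trans_lt ?_
    simp
  · rw [expec_eq_integral hfi, EReal.coe_le_coe_iff]
    refine haQ.trans (integral_mono_ae (hbdd T le_rfl Q (hae.mono fun _ h => h.2)).1 hfi ?_)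
    filter_upwards [hae] with ω hω
    have := hω.1
    rw [V.terminal] at this
    exact (EReal.coe_lt_coe_iff.1 this).le

end ValueProcess

section GeneralizedMartingale

variable {Ω : Type*} {m : MeasurableSpace Ω} [mΩ : MeasurableSpace Ω] {Q : Measure Ω} [IsProbabilityMeasure Q]

/-- One step of the fact that a local martingale in discrete time whose terminal value has an
integrable negative part is a true martingale. -/
lemma integrable_step_of_aecover {A : ℕ → Set Ω} (hA : AECover Q atTop A) {X Y : Ω → ℝ}
    (hXm : Measurable X) (hX : ∀ n, IntegrableOn X (A n) Q) (hY : ∀ n, IntegrableOn Y (A n) Q)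
    (heq : ∀ n, ∫ ω in A n, Y ω ∂Q = ∫ ω in A n, X ω ∂Q)
    (heqN : ∀ n, ∫ ω in A n ∩ {ω | X ω < 0}, Y ω ∂Q = ∫ ω in A n ∩ {ω | X ω < 0}, X ω ∂Q)
    (hYneg : Integrable (fun ω => max (-Y ω) 0) Q) :
    Integrable (fun ω => max (-X ω) 0) Q ∧
      (Integrable X Q → Integrable Y Q ∧ ∫ ω, Y ω ∂Q = ∫ ω, X ω ∂Q) := by
  have hN : MeasurableSet {ω | X ω < 0} := measurableSet_lt hXm measurable_const
  constructor
  · refine hA.integrable_of_integral_bounded_of_nonneg_ae (∫ ω, max (-Y ω) 0 ∂Q)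
      (fun n => (hX n).neg_part) (Eventually.of_forall fun ω => le_max_right _ _)
      (Eventually.of_forall fun n => ?_)
    have h1 : (fun ω => max (-X ω) 0) = {ω | X ω < 0}.indicator fun ω => -X ω := by
      ext ω
      by_cases h : X ω < 0
      · rw [indicator_of_mem (show ω ∈ {ω | X ω < 0} from h), max_eq_left (by linarith)]
      · rw [indicator_of_notMem (show ω ∉ {ω | X ω < 0} from h), max_eq_right (by linarith)]
    rw [h1, setIntegral_indicator hN, integral_neg, ← heqN, ← integral_neg]
    calc ∫ ω in A n ∩ {ω | X ω < 0}, -Y ω ∂Q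
        ≤ ∫ ω in A n ∩ {ω | X ω < 0}, max (-Y ω) 0 ∂Q :=
          integral_mono ((hY n).mono_set inter_subset_left).neg hYneg.integrableOn
            fun ω => le_max_left _ _
      _ ≤ ∫ ω, max (-Y ω) 0 ∂Q :=
          setIntegral_le_integral hYneg (Eventually.of_forall fun ω => le_max_right _ _)
  · intro hXi
    have hpos : Integrable (fun ω => max (Y ω) 0) Q := by
      refine hA.integrable_of_integral_bounded_of_nonneg_ae
        (∫ ω, |X ω| ∂Q + ∫ ω, max (-Y ω) 0 ∂Q)
        (fun n => (hY n).pos_part) (Eventually.of_forall fun ω => le_max_right _ _)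
        (Eventually.of_forall fun n => ?_)
      have h1 : ∀ ω, max (Y ω) 0 = Y ω + max (-Y ω) 0 := by
        intro ω
        rcases le_total (Y ω) 0 with h | h
        · rw [max_eq_right h, max_eq_left (by linarith)]
          ring
        · rw [max_eq_left h, max_eq_right (by linarith), add_zero]
      simp only [h1]
      rw [integral_add (hY n) hYneg.integrableOn, heq]
      refine add_le_add ?_ (setIntegral_le_integral hYneg
        (Eventually.of_forall fun ω => le_max_right _ _))
      calc ∫ ω in A n, X ω ∂Q ≤ ∫ ω in A n, |X ω| ∂Q :=
            integral_mono hXi.integrableOn hXi.abs.integrableOn fun ω => le_abs_self _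
        _ ≤ ∫ ω, |X ω| ∂Q :=
          setIntegral_le_integral hXi.abs (Eventually.of_forall fun ω => abs_nonneg _)
    have hYi : Integrable Y Q := by
      refine (hpos.sub hYneg).congr (Eventually.of_forall fun ω => ?_)
      change max (Y ω) 0 - max (-Y ω) 0 = Y ω
      rcases le_total (Y ω) 0 with h | h
      · rw [max_eq_right h, max_eq_left (by linarith)]
        ring
      · rw [max_eq_left h, max_eq_right (by linarith), sub_zero]
    refine ⟨hYi, hA.integral_eq_of_tendsto _ hYi ?_⟩
    simp only [heq]
    exact hA.integral_tendsto_of_countably_generated hXi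

lemma integral_mul_eq_zero_of_setIntegral (hm : m ≤ mΩ) {h D : Ω → ℝ}
    (hD : Integrable D Q) (hD0 : ∀ B, MeasurableSet[m] B → ∫ ω in B, D ω ∂Q = 0)
    (hh : Measurable[m] h) {c : ℝ} (hc : ∀ ω, |h ω| ≤ c) :
    Integrable (fun ω => h ω * D ω) Q ∧ ∫ ω, h ω * D ω ∂Q = 0 := by
  have h1 : (fun _ => (0 : ℝ)) =ᵐ[Q] Q[D | m] :=
    ae_eq_condExp_of_forall_setIntegral_eq hm hD (fun _ _ _ => integrableOn_zero)
      (fun s hs _ => by simp [hD0 s hs]) aestronglyMeasurable_const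
  have h2 := condExp_stronglyMeasurable_mul_of_bound (μ := Q) hm
    (Measurable.stronglyMeasurable hh) hD c (Eventually.of_forall hc)
  refine ⟨hD.bdd_mul (c := c) (hh.mono hm le_rfl).aestronglyMeasurable (Eventually.of_forall hc), ?_⟩
  have h3 := integral_condExp (μ := Q) (f := h * D) hm
  calc ∫ ω, h ω * D ω ∂Q = ∫ ω, (Q[h * D | m]) ω ∂Q := h3.symm
    _ = 0 := by
      refine integral_eq_zero_of_ae ?_
      filter_upwards [h1, h2] with ω h1 h2
      rw [h2, Pi.mul_apply, ← h1]
      simp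

lemma integrable_step {d : ℕ} (hm : m ≤ mΩ) {X : Ω → ℝ}
    {h D : Ω → Fin d → ℝ} (hX : Measurable[m] X) (hh : ∀ i, Measurable[m] fun ω => h ω i)
    (hD : ∀ i, Integrable (fun ω => D ω i) Q)
    (hD0 : ∀ i B, MeasurableSet[m] B → ∫ ω in B, D ω i ∂Q = 0)
    (hneg : Integrable (fun ω => max (-(X ω + ∑ i, h ω i * D ω i)) 0) Q) :
    Integrable (fun ω => max (-X ω) 0) Q ∧
      (Integrable X Q → Integrable (fun ω => X ω + ∑ i, h ω i * D ω i) Q ∧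
        ∫ ω, X ω + ∑ i, h ω i * D ω i ∂Q = ∫ ω, X ω ∂Q) := by
  classical
  let A : ℕ → Set Ω := fun n => {ω | |X ω| ≤ n} ∩ ⋂ i, {ω | |h ω i| ≤ n}
  have hAm : ∀ n, MeasurableSet[m] (A n) := fun n =>
    MeasurableSet.inter (m := m) (measurableSet_le (mδ := m) (measurable_norm.comp hX)
      (@measurable_const _ _ _ m _)) (MeasurableSet.iInter (m := m) fun i =>
        measurableSet_le (mδ := m) (measurable_norm.comp (hh i)) (@measurable_const _ _ _ m _))
  have hA : AECover Q atTop A := by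
    refine ⟨Eventually.of_forall fun ω => ?_, fun n => hm _ (hAm n)⟩
    obtain ⟨N, hN⟩ := exists_nat_ge (|X ω| + ∑ i, |h ω i|)
    filter_upwards [eventually_ge_atTop N] with n hn
    have hn' : (N : ℝ) ≤ n := by exact_mod_cast hn
    have hs : 0 ≤ ∑ i, |h ω i| := Finset.sum_nonneg fun i _ => abs_nonneg _
    refine ⟨show |X ω| ≤ n by linarith, mem_iInter.2 fun i => show |h ω i| ≤ n from ?_⟩
    have := Finset.single_le_sum (f := fun i => |h ω i|) (fun i _ => abs_nonneg _)
      (Finset.mem_univ i)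
    linarith [abs_nonneg (X ω)]
  have key : ∀ n B, MeasurableSet[m] B → B ⊆ A n → IntegrableOn X B Q ∧
      IntegrableOn (fun ω => X ω + ∑ i, h ω i * D ω i) B Q ∧
      ∫ ω in B, X ω + ∑ i, h ω i * D ω i ∂Q = ∫ ω in B, X ω ∂Q := by
    intro n B hB hBA
    have hXB : IntegrableOn X B Q := by
      refine Integrable.of_bound (hX.mono hm le_rfl).aestronglyMeasurable n ?_
      exact (ae_restrict_iff' (hm _ hB)).2 (Eventually.of_forall fun ω hω => (hBA hω).1)
    have hi : ∀ i, IntegrableOn (fun ω => h ω i * D ω i) B Q ∧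
        ∫ ω in B, h ω i * D ω i ∂Q = 0 := by
      intro i
      have h1 := integral_mul_eq_zero_of_setIntegral hm (hD i) (hD0 i)
        (Measurable.indicator (m := m) (hh i) hB) (c := n) (fun ω => by
          by_cases hω : ω ∈ B
          · rw [indicator_of_mem hω]
            exact mem_iInter.1 (hBA hω).2 i
          · rw [indicator_of_notMem hω]
            simp)
      have h2 : (fun ω => B.indicator (fun ω => h ω i) ω * D ω i) =
          B.indicator fun ω => h ω i * D ω i := by
        ext ω
        by_cases hω : ω ∈ B <;> simp [hω]
      rw [h2, integrable_indicator_iff (hm _ hB), integral_indicator (hm _ hB)] at h1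
      exact h1
    have hsum : IntegrableOn (fun ω => ∑ i, h ω i * D ω i) B Q :=
      integrable_finsetSum _ fun i _ => (hi i).1
    refine ⟨hXB, hXB.add hsum, ?_⟩
    rw [integral_add hXB hsum, integral_finsetSum _ fun i _ => (hi i).1]
    simp [fun i => (hi i).2]
  exact integrable_step_of_aecover hA (hX.mono hm le_rfl) (fun n => (key n _ (hAm n) subset_rfl).1)
    (fun n => (key n _ (hAm n) subset_rfl).2.1) (fun n => (key n _ (hAm n) subset_rfl).2.2)
    (fun n => (key n _ (MeasurableSet.inter (m := m) (hAm n) (measurableSet_lt (mδ := m) hX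
      (@measurable_const _ _ _ m _))) inter_subset_left).2.2) hneg

end GeneralizedMartingale

section WeakDuality

variable {Ω₁ : Type} [MeasurableSpace Ω₁] [TopologicalSpace Ω₁] [PolishSpace Ω₁] [BorelSpace Ω₁]
  {T d : ℕ} {S : (t : ℕ) → (Fin t → Ω₁) → Fin d → ℝ}
  {H : (u : ℕ) → (Fin u → Ω₁) → Fin d → ℝ}

lemma gain_succ {t : ℕ} (ht : t + 1 ≤ T) (ω : Fin T → Ω₁) :
    gain Ω₁ S H (t + 1) ht ω = gain Ω₁ S H t (Nat.le_of_succ_le ht) ω +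
      ∑ i, H t (restr Ω₁ t (Nat.le_of_succ_le ht) ω) i *
        (S (t + 1) (restr Ω₁ (t + 1) ht ω) i - S t (restr Ω₁ t (Nat.le_of_succ_le ht) ω) i) := by
  rw [gain, Fin.sum_univ_castSucc]
  rfl

lemma measurable_gain (hS : ∀ t, t ≤ T → Measurable (S t)) (hH : ∀ u, Measurable (H u)) {t : ℕ}
    (h : t ≤ T) : Measurable (gain Ω₁ S H t h) := by
  refine Finset.measurable_fun_sum _ fun u _ => Finset.measurable_fun_sum _ fun i _ => ?_
  exact ((measurable_pi_apply i).comp ((hH u).comp (measurable_restr _))).mul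
      ((((measurable_pi_apply i).comp (hS _ (Nat.succ_le_of_lt (u.2.trans_le h)))).comp
        (measurable_restr _)).sub
        (((measurable_pi_apply i).comp (hS _ (u.2.le.trans h))).comp (measurable_restr _)))

lemma exists_measurable_strategy (hH : Pred Ω₁ d H) (Q : Measure (Fin T → Ω₁))
    [IsProbabilityMeasure Q] : ∃ H' : (u : ℕ) → (Fin u → Ω₁) → Fin d → ℝ,
      (∀ u, Measurable (H' u)) ∧
        ∀ᵐ ω ∂Q, gain Ω₁ S H T le_rfl ω = gain Ω₁ S H' T le_rfl ω := by
  have hex : ∀ u, ∃ h' : (Fin u → Ω₁) → Fin d → ℝ, Measurable h' ∧ ∀ hu : u ≤ T,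
      ∀ᵐ ω ∂Q, H u (restr Ω₁ u hu ω) = h' (restr Ω₁ u hu ω) := by
    intro u
    by_cases hu : u ≤ T
    · have := Measure.isProbabilityMeasure_map (μ := Q) (measurable_restr hu).aemeasurable
      have hHu : UMeas (H u) := hH u
      obtain ⟨h', hm, hae⟩ := hHu.aemeasurable (Q.map (restr Ω₁ u hu))
      exact ⟨h', hm, fun _ => ae_of_ae_map (measurable_restr hu).aemeasurable hae⟩
    · exact ⟨fun _ => 0, measurable_const, fun h => absurd h hu⟩
  choose H' hm hae using hex
  refine ⟨H', hm, ?_⟩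
  have hall : ∀ᵐ ω ∂Q, ∀ u : Fin T, H u (restr Ω₁ u u.2.le ω) = H' u (restr Ω₁ u u.2.le ω) :=
    ae_all_iff.2 fun u => hae u u.2.le
  filter_upwards [hall] with ω hω
  exact Finset.sum_congr rfl fun u _ => Finset.sum_congr rfl fun i _ => by rw [hω u]

lemma integral_gain_eq_zero (hS : ∀ t, t ≤ T → Measurable (S t)) (hH : ∀ u, Measurable (H u))
    {Q : Measure (Fin T → Ω₁)} [IsProbabilityMeasure Q] (hQ : IsMartMeas Ω₁ S Q) {t : ℕ}
    (ht : t ≤ T) (hneg : Integrable (fun ω => max (-gain Ω₁ S H t ht ω) 0) Q) :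
    Integrable (gain Ω₁ S H t ht) Q ∧ ∫ ω, gain Ω₁ S H t ht ω ∂Q = 0 := by
  induction t with
  | zero =>
    have : gain Ω₁ S H 0 ht = fun _ => 0 := by
      ext ω
      simp [gain]
    rw [this]
    exact ⟨integrable_const 0, by simp⟩
  | succ t ih =>
    have ht' : t ≤ T := Nat.le_of_succ_le ht
    have hD : ∀ i, Integrable (fun ω => S (t + 1) (restr Ω₁ (t + 1) ht ω) i -
        S t (restr Ω₁ t ht' ω) i) Q := fun i => (hQ.1 (t + 1) ht i).sub (hQ.1 t ht' i)
    have hr := comap_measurable (m := MeasurableSpace.pi) (restr Ω₁ t ht')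
    simp only [gain_succ] at hneg
    have hstep := integrable_step
      (m := MeasurableSpace.comap (restr Ω₁ t ht') MeasurableSpace.pi)
      (measurable_restr ht').comap_le (X := gain Ω₁ S H t ht')
      (h := fun ω => H t (restr Ω₁ t ht' ω))
      (D := fun ω i => S (t + 1) (restr Ω₁ (t + 1) ht ω) i - S t (restr Ω₁ t ht' ω) i)
      ((measurable_gain (fun s hs => hS s (hs.trans ht')) hH le_rfl).comp hr)
      (fun i => (measurable_pi_apply i).comp ((hH t).comp hr)) hD (fun i B hB => ?_) hneg
    · obtain ⟨h1, h2⟩ := ih ht' hstep.1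
      obtain ⟨h3, h4⟩ := hstep.2 h1
      have : gain Ω₁ S H (t + 1) ht = fun ω => gain Ω₁ S H t ht' ω +
          ∑ i, H t (restr Ω₁ t ht' ω) i *
            (S (t + 1) (restr Ω₁ (t + 1) ht ω) i - S t (restr Ω₁ t ht' ω) i) :=
        funext fun ω => gain_succ ht ω
      rw [this]
      exact ⟨h3, h4.trans h2⟩
    · obtain ⟨B', hB', rfl⟩ := hB
      rw [integral_sub (hQ.1 (t + 1) ht i).integrableOn (hQ.1 t ht' i).integrableOn, sub_eq_zero]
      exact hQ.2 t ht i _ ⟨B', USet.of_measurable hB', rfl⟩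

/-- Weak duality. -/
lemma expec_le_of_superhedge (hS : ∀ t, t ≤ T → Measurable (S t)) (hH : Pred Ω₁ d H)
    {Q : Measure (Fin T → Ω₁)} [IsProbabilityMeasure Q] (hQ : IsMartMeas Ω₁ S Q)
    {f : (Fin T → Ω₁) → ℝ} (hf : Integrable f Q) {x : ℝ}
    (hx : ∀ᵐ ω ∂Q, f ω ≤ x + gain Ω₁ S H T le_rfl ω) : expec Q f ≤ x := by
  obtain ⟨H', hm, hae⟩ := exists_measurable_strategy (S := S) hH Q
  have hx' : ∀ᵐ ω ∂Q, f ω ≤ x + gain Ω₁ S H' T le_rfl ω := by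
    filter_upwards [hx, hae] with ω h1 h2
    rwa [← h2]
  obtain ⟨h1, h2⟩ := integral_gain_eq_zero hS hm hQ le_rfl (by
    refine Integrable.mono' (hf.abs.add (integrable_const |x|))
      ((measurable_gain hS hm le_rfl).neg.max measurable_const).aestronglyMeasurable ?_
    filter_upwards [hx'] with ω hω
    rw [Real.norm_of_nonneg (le_max_right _ _)]
    refine max_le ?_ (add_nonneg (abs_nonneg _) (abs_nonneg _))
    change _ ≤ |f ω| + |x|
    linarith [neg_abs_le (f ω), le_abs_self x])
  rw [expec_eq_integral hf, EReal.coe_le_coe_iff]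
  calc ∫ ω, f ω ∂Q ≤ ∫ ω, x + gain Ω₁ S H' T le_rfl ω ∂Q :=
        integral_mono_ae hf ((integrable_const x).add h1) hx'
    _ = x := by
      rw [integral_add (integrable_const x) h1, h2]
      simp

end WeakDuality

end BN

open BN in
/-- **Multi-period Superhedging Theorem without options** (Theorem 4.7). Under
`NA(𝒫)`, for a weight function `φ ≥ 1` and upper semianalytic `f` with `|f| ≤ φ`,
the superhedging price equals `sup_{Q ∈ 𝒬_φ} E_Q[f]`, where
`𝒬_φ = {Q ∈ 𝒬 : E_Q[φ] < ∞}`. -/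
theorem multi_period_superhedging_no_options
    (Ω₁ : Type) [MeasurableSpace Ω₁] [TopologicalSpace Ω₁] [PolishSpace Ω₁]
    [BorelSpace Ω₁] [Nonempty Ω₁] (T d : ℕ)
    (Pt : (t : ℕ) → (Fin t → Ω₁) → Set (ProbabilityMeasure Ω₁))
    (hPtne : ∀ t, t < T → ∀ ω, (Pt t ω).Nonempty)
    (hPtconv : ∀ t, t < T → ∀ ω, ConvexPM (Pt t ω))
    (hPtgraph : ∀ t, t < T →
      AnalyticSet {p : (Fin t → Ω₁) × ProbabilityMeasure Ω₁ | p.2 ∈ Pt t p.1})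
    (S : (t : ℕ) → (Fin t → Ω₁) → Fin d → ℝ) (hS : ∀ t, t ≤ T → Measurable (S t))
    (hNA : NA Ω₁ (MeasFam Ω₁ Pt T) S (fun i : Fin 0 => i.elim0))
    (φ : (Fin T → Ω₁) → ℝ) (hφmeas : @Measurable _ _ (univComp (Fin T → Ω₁)) _ φ)
    (hφ1 : ∀ ω, 1 ≤ φ ω)
    (f : (Fin T → Ω₁) → ℝ) (hf : UpperSemianalytic f) (hfφ : ∀ ω, |f ω| ≤ φ ω) :
    sSup ((fun Q => expec Q f) ''
        {Q ∈ QSet Ω₁ (MeasFam Ω₁ Pt T) S (fun i : Fin 0 => i.elim0) |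
          (∫⁻ ω, ENNReal.ofReal (φ ω) ∂Q) < ⊤})
      = superPrice Ω₁ (MeasFam Ω₁ Pt T) S (fun i : Fin 0 => i.elim0) f := by
  obtain ⟨V⟩ := nonempty_valueProcess hPtne hPtconv hPtgraph hS hf
  apply le_antisymm
  · refine sSup_le ?_
    rintro _ ⟨Q, ⟨⟨hQ, ⟨P, hP, hQP⟩, hmart, -⟩, hQφ⟩, rfl⟩
    refine le_sInf ?_
    rintro _ ⟨x, ⟨H, h, hH, hx⟩, rfl⟩
    simp only [Finset.univ_eq_empty, Finset.sum_empty, add_zero] at hx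
    refine expec_le_of_superhedge hS hH hmart
      ⟨V.umeas_claim.aestronglyMeasurable Q, lt_of_le_of_lt (lintegral_mono fun ω => ?_) hQφ⟩
      (hQP.ae_le (hx.ae hP))
    rw [← ofReal_norm]
    exact ENNReal.ofReal_le_ofReal (hfφ ω)
  · have hle : superPrice Ω₁ (MeasFam Ω₁ Pt T) S (fun i : Fin 0 => i.elim0) f ≤
        V.F 0 Fin.elim0 := by
      obtain ⟨ω, hω⟩ := (V.ae_ne_bot hS hNA (Nat.zero_le T) (Measure.dirac Fin.elim0) rfl).exists
      rw [Subsingleton.elim ω Fin.elim0] at hω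
      rcases eq_or_ne (V.F 0 Fin.elim0) ⊤ with htop | htop
      · rw [htop]
        exact le_top
      · have ha := (EReal.coe_toReal htop hω).symm
        exact (V.superPrice_le hS hNA ha).trans ha.ge
    refine hle.trans (le_of_forall_lt fun c hc => ?_)
    obtain ⟨a, hca, haF⟩ := EReal.lt_iff_exists_real_btwn.1 hc
    obtain ⟨Q, hQ, hQφ, haQ⟩ := V.exists_martingale_measure hS hNA hφmeas hfφ haF
    exact hca.trans_le (haQ.trans (le_sSup ⟨Q, ⟨hQ, hQφ⟩, rfl⟩))
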